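/- arXiv:2102.12012 — 3 statements merged into one kernel-verified Lean document; each statement's English description precedes it below -/
import Mathlib

section
/- For every constant ε > 0 and every constant c > 0 the following holds. For each n, let G = G(n) be a d-regular, λ-edge-connected graph on n vertices with d ≥ λ ≥ c·n, and let p = (2 + ε)·(log n)/d. Form the random subgraph G_p by keeping each edge of G independently with probability p, and then color each edge of G_p independently and uniformly at random from the color set {1, …, n−1}. Then the probability that the resulting edge-colored graph contains a rainbow spanning tree tends to 1 as n → ∞. -/
open Finset SimpleGraph Filter
open scoped Classical

/-- The edge-cut of `G` determined by a vertex set `A`: the edges of `G` with exactly one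
endpoint in `A`. -/
noncomputable def edgeCut {n : ℕ} (G : SimpleGraph (Fin n)) (A : Finset (Fin n)) :
    Finset (Sym2 (Fin n)) :=
  G.edgeFinset.filter fun e => ∃ u v, e = s(u, v) ∧ u ∈ A ∧ v ∉ A

/-- The probability that the random subgraph of `G` obtained by keeping each edge
independently with probability `p`, with every (potential) edge colored independently and
uniformly at random from the `n - 1` colors `Fin (n - 1)`, satisfies the property `P`
(as a function of the set of kept edges and of the coloring). -/
noncomputable def prColored (n : ℕ) (G : SimpleGraph (Fin n)) (p : ℝ)
    (P : Finset (Sym2 (Fin n)) → (Sym2 (Fin n) → Fin (n - 1)) → Prop) : ℝ :=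
  ∑ H ∈ G.edgeFinset.powerset, ∑ φ : Sym2 (Fin n) → Fin (n - 1),
    p ^ H.card * (1 - p) ^ (G.edgeFinset.card - H.card) *
      (1 / (n - 1 : ℝ)) ^ Fintype.card (Sym2 (Fin n)) *
      (if P H φ then 1 else 0)

/-- The edge-colored graph given by the kept edges `H` and the coloring `φ` contains a
rainbow spanning tree. -/
def HasRainbowSpanningTree {n : ℕ} (H : Finset (Sym2 (Fin n)))
    (φ : Sym2 (Fin n) → Fin (n - 1)) : Prop :=
  ∃ T ⊆ H, (SimpleGraph.fromEdgeSet (T : Set (Sym2 (Fin n)))).IsTree ∧ Set.InjOn φ ↑T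

/-- **Rado's theorem** for vectors. -/
theorem exists_linearIndependent_transversal {K M ι : Type*} [Field K] [AddCommGroup M]
    [Module K M] [FiniteDimensional K M] [Fintype ι] (A : ι → Finset M)
    (h : ∀ J : Finset ι,
      J.card ≤ Module.finrank K (⨆ i ∈ J, Submodule.span K (A i : Set M) : Submodule K M)) :
    ∃ a : ι → M, (∀ i, a i ∈ A i) ∧ LinearIndependent K a := by
  induction hN : ∑ i, (A i).card using Nat.strong_induction_on generalizing A with
  | _ N ih =>
  subst hN
  by_cases hA : ∀ i, (A i).card ≤ 1
  · have hne : ∀ i, ∃ x, A i = {x} := by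
      intro i
      rcases Nat.le_one_iff_eq_zero_or_eq_one.1 (hA i) with h0 | h1
      · have := h {i}
        rw [Finset.card_eq_zero] at h0
        simp [h0] at this
      · exact Finset.card_eq_one.1 h1
    choose a ha using hne
    refine ⟨a, fun i => by simp [ha i], ?_⟩
    rw [linearIndependent_iff_card_le_finrank_span]
    have hsup : (⨆ i ∈ univ, Submodule.span K (A i : Set M)) = Submodule.span K (Set.range a) := by
      simp only [mem_univ, iSup_pos, ← Submodule.span_iUnion, ha, Finset.coe_singleton,
        Set.iUnion_singleton_eq_range]
    have := h univ
    rw [hsup] at this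
    simpa [Set.finrank] using this
  · push Not at hA
    obtain ⟨i, hi⟩ := hA
    obtain ⟨x, hx, y, hy, hxy⟩ := Finset.one_lt_card.1 hi
    have red : ∀ z ∈ A i, (∀ J : Finset ι, J.card ≤ Module.finrank K
          (⨆ j ∈ J, Submodule.span K (Function.update A i ((A i).erase z) j : Set M) :
            Submodule K M)) →
        ∃ a : ι → M, (∀ i, a i ∈ A i) ∧ LinearIndependent K a := by
      intro z hz hJ
      have hlt : ∑ j, (Function.update A i ((A i).erase z) j).card < ∑ j, (A j).card := by
        refine Finset.sum_lt_sum (fun j _ => ?_) ⟨i, mem_univ _, ?_⟩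
        · by_cases hj : j = i
          · subst hj; simpa using Finset.card_le_card (Finset.erase_subset _ _)
          · simp [hj]
        · simpa using Finset.card_erase_lt_of_mem hz
      obtain ⟨a, ha, hli⟩ := ih _ hlt _ hJ rfl
      refine ⟨a, fun j => ?_, hli⟩
      have := ha j
      by_cases hj : j = i
      · subst hj
        rw [Function.update_self] at this
        exact Finset.mem_of_mem_erase this
      · simpa [hj] using this
    by_contra hcon
    have bad : ∀ z ∈ A i, ∃ J : Finset ι, i ∈ J ∧ Module.finrank K
          (⨆ j ∈ J, Submodule.span K (Function.update A i ((A i).erase z) j : Set M) :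
            Submodule K M) < J.card := by
      intro z hz
      by_contra hb
      push Not at hb
      refine hcon (red z hz fun J => ?_)
      by_cases hJ : i ∈ J
      · exact hb J hJ
      · refine (h J).trans (Submodule.finrank_mono (iSup₂_mono fun j hj => ?_))
        have hji : j ≠ i := by rintro rfl; exact hJ hj
        rw [Function.update_of_ne hji]
    obtain ⟨J₁, hi₁, h₁⟩ := bad x hx
    obtain ⟨J₂, hi₂, h₂⟩ := bad y hy
    set U₁ : Submodule K M :=
      ⨆ j ∈ J₁, Submodule.span K (Function.update A i ((A i).erase x) j : Set M) with hU₁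
    set U₂ : Submodule K M :=
      ⨆ j ∈ J₂, Submodule.span K (Function.update A i ((A i).erase y) j : Set M) with hU₂
    have key₁ : ∀ j ∈ J₁, j ≠ i → Submodule.span K (A j : Set M) ≤ U₁ := by
      intro j hj hji
      refine le_trans ?_ (le_iSup₂ (f := fun j (_ : j ∈ J₁) =>
        Submodule.span K (Function.update A i ((A i).erase x) j : Set M)) j hj)
      rw [Function.update_of_ne hji]
    have key₂ : ∀ j ∈ J₂, j ≠ i → Submodule.span K (A j : Set M) ≤ U₂ := by
      intro j hj hji
      refine le_trans ?_ (le_iSup₂ (f := fun j (_ : j ∈ J₂) =>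
        Submodule.span K (Function.update A i ((A i).erase y) j : Set M)) j hj)
      rw [Function.update_of_ne hji]
    have key₃ : Submodule.span K (A i : Set M) ≤ U₁ ⊔ U₂ := by
      rw [Submodule.span_le]
      intro z hz
      by_cases hzx : z = x
      · refine Submodule.mem_sup_right ?_
        refine (le_iSup₂ (f := fun j (_ : j ∈ J₂) =>
          Submodule.span K (Function.update A i ((A i).erase y) j : Set M)) i hi₂) ?_
        rw [Function.update_self]
        exact Submodule.subset_span (Finset.mem_erase.2 ⟨hzx ▸ hxy, hz⟩)
      · refine Submodule.mem_sup_left ?_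
        refine (le_iSup₂ (f := fun j (_ : j ∈ J₁) =>
          Submodule.span K (Function.update A i ((A i).erase x) j : Set M)) i hi₁) ?_
        rw [Function.update_self]
        exact Submodule.subset_span (Finset.mem_erase.2 ⟨hzx, hz⟩)
    have hsup : (J₁ ∪ J₂).card ≤ Module.finrank K (U₁ ⊔ U₂ : Submodule K M) := by
      refine (h _).trans (Submodule.finrank_mono (iSup₂_le fun j hj => ?_))
      by_cases hji : j = i
      · exact hji ▸ key₃
      · rcases Finset.mem_union.1 hj with hj | hj
        · exact (key₁ j hj hji).trans le_sup_left
        · exact (key₂ j hj hji).trans le_sup_right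
    have hinf : ((J₁ ∩ J₂).erase i).card ≤ Module.finrank K (U₁ ⊓ U₂ : Submodule K M) := by
      refine (h _).trans (Submodule.finrank_mono (iSup₂_le fun j hj => ?_))
      simp only [Finset.mem_erase, Finset.mem_inter] at hj
      exact le_inf (key₁ j hj.2.1 hj.1) (key₂ j hj.2.2 hj.1)
    have e₁ := Submodule.finrank_sup_add_finrank_inf_eq U₁ U₂
    have e₂ := Finset.card_union_add_card_inter J₁ J₂
    rw [Finset.card_erase_of_mem (Finset.mem_inter.2 ⟨hi₁, hi₂⟩)] at hinf
    omega

/-- The vector over `ZMod 2` of a potential edge: the sum of the unit vectors of its endpoints. -/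
noncomputable def edgeVec {n : ℕ} : Sym2 (Fin n) → (Fin n → ZMod 2) :=
  Sym2.lift ⟨fun u v => Pi.single u 1 + Pi.single v 1, fun _ _ => add_comm _ _⟩

/-- The cycle-matroid span of a set of edges. -/
noncomputable def edgeSpan {n : ℕ} (F : Finset (Sym2 (Fin n))) :
    Submodule (ZMod 2) (Fin n → ZMod 2) :=
  Submodule.span (ZMod 2) (edgeVec '' (F : Set (Sym2 (Fin n))))

theorem edgeVec_mk {n : ℕ} (u v : Fin n) :
    edgeVec s(u, v) = Pi.single u 1 + Pi.single v 1 := rfl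

/-- A functional that vanishes on the edges of `F` vanishes on their span. -/
theorem map_eq_zero_of_mem_edgeSpan {n : ℕ} {F : Finset (Sym2 (Fin n))}
    (f : (Fin n → ZMod 2) →ₗ[ZMod 2] ZMod 2) (hf : ∀ e ∈ F, f (edgeVec e) = 0)
    {x : Fin n → ZMod 2} (hx : x ∈ edgeSpan F) : f x = 0 := by
  have : edgeSpan F ≤ LinearMap.ker f := by
    refine Submodule.span_le.2 ?_
    rintro _ ⟨e, he, rfl⟩
    exact hf e he
  exact this hx

theorem sum_edgeVec {n : ℕ} (A : Finset (Fin n)) (u v : Fin n) :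
    ∑ w ∈ A, edgeVec s(u, v) w = (if u ∈ A then 1 else 0) + (if v ∈ A then 1 else 0) := by
  simp [edgeVec_mk, Finset.sum_add_distrib, Pi.single_apply]

theorem edgeVec_mem_edgeSpan_trans {n : ℕ} {F : Finset (Sym2 (Fin n))} {u v w : Fin n}
    (h₁ : edgeVec s(u, v) ∈ edgeSpan F) (h₂ : edgeVec s(v, w) ∈ edgeSpan F) :
    edgeVec s(u, w) ∈ edgeSpan F := by
  have := Submodule.add_mem _ h₁ h₂
  convert this using 1
  simp only [edgeVec_mk]
  have h2 : (Pi.single v 1 : Fin n → ZMod 2) + Pi.single v 1 = 0 :=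
    funext fun _ => CharTwo.add_self_eq_zero _
  rw [add_assoc, ← add_assoc (Pi.single v 1), h2, zero_add]

/-- The sum of the coordinates in `A`, as a functional. -/
noncomputable def sumOn {n : ℕ} (A : Finset (Fin n)) : (Fin n → ZMod 2) →ₗ[ZMod 2] ZMod 2 :=
  ∑ w ∈ A, LinearMap.proj w

theorem sumOn_apply {n : ℕ} (A : Finset (Fin n)) (x : Fin n → ZMod 2) :
    sumOn A x = ∑ w ∈ A, x w := by
  simp [sumOn]

/-- `n - 1` independent edge vectors are those of a spanning tree. -/
theorem isTree_of_linearIndependent {n : ℕ} (hn : 0 < n) {ι : Type*} [Fintype ι]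
    (hι : Fintype.card ι = n - 1) (e : ι → Sym2 (Fin n)) (hd : ∀ i, ¬ (e i).IsDiag)
    (hli : LinearIndependent (ZMod 2) fun i => edgeVec (e i)) :
    (SimpleGraph.fromEdgeSet ((univ.image e : Finset _) : Set (Sym2 (Fin n)))).IsTree := by
  have : Nonempty (Fin n) := ⟨⟨0, hn⟩⟩
  set T : Finset (Sym2 (Fin n)) := univ.image e with hT
  have hinj : Function.Injective e := fun i j hij => hli.injective (by simp [hij])
  have hspan : Set.range (fun i => edgeVec (e i)) = edgeVec '' (T : Set (Sym2 (Fin n))) := by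
    ext x; simp [hT]
  have hker : edgeSpan T ≤ LinearMap.ker (sumOn (univ : Finset (Fin n))) := by
    refine Submodule.span_le.2 ?_
    rintro _ ⟨e, -, rfl⟩
    induction e with | _ u v =>
    simp only [SetLike.mem_coe, LinearMap.mem_ker, sumOn_apply, sum_edgeVec]
    simpa using CharTwo.add_self_eq_zero (1 : ZMod 2)
  have hsurj : LinearMap.range (sumOn (univ : Finset (Fin n))) = ⊤ := by
    rw [LinearMap.range_eq_top]
    intro c
    exact ⟨Pi.single ⟨0, hn⟩ c, by simp [sumOn_apply]⟩
  have hfr := LinearMap.finrank_range_add_finrank_ker (sumOn (univ : Finset (Fin n)))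
  rw [hsurj, finrank_top, Module.finrank_self, Module.finrank_fin_fun] at hfr
  have hT1 : Module.finrank (ZMod 2) (edgeSpan T) = n - 1 := by
    rw [edgeSpan, ← hspan, finrank_span_eq_card hli, hι]
  have heq : edgeSpan T = LinearMap.ker (sumOn (univ : Finset (Fin n))) :=
    Submodule.eq_of_le_of_finrank_eq hker (by omega)
  rw [SimpleGraph.isTree_iff_connected_and_card]
  constructor
  · refine SimpleGraph.connected_iff_exists_forall_reachable _ |>.2 ⟨⟨0, hn⟩, fun w => ?_⟩
    by_contra hw
    set Γ := SimpleGraph.fromEdgeSet (T : Set (Sym2 (Fin n))) with hΓ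
    set A : Finset (Fin n) := univ.filter fun v => Γ.Reachable ⟨0, hn⟩ v with hA
    have hmem : edgeVec s(⟨0, hn⟩, w) ∈ edgeSpan T := by
      rw [heq, LinearMap.mem_ker, sumOn_apply, sum_edgeVec]
      simpa using CharTwo.add_self_eq_zero (1 : ZMod 2)
    have h0 := map_eq_zero_of_mem_edgeSpan (sumOn A) (fun e he => ?_) hmem
    · rw [sumOn_apply, sum_edgeVec] at h0
      simp [hA, hw] at h0
    · induction e with | _ u v =>
      have hiff : u ∈ A ↔ v ∈ A := by
        by_cases huv : u = v
        · rw [huv]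
        have hadj : Γ.Adj u v := by rw [hΓ, SimpleGraph.fromEdgeSet_adj]; exact ⟨he, huv⟩
        simp only [hA, mem_filter, mem_univ, true_and]
        exact ⟨fun h => h.trans hadj.reachable, fun h => h.trans hadj.symm.reachable⟩
      rw [sumOn_apply, sum_edgeVec]
      by_cases hu : u ∈ A
      · simpa [hu, ← hiff] using CharTwo.add_self_eq_zero (1 : ZMod 2)
      · simp [hu, ← hiff]
  · rw [SimpleGraph.edgeSet_fromEdgeSet]
    have : (T : Set (Sym2 (Fin n))) \ Sym2.diagSet = T := by
      refine sdiff_eq_left.2 (Set.disjoint_left.2 ?_)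
      rintro x hx hx'
      simp only [hT, coe_image, coe_univ, Set.image_univ, Set.mem_range] at hx
      obtain ⟨i, rfl⟩ := hx
      exact hd i hx'
    rw [this]
    have hTc : T.card = n - 1 := by
      rw [hT, Finset.card_image_of_injective _ hinj, card_univ, hι]
    rw [Nat.card_coe_set_eq, Set.ncard_coe_finset, hTc, Nat.card_fin]
    omega

/-- A failure of Rado's condition: if there is no rainbow spanning tree, then some set `S` of
colors spans a graph of rank less than `|S|`. -/
theorem exists_deficient_colors {n : ℕ} (hn : 0 < n) (G : SimpleGraph (Fin n))
    {H : Finset (Sym2 (Fin n))} (hH : H ⊆ G.edgeFinset) {φ : Sym2 (Fin n) → Fin (n - 1)}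
    (h : ¬ HasRainbowSpanningTree H φ) :
    ∃ (S : Finset (Fin (n - 1))) (F : Finset (Sym2 (Fin n))), F ⊆ H ∧ F.card < S.card ∧
      (∀ e ∈ F, φ e ∈ S) ∧ ∀ e ∈ H, φ e ∈ S → edgeVec e ∈ edgeSpan F := by
  by_contra hcon
  refine h ?_
  obtain ⟨a, ha, hli⟩ := exists_linearIndependent_transversal (K := ZMod 2)
    (fun i : Fin (n - 1) => (H.filter fun e => φ e = i).image edgeVec) fun J => by
      by_contra hJ
      push Not at hJ
      have hsup : (⨆ i ∈ J, Submodule.span (ZMod 2)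
          (((H.filter fun e => φ e = i).image edgeVec : Finset _) : Set (Fin n → ZMod 2))) =
          Submodule.span (ZMod 2) (edgeVec '' ((H.filter fun e => φ e ∈ J : Finset _) :
            Set (Sym2 (Fin n)))) := by
        simp only [← Submodule.span_iUnion]
        congr 1
        ext x
        simp only [Set.mem_iUnion, coe_image, Set.mem_image, coe_filter, Set.mem_ofPred_eq]
        constructor
        · rintro ⟨i, hi, e, ⟨he, rfl⟩, rfl⟩
          exact ⟨e, ⟨he, hi⟩, rfl⟩
        · rintro ⟨e, ⟨he, hi⟩, rfl⟩
          exact ⟨_, hi, e, ⟨he, rfl⟩, rfl⟩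
      rw [hsup] at hJ
      obtain ⟨b, hb, hbs, hbl⟩ := exists_linearIndependent (ZMod 2)
        (edgeVec '' ((H.filter fun e => φ e ∈ J : Finset _) : Set (Sym2 (Fin n))))
      obtain ⟨F, hF, hFb⟩ := Set.SurjOn.exists_bijOn_subset (f := edgeVec)
        (s := ((H.filter fun e => φ e ∈ J : Finset _) : Set (Sym2 (Fin n)))) (t := b) hb
      have hspan : edgeSpan F.toFinset = Submodule.span (ZMod 2)
          (edgeVec '' ((H.filter fun e => φ e ∈ J : Finset _) : Set (Sym2 (Fin n)))) := by
        rw [edgeSpan, Set.coe_toFinset, hFb.image_eq, hbs]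
      refine hcon ⟨J, F.toFinset, fun e he => ?_, ?_, fun e he => ?_, fun e he hJe => ?_⟩
      · exact (mem_filter.1 (hF (Set.mem_toFinset.1 he))).1
      · refine lt_of_eq_of_lt ?_ hJ
        have hli' : LinearIndependent (ZMod 2) fun x : F => edgeVec (x : Sym2 (Fin n)) := by
          have := hbl.comp (fun x : F => (⟨edgeVec x, hFb.mapsTo x.2⟩ : b)) (fun x y hxy =>
            Subtype.ext (hFb.injOn x.2 y.2 (congrArg Subtype.val hxy)))
          exact this
        have hr : Set.range (fun x : F => edgeVec (x : Sym2 (Fin n))) = edgeVec '' F := by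
          ext; simp
        have := finrank_span_eq_card hli'
        rw [hr, hFb.image_eq, hbs] at this
        rw [this, Set.toFinset_card]
      · exact (mem_filter.1 (hF (Set.mem_toFinset.1 he))).2
      · rw [hspan]
        exact Submodule.subset_span ⟨e, by simpa using ⟨he, hJe⟩, rfl⟩
  have ha' : ∀ i, ∃ e, e ∈ H ∧ φ e = i ∧ edgeVec e = a i := fun i => by
    obtain ⟨e, he, hea⟩ := Finset.mem_image.1 (ha i)
    exact ⟨e, (mem_filter.1 he).1, (mem_filter.1 he).2, hea⟩
  choose e he hφ hea using ha'
  refine ⟨univ.image e, ?_, isTree_of_linearIndependent hn (by simp) e (fun i => ?_) ?_, ?_⟩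
  · intro x hx
    obtain ⟨i, -, rfl⟩ := Finset.mem_image.1 hx
    exact he i
  · exact G.not_isDiag_of_mem_edgeSet (SimpleGraph.mem_edgeFinset.1 (hH (he i)))
  · simpa only [hea] using hli
  · intro x hx y hy hxy
    simp only [coe_image, coe_univ, Set.image_univ, Set.mem_range] at hx hy
    obtain ⟨i, rfl⟩ := hx
    obtain ⟨j, rfl⟩ := hy
    rw [hφ, hφ] at hxy
    rw [hxy]

/-- The subgraph of `G` formed by the edges whose endpoints lie in different fibers of `P`. -/
def crossGraph {n : ℕ} {α : Type*} (G : SimpleGraph (Fin n)) (P : Fin n → α) :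
    SimpleGraph (Fin n) where
  Adj u v := G.Adj u v ∧ P u ≠ P v
  symm := ⟨fun _ _ h => ⟨h.1.symm, h.2.symm⟩⟩
  loopless := ⟨fun _ h => h.2 rfl⟩

/-- The edges of `G` whose endpoints lie in different fibers of `P`. -/
noncomputable def crossEdges {n : ℕ} {α : Type*} (G : SimpleGraph (Fin n)) (P : Fin n → α) :
    Finset (Sym2 (Fin n)) :=
  (crossGraph G P).edgeFinset

theorem mk_mem_crossEdges {n : ℕ} {α : Type*} {G : SimpleGraph (Fin n)} {P : Fin n → α}
    {u v : Fin n} : s(u, v) ∈ crossEdges G P ↔ G.Adj u v ∧ P u ≠ P v := by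
  rw [crossEdges, SimpleGraph.mem_edgeFinset, SimpleGraph.mem_edgeSet]
  rfl

theorem crossEdges_subset {n : ℕ} {α : Type*} (G : SimpleGraph (Fin n)) (P : Fin n → α) :
    crossEdges G P ⊆ G.edgeFinset := by
  intro e he
  induction e with | _ u v => simpa using (mk_mem_crossEdges.1 he).1

theorem sum_degree_crossGraph {n : ℕ} {α : Type*} (G : SimpleGraph (Fin n)) (P : Fin n → α) :
    ∑ v, (crossGraph G P).degree v = 2 * (crossEdges G P).card :=
  (crossGraph G P).sum_degrees_eq_twice_card_edges

/-- The edges with one end in `A` and the other end outside are counted by the degrees in `A`. -/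
theorem card_edgeCut_fiber_le {n : ℕ} {α : Type*} [DecidableEq α]
    (G : SimpleGraph (Fin n)) (P : Fin n → α) (y : α) :
    (edgeCut G (univ.filter fun v => P v = y)).card ≤
      ∑ v with P v = y, (crossGraph G P).degree v := by
  have : edgeCut G (univ.filter fun v => P v = y) ⊆
      (univ.filter fun v => P v = y).biUnion fun v =>
        ((crossGraph G P).neighborFinset v).image fun w => s(v, w) := by
    intro e he
    simp only [edgeCut, mem_filter, mem_univ, true_and] at he
    obtain ⟨hG, u, v, rfl, hu, hv⟩ := he
    rw [SimpleGraph.mem_edgeFinset, SimpleGraph.mem_edgeSet] at hG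
    simp only [mem_biUnion, mem_filter, mem_univ, true_and, mem_image,
      SimpleGraph.mem_neighborFinset]
    exact ⟨u, hu, v, ⟨hG, fun h => hv (h ▸ hu)⟩, rfl⟩
  refine (Finset.card_le_card this).trans (Finset.card_biUnion_le.trans ?_)
  exact Finset.sum_le_sum fun v _ => Finset.card_image_le

theorem card_image_mul_le {n : ℕ} {α : Type*} [DecidableEq α]
    (G : SimpleGraph (Fin n)) (P : Fin n → α) {l : ℕ}
    (hl : ∀ A : Finset (Fin n), A.Nonempty → A ≠ univ → l ≤ (edgeCut G A).card)
    (ht : 2 ≤ (univ.image P).card) :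
    (univ.image P).card * l ≤ 2 * (crossEdges G P).card := by
  rw [← sum_degree_crossGraph, ← smul_eq_mul, ← Finset.sum_const]
  rw [← Finset.sum_fiberwise_of_maps_to (t := univ.image P) (g := P)
    (fun v _ => mem_image_of_mem P (mem_univ v))]
  refine Finset.sum_le_sum fun y hy => ?_
  refine le_trans (hl _ ?_ ?_) (card_edgeCut_fiber_le G P y)
  · obtain ⟨v, -, rfl⟩ := mem_image.1 hy
    exact ⟨v, by simp⟩
  · intro h
    obtain ⟨z, hz, hzy⟩ := Finset.exists_mem_ne (by omega : 1 < (univ.image P).card) y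
    obtain ⟨v, -, rfl⟩ := mem_image.1 hz
    have : v ∈ (univ.filter fun v => P v = y) := by rw [h]; exact mem_univ v
    exact hzy (by simpa using this)

/-- The equivalence relation of lying in the same component of the forest `F`. -/
def spanSetoid {n : ℕ} (F : Finset (Sym2 (Fin n))) : Setoid (Fin n) where
  r u v := edgeVec s(u, v) ∈ edgeSpan F
  iseqv := ⟨fun u => by
      have : edgeVec s(u, u) = 0 := by
        rw [edgeVec_mk]; exact funext fun _ => CharTwo.add_self_eq_zero _
      rw [this]; exact zero_mem _,
    fun h => by rwa [Sym2.eq_swap], edgeVec_mem_edgeSpan_trans⟩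

/-- A choice of representatives of the components of `F`. -/
noncomputable def spanRep {n : ℕ} (F : Finset (Sym2 (Fin n))) (u : Fin n) : Fin n :=
  (Quotient.mk (spanSetoid F) u).out

theorem spanRep_eq_iff {n : ℕ} {F : Finset (Sym2 (Fin n))} {u v : Fin n} :
    spanRep F u = spanRep F v ↔ edgeVec s(u, v) ∈ edgeSpan F := by
  rw [spanRep, spanRep, Quotient.out_inj, Quotient.eq]
  rfl

theorem edgeVec_spanRep_mem {n : ℕ} (F : Finset (Sym2 (Fin n))) (u : Fin n) :
    edgeVec s(u, spanRep F u) ∈ edgeSpan F := by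
  have h : (spanSetoid F).r (spanRep F u) u := Quotient.mk_out (s := spanSetoid F) u
  rw [Sym2.eq_swap]
  exact h

theorem le_card_image_spanRep_add {n : ℕ} (F : Finset (Sym2 (Fin n))) :
    n ≤ (univ.image (spanRep F)).card + F.card := by
  set s : Finset (Fin n → ZMod 2) :=
    (univ.image (spanRep F)).image (fun v => Pi.single v 1) ∪ F.image edgeVec with hs
  have htop : Submodule.span (ZMod 2) (s : Set (Fin n → ZMod 2)) = ⊤ := by
    rw [eq_top_iff, ← (Pi.basisFun (ZMod 2) (Fin n)).span_eq, Submodule.span_le]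
    rintro _ ⟨u, rfl⟩
    rw [Pi.basisFun_apply, SetLike.mem_coe]
    have h1 : edgeVec s(u, spanRep F u) ∈ Submodule.span (ZMod 2) (s : Set (Fin n → ZMod 2)) := by
      refine (Submodule.span_mono ?_ : edgeSpan F ≤ _) (edgeVec_spanRep_mem F u)
      simp [hs]
    have h2 : (Pi.single (spanRep F u) 1 : Fin n → ZMod 2) ∈
        Submodule.span (ZMod 2) (s : Set (Fin n → ZMod 2)) :=
      Submodule.subset_span (by simp [hs])
    have := Submodule.sub_mem _ h1 h2
    simpa [edgeVec_mk] using this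
  have h1 := finrank_span_finset_le_card (R := ZMod 2) s
  rw [Set.finrank, htop, finrank_top, Module.finrank_fin_fun] at h1
  refine h1.trans ((card_union_le _ _).trans ?_)
  exact Nat.add_le_add card_image_le card_image_le

/-- Few edges of `G` join vertices in the same component of a small forest. -/
theorem card_edgeFinset_le_crossEdges_add {n : ℕ} (G : SimpleGraph (Fin n))
    (F : Finset (Sym2 (Fin n))) :
    G.edgeFinset.card ≤ (crossEdges G (spanRep F)).card + 4 * F.card ^ 2 := by
  set t : Finset (Fin n) := F.biUnion Sym2.toFinset with ht
  have htc : t.card ≤ 2 * F.card := by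
    rw [mul_comm]
    refine Finset.card_biUnion_le_card_mul _ _ _ fun e _ => ?_
    rw [Sym2.card_toFinset]; split_ifs <;> omega
  have hsub : G.edgeFinset ⊆ crossEdges G (spanRep F) ∪ (t ×ˢ t).image fun x => s(x.1, x.2) := by
    intro e he
    induction e with | _ u v =>
    rw [SimpleGraph.mem_edgeFinset, SimpleGraph.mem_edgeSet] at he
    rw [mem_union, mk_mem_crossEdges]
    by_cases h : spanRep F u = spanRep F v
    · right
      have hv : ∀ w x : Fin n, w ≠ x → edgeVec s(w, x) ∈ edgeSpan F → w ∈ t := by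
        intro w x hwx hmem
        by_contra hw
        have := map_eq_zero_of_mem_edgeSpan (sumOn {w}) (fun e he => ?_) hmem
        · rw [sumOn_apply, sum_edgeVec] at this
          simp [hwx.symm] at this
        · induction e with | _ a b =>
          have ha : a ≠ w := fun ha => hw (mem_biUnion.2 ⟨_, he, by simp [ha]⟩)
          have hb : b ≠ w := fun hb => hw (mem_biUnion.2 ⟨_, he, by simp [hb]⟩)
          rw [sumOn_apply, sum_edgeVec]
          simp [ha, hb]
      rw [spanRep_eq_iff] at h
      exact mem_image.2 ⟨(u, v), mem_product.2 ⟨hv u v he.ne h,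
        hv v u he.ne.symm (by rwa [Sym2.eq_swap])⟩, rfl⟩
    · exact Or.inl ⟨he, h⟩
  refine (Finset.card_le_card hsub).trans ((card_union_le _ _).trans ?_)
  have h2 : (t ×ˢ t).card ≤ 4 * F.card ^ 2 := by
    rw [card_product]; nlinarith
  have := (card_image_le (s := t ×ˢ t) (f := fun x => s(x.1, x.2))).trans h2
  omega

theorem prColored_le_sum {n : ℕ} {G : SimpleGraph (Fin n)} {p : ℝ} (hn : 2 ≤ n) (hp0 : 0 ≤ p)
    (hp1 : p ≤ 1) {ι : Type*} (s : Finset ι)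
    {P : Finset (Sym2 (Fin n)) → (Sym2 (Fin n) → Fin (n - 1)) → Prop}
    {Q : ι → Finset (Sym2 (Fin n)) → (Sym2 (Fin n) → Fin (n - 1)) → Prop}
    (h : ∀ H ⊆ G.edgeFinset, ∀ φ, P H φ → ∃ i ∈ s, Q i H φ) :
    prColored n G p P ≤ ∑ i ∈ s, prColored n G p (Q i) := by
  have hn' : (0 : ℝ) ≤ 1 / (n - 1) := by
    have : (2 : ℝ) ≤ n := by exact_mod_cast hn
    exact one_div_nonneg.2 (by linarith)
  have hp : 0 ≤ 1 - p := by linarith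
  unfold prColored
  rw [Finset.sum_comm (s := s)]
  refine Finset.sum_le_sum fun H hH => ?_
  rw [Finset.sum_comm (s := s)]
  refine Finset.sum_le_sum fun φ _ => ?_
  rw [← Finset.mul_sum]
  refine mul_le_mul_of_nonneg_left ?_ (by positivity)
  have hnn : ∀ i ∈ s, (0 : ℝ) ≤ if Q i H φ then 1 else 0 := fun i _ => by split_ifs <;> simp
  split_ifs with hP
  · obtain ⟨i, hi, hQ⟩ := h H (mem_powerset.1 hH) φ hP
    refine le_trans ?_ (Finset.single_le_sum hnn hi)
    simp [hQ]
  · exact Finset.sum_nonneg hnn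

theorem prod_ite_one_zero {ι : Type*} (s : Finset ι) (q : ι → Prop) [DecidablePred q]
    [Decidable (∀ i ∈ s, q i)] :
    ∏ i ∈ s, (if q i then (1 : ℝ) else 0) = if ∀ i ∈ s, q i then 1 else 0 := by
  split_ifs with h
  · exact Finset.prod_eq_one fun i hi => if_pos (h i hi)
  · push Not at h
    obtain ⟨i, hi, hq⟩ := h
    exact Finset.prod_eq_zero hi (if_neg hq)

theorem prColored_edgewise {n : ℕ} (G : SimpleGraph (Fin n)) (p : ℝ) (hn : 2 ≤ n)
    (C : Sym2 (Fin n) → Finset (Fin (n - 1))) (ok : Sym2 (Fin n) → Prop) :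
    prColored n G p (fun H φ => ∀ e ∈ G.edgeFinset, (e ∈ H → φ e ∈ C e) ∧ (e ∉ H → ok e)) =
      ∏ e ∈ G.edgeFinset, (p * ((C e).card / (n - 1 : ℝ)) + if ok e then 1 - p else 0) := by
  have hn' : (n - 1 : ℝ) ≠ 0 := by
    have : (2 : ℝ) ≤ n := by exact_mod_cast hn
    linarith
  rw [Finset.prod_add, prColored]
  refine Finset.sum_congr rfl fun H hH => ?_
  rw [mem_powerset] at hH
  have hφ : ∀ φ : Sym2 (Fin n) → Fin (n - 1),
      p ^ H.card * (1 - p) ^ (G.edgeFinset.card - H.card) *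
      (1 / (n - 1 : ℝ)) ^ Fintype.card (Sym2 (Fin n)) *
      (if ∀ e ∈ G.edgeFinset, (e ∈ H → φ e ∈ C e) ∧ (e ∉ H → ok e) then 1 else 0) =
      (p ^ H.card * ∏ e ∈ G.edgeFinset \ H, if ok e then 1 - p else 0) *
        ∏ e, (1 / (n - 1 : ℝ) * if e ∈ H → φ e ∈ C e then 1 else 0) := by
    intro φ
    rw [Finset.prod_mul_distrib, Finset.prod_const, card_univ]
    have h1 : (∏ e ∈ G.edgeFinset \ H, if ok e then 1 - p else 0) =
        (1 - p) ^ (G.edgeFinset.card - H.card) *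
          if ∀ e ∈ G.edgeFinset \ H, ok e then 1 else 0 := by
      rw [← Finset.card_sdiff_of_subset hH, ← Finset.prod_const, ← prod_ite_one_zero,
        ← Finset.prod_mul_distrib]
      exact Finset.prod_congr rfl fun e _ => by split_ifs <;> simp
    have h2 : (if ∀ e ∈ G.edgeFinset, (e ∈ H → φ e ∈ C e) ∧ (e ∉ H → ok e) then (1 : ℝ) else 0) =
        (if ∀ e ∈ G.edgeFinset \ H, ok e then 1 else 0) *
          if ∀ e ∈ univ, e ∈ H → φ e ∈ C e then 1 else 0 := by
      have hiff : (∀ e ∈ G.edgeFinset, (e ∈ H → φ e ∈ C e) ∧ (e ∉ H → ok e)) ↔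
          (∀ e ∈ G.edgeFinset \ H, ok e) ∧ ∀ e ∈ univ, e ∈ H → φ e ∈ C e := by
        refine ⟨fun h => ⟨fun e he => ?_, fun e _ he => (h e (hH he)).1 he⟩,
          fun h e he => ⟨h.2 e (mem_univ e), fun heH => h.1 e (mem_sdiff.2 ⟨he, heH⟩)⟩⟩
        rw [Finset.mem_sdiff] at he
        exact (h e he.1).2 he.2
      by_cases ha : ∀ e ∈ G.edgeFinset \ H, ok e
      · by_cases hb : ∀ e ∈ univ, e ∈ H → φ e ∈ C e
        · rw [if_pos ha, if_pos hb, if_pos (hiff.2 ⟨ha, hb⟩), one_mul]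
        · rw [if_neg hb, if_neg fun h => hb (hiff.1 h).2, mul_zero]
      · rw [if_neg ha, if_neg fun h => ha (hiff.1 h).1, zero_mul]
    rw [h1, h2, prod_ite_one_zero]
    ring
  rw [Finset.sum_congr rfl fun φ _ => by convert hφ φ, ← Finset.mul_sum]
  have hsum : ∑ φ : Sym2 (Fin n) → Fin (n - 1),
      ∏ e, (1 / (n - 1 : ℝ) * if e ∈ H → φ e ∈ C e then 1 else 0) =
      ∏ e ∈ H, ((C e).card / (n - 1 : ℝ)) := by
    have := Finset.prod_univ_sum (fun _ : Sym2 (Fin n) => (univ : Finset (Fin (n - 1))))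
      (fun e c => 1 / (n - 1 : ℝ) * if e ∈ H → c ∈ C e then 1 else 0)
    rw [Fintype.piFinset_univ] at this
    rw [← this, ← Finset.prod_subset (subset_univ H)]
    · refine Finset.prod_congr rfl fun e he => ?_
      simp [he, div_eq_mul_inv]
    · intro e _ he
      have h1 : ((n - 1 : ℕ) : ℝ) = n - 1 := by
        rw [Nat.cast_sub (by omega)]; simp
      simp [he, h1, hn']
  rw [hsum, Finset.prod_mul_distrib, Finset.prod_const]
  ring

theorem prColored_true {n : ℕ} (G : SimpleGraph (Fin n)) (p : ℝ) (hn : 2 ≤ n) :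
    prColored n G p (fun _ _ => True) = 1 := by
  have hn' : (n - 1 : ℝ) ≠ 0 := by
    have : (2 : ℝ) ≤ n := by exact_mod_cast hn
    linarith
  have := prColored_edgewise G p hn (fun _ => univ) (fun _ => True)
  have h1 : ((n - 1 : ℕ) : ℝ) = n - 1 := by
    rw [Nat.cast_sub (by omega)]; simp
  simpa [h1, div_self hn'] using this

theorem prColored_not {n : ℕ} (G : SimpleGraph (Fin n)) (p : ℝ) (hn : 2 ≤ n)
    (P : Finset (Sym2 (Fin n)) → (Sym2 (Fin n) → Fin (n - 1)) → Prop) :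
    prColored n G p P = 1 - prColored n G p (fun H φ => ¬ P H φ) := by
  rw [← prColored_true G p hn, eq_sub_iff_add_eq]
  unfold prColored
  rw [← Finset.sum_add_distrib]
  refine Finset.sum_congr rfl fun H _ => ?_
  rw [← Finset.sum_add_distrib]
  refine Finset.sum_congr rfl fun φ _ => ?_
  by_cases h : P H φ <;> simp [h]

theorem prColored_nonneg {n : ℕ} (G : SimpleGraph (Fin n)) {p : ℝ} (hn : 2 ≤ n) (hp0 : 0 ≤ p)
    (hp1 : p ≤ 1) (P : Finset (Sym2 (Fin n)) → (Sym2 (Fin n) → Fin (n - 1)) → Prop) :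
    0 ≤ prColored n G p P := by
  have hn' : (0 : ℝ) ≤ 1 / (n - 1) := by
    have : (2 : ℝ) ≤ n := by exact_mod_cast hn
    exact one_div_nonneg.2 (by linarith)
  have hp : 0 ≤ 1 - p := by linarith
  refine Finset.sum_nonneg fun H _ => Finset.sum_nonneg fun φ _ => ?_
  have : (0 : ℝ) ≤ if P H φ then 1 else 0 := by split_ifs <;> simp
  positivity

theorem prod_ite_ite {ι : Type*} [DecidableEq ι] {s A B : Finset ι} (hA : A ⊆ s) (hB : B ⊆ s)
    (hAB : Disjoint A B) (a b : ℝ) :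
    ∏ e ∈ s, (if e ∈ A then a else if e ∈ B then b else 1) = a ^ A.card * b ^ B.card := by
  have hsplit : ∀ e ∈ s, (if e ∈ A then a else if e ∈ B then b else 1) =
      (if e ∈ A then a else 1) * if e ∈ B then b else 1 := by
    intro e _
    by_cases h : e ∈ A
    · simp [h, Finset.disjoint_left.1 hAB h]
    · simp [h]
  rw [Finset.prod_congr rfl hsplit, Finset.prod_mul_distrib, Finset.prod_ite_mem,
    Finset.prod_ite_mem, Finset.inter_eq_right.2 hA, Finset.inter_eq_right.2 hB]
  simp

theorem sum_powerset_pow_card {ι : Type*} (s : Finset ι) (a : ℝ) :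
    ∑ t ∈ s.powerset, a ^ t.card = (1 + a) ^ s.card := by
  have := Finset.sum_pow_mul_eq_add_pow a 1 s
  simpa [add_comm] using this

theorem cast_card_compl {n : ℕ} (hn : 2 ≤ n) (S : Finset (Fin (n - 1))) :
    ((Sᶜ.card : ℕ) : ℝ) = n - 1 - S.card := by
  rw [card_compl, Nat.cast_sub (card_le_univ S), Fintype.card_fin, Nat.cast_sub (by omega)]
  simp

/-- The union bound over color sets `S` of size `k` and forests `F` with fewer than `k` edges
that span all the edges with color in `S`. -/
theorem prColored_exists_forest_le {n : ℕ} (G : SimpleGraph (Fin n)) {p : ℝ} (hn : 2 ≤ n)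
    (hp0 : 0 ≤ p) (hp1 : p ≤ 1) {k : ℕ} (hk : k ≤ n - 1) {x : ℝ} (hx0 : 0 < x) (hx1 : x ≤ 1)
    (N : ℝ) :
    prColored n G p (fun H φ => ∃ S : Finset (Fin (n - 1)), S.card = k ∧
      ∃ F ⊆ G.edgeFinset, F.card < k ∧ N ≤ (crossEdges G (spanRep F)).card ∧
        (∀ e ∈ F, e ∈ H ∧ φ e ∈ S) ∧ ∀ e ∈ crossEdges G (spanRep F), e ∈ H → φ e ∉ S) ≤
      (n - 1).choose k * (x⁻¹ ^ k * (Real.exp (x * (p * (k / (n - 1 : ℝ))) * G.edgeFinset.card) *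
        Real.exp (-(p * (k / (n - 1 : ℝ)) * N)))) := by
  have hn2 : (2 : ℝ) ≤ n := by exact_mod_cast hn
  have hkn : (k : ℝ) ≤ n - 1 := by
    have : (k : ℝ) ≤ ((n - 1 : ℕ) : ℝ) := by exact_mod_cast hk
    rwa [Nat.cast_sub (by omega), Nat.cast_one] at this
  have hr0 : (0 : ℝ) ≤ k / (n - 1 : ℝ) := div_nonneg (by positivity) (by linarith)
  have hr1 : (k : ℝ) / (n - 1 : ℝ) ≤ 1 := (div_le_one (by linarith)).2 hkn
  set q : ℝ := p * (k / (n - 1 : ℝ)) with hq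
  have hq0 : 0 ≤ q := mul_nonneg hp0 hr0
  have hq1 : q ≤ 1 := mul_le_one₀ hp1 hr0 hr1
  set 𝓕 := G.edgeFinset.powerset.filter fun F =>
    F.card < k ∧ N ≤ (crossEdges G (spanRep F)).card with h𝓕
  have hunion := prColored_le_sum (G := G) hn hp0 hp1
    ((univ : Finset (Fin (n - 1))).powersetCard k ×ˢ 𝓕)
    (P := fun H φ => ∃ S : Finset (Fin (n - 1)), S.card = k ∧
      ∃ F ⊆ G.edgeFinset, F.card < k ∧ N ≤ (crossEdges G (spanRep F)).card ∧
        (∀ e ∈ F, e ∈ H ∧ φ e ∈ S) ∧ ∀ e ∈ crossEdges G (spanRep F), e ∈ H → φ e ∉ S)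
    (Q := fun i H φ => ∀ e ∈ G.edgeFinset,
      (e ∈ H → φ e ∈ (if e ∈ i.2 then i.1 else
        if e ∈ crossEdges G (spanRep i.2) then i.1ᶜ else univ)) ∧ (e ∉ H → e ∉ i.2))
    (by
      rintro H - φ ⟨S, hS, F, hF, hFk, hN, h1, h2⟩
      refine ⟨(S, F), ?_, fun e _ => ⟨fun heH => ?_, fun heH heF => heH (h1 e heF).1⟩⟩
      · simp [h𝓕, hS, hF, hFk, hN]
      · dsimp only
        split_ifs with hF' hc
        · exact (h1 e hF').2
        · exact mem_compl.2 (h2 e hc heH)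
        · exact mem_univ _)
  refine hunion.trans ?_
  have hterm : ∀ i ∈ (univ : Finset (Fin (n - 1))).powersetCard k ×ˢ 𝓕,
      prColored n G p (fun H φ => ∀ e ∈ G.edgeFinset,
      (e ∈ H → φ e ∈ (if e ∈ i.2 then i.1 else
        if e ∈ crossEdges G (spanRep i.2) then i.1ᶜ else univ)) ∧ (e ∉ H → e ∉ i.2)) ≤
      x⁻¹ ^ k * ((x * q) ^ i.2.card * Real.exp (-(q * N))) := by
    rintro ⟨S, F⟩ hi
    simp only [mem_product, mem_powersetCard, subset_univ, true_and, h𝓕, mem_filter,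
      mem_powerset] at hi
    obtain ⟨hS, hF, hFk, hN⟩ := hi
    rw [prColored_edgewise G p hn]
    dsimp only
    have hdisj : Disjoint F (crossEdges G (spanRep F)) := by
      rw [Finset.disjoint_left]
      intro e he hc
      induction e with | _ u v =>
      exact (mk_mem_crossEdges.1 hc).2
        (spanRep_eq_iff.2 (Submodule.subset_span ⟨_, he, rfl⟩))
    have hfac : ∀ e ∈ G.edgeFinset,
        (p * ((if e ∈ F then S else if e ∈ crossEdges G (spanRep F) then Sᶜ else univ).card /
          (n - 1 : ℝ)) + if e ∉ F then 1 - p else 0) =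
        if e ∈ F then q else if e ∈ crossEdges G (spanRep F) then 1 - q else 1 := by
      intro e _
      have hn1 : (n - 1 : ℝ) ≠ 0 := by linarith
      by_cases h1 : e ∈ F
      · simp [h1, hS, hq]
      · by_cases h2 : e ∈ crossEdges G (spanRep F)
        · simp only [h1, h2, if_true, if_false, not_false_eq_true, cast_card_compl hn, hS, hq]
          field_simp
          ring
        · have h3 : ((n - 1 : ℕ) : ℝ) = n - 1 := by
            rw [Nat.cast_sub (by omega)]; simp
          simp [h1, h2, h3, hn1]
    trans ∏ e ∈ G.edgeFinset, (if e ∈ F then q else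
      if e ∈ crossEdges G (spanRep F) then 1 - q else 1)
    · exact (Finset.prod_congr rfl fun e he => by convert hfac e he).le
    rw [prod_ite_ite hF (crossEdges_subset G _) hdisj]
    have e1 : (1 - q) ^ (crossEdges G (spanRep F)).card ≤ Real.exp (-(q * N)) := by
      calc (1 - q) ^ (crossEdges G (spanRep F)).card
          ≤ Real.exp (-q) ^ (crossEdges G (spanRep F)).card :=
            pow_le_pow_left₀ (by linarith) (Real.one_sub_le_exp_neg q) _
        _ = Real.exp (-(q * (crossEdges G (spanRep F)).card)) := by
            rw [← Real.exp_nat_mul]; ring_nf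
        _ ≤ _ := Real.exp_le_exp.2 (neg_le_neg (mul_le_mul_of_nonneg_left hN hq0))
    have e2 : 1 ≤ x⁻¹ ^ k * x ^ F.card := by
      rw [inv_pow, inv_mul_eq_div, one_le_div (pow_pos hx0 k)]
      exact pow_le_pow_of_le_one hx0.le hx1 hFk.le
    calc q ^ F.card * (1 - q) ^ (crossEdges G (spanRep F)).card
        ≤ q ^ F.card * Real.exp (-(q * N)) := by gcongr
      _ ≤ (x⁻¹ ^ k * x ^ F.card) * (q ^ F.card * Real.exp (-(q * N))) :=
          le_mul_of_one_le_left (by positivity) e2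
      _ = x⁻¹ ^ k * ((x * q) ^ F.card * Real.exp (-(q * N))) := by rw [mul_pow x q]; ring
  refine (Finset.sum_le_sum hterm).trans ?_
  rw [Finset.sum_product]
  simp only
  rw [Finset.sum_const, card_powersetCard, card_univ, Fintype.card_fin, nsmul_eq_mul,
    ← Finset.mul_sum, ← Finset.sum_mul]
  gcongr
  calc ∑ F ∈ 𝓕, (x * q) ^ F.card ≤ ∑ F ∈ G.edgeFinset.powerset, (x * q) ^ F.card :=
        Finset.sum_le_sum_of_subset_of_nonneg (filter_subset _ _) fun _ _ _ => by positivity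
    _ = (1 + x * q) ^ G.edgeFinset.card := sum_powerset_pow_card _ _
    _ ≤ Real.exp (x * q) ^ G.edgeFinset.card := by
        gcongr
        rw [add_comm]
        exact Real.add_one_le_exp _
    _ = _ := by rw [← Real.exp_nat_mul, mul_comm]

/-- The union bound for few colors appearing between the fibers of `P`. -/
theorem prColored_few_colors_le {n : ℕ} {α : Type*} (G : SimpleGraph (Fin n)) (P : Fin n → α)
    {p : ℝ} (hn : 2 ≤ n) (hp0 : 0 ≤ p) (hp1 : p ≤ 1) {t : ℕ} (ht : t ≤ n - 1)
    {x : ℝ} (hx0 : 0 < x) (hx1 : x ≤ 1) :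
    prColored n G p (fun H φ => ((H ∩ crossEdges G P).image φ).card ≤ t) ≤
      x⁻¹ ^ t * (Real.exp (x * p * (crossEdges G P).card) *
        Real.exp (-(p * (1 - t / (n - 1 : ℝ)) * ((crossEdges G P).card - t)))) := by
  have hn2 : (2 : ℝ) ≤ n := by exact_mod_cast hn
  have hn1 : (n - 1 : ℝ) ≠ 0 := by linarith
  have hcast : ((n - 1 : ℕ) : ℝ) = n - 1 := by rw [Nat.cast_sub (by omega)]; simp
  have htn : (t : ℝ) ≤ n - 1 := by
    rw [← hcast]; exact_mod_cast ht
  have hr1 : (t : ℝ) / (n - 1 : ℝ) ≤ 1 := (div_le_one (by linarith)).2 htn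
  let c₀ : Fin (n - 1) := ⟨0, by omega⟩
  set X := crossEdges G P with hX
  set 𝓦 := X.powerset.filter fun W => W.card ≤ t with h𝓦
  have hunion := prColored_le_sum (G := G) hn hp0 hp1
    (𝓦.sigma fun W => Fintype.piFinset fun e => if e ∈ W then univ else {c₀})
    (P := fun H φ => ((H ∩ X).image φ).card ≤ t)
    (Q := fun i H φ => ∀ e ∈ G.edgeFinset,
      (e ∈ H → φ e ∈ (if e ∈ i.1 then {i.2 e} else
        if e ∈ X \ i.1 then i.1.image i.2 else univ)) ∧ (e ∉ H → e ∉ i.1))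
    (by
      intro H _ φ hφ
      obtain ⟨W, hW, hWb⟩ := Set.SurjOn.exists_bijOn_subset (f := φ)
        (s := ((H ∩ X : Finset _) : Set (Sym2 (Fin n)))) (t := (((H ∩ X).image φ : Finset _) :
          Set (Fin (n - 1)))) (by rw [coe_image]; exact Set.surjOn_image _ _)
      have hWc : W.toFinset.card = ((H ∩ X).image φ).card := by
        rw [← Finset.card_image_of_injOn (f := φ) (s := W.toFinset) (by
          rw [Set.coe_toFinset]; exact hWb.injOn)]
        congr 1
        apply Finset.coe_injective
        rw [coe_image, Set.coe_toFinset, hWb.image_eq]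
      have hWX : ∀ e ∈ W.toFinset, e ∈ H ∧ e ∈ X := fun e he => by
        simpa using hW (Set.mem_toFinset.1 he)
      refine ⟨⟨W.toFinset, fun e => if e ∈ W.toFinset then φ e else c₀⟩, ?_,
        fun e _ => ⟨fun heH => ?_,
        fun heH heW => heH (hWX e heW).1⟩⟩
      · rw [mem_sigma, h𝓦, mem_filter, mem_powerset, Fintype.mem_piFinset]
        refine ⟨⟨fun e he => (hWX e he).2, hWc.trans_le hφ⟩, fun e => ?_⟩
        dsimp only
        split_ifs <;> simp
      · dsimp only
        split_ifs with h1 h2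
        · simp
        · rw [Finset.mem_sdiff] at h2
          have : φ e ∈ (((H ∩ X).image φ : Finset _) : Set (Fin (n - 1))) := by
            simpa using ⟨e, ⟨heH, h2.1⟩, rfl⟩
          rw [← hWb.image_eq] at this
          obtain ⟨e', he', h⟩ := this
          exact mem_image.2 ⟨e', by simpa using he', by simp [he', h]⟩
        · exact mem_univ _)
  refine hunion.trans ?_
  have hterm : ∀ i ∈ 𝓦.sigma fun W => Fintype.piFinset fun e => if e ∈ W then univ else {c₀},
      prColored n G p (fun H φ => ∀ e ∈ G.edgeFinset,
      (e ∈ H → φ e ∈ (if e ∈ i.1 then {i.2 e} else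
        if e ∈ X \ i.1 then i.1.image i.2 else univ)) ∧ (e ∉ H → e ∉ i.1)) ≤
      (p / (n - 1 : ℝ)) ^ i.1.card *
        Real.exp (-(p * (1 - t / (n - 1 : ℝ)) * (X.card - t))) := by
    rintro ⟨W, κ⟩ hi
    simp only [mem_sigma, h𝓦, mem_filter, mem_powerset] at hi
    obtain ⟨⟨hW, hWt⟩, -⟩ := hi
    rw [prColored_edgewise G p hn]
    dsimp only
    set b : ℝ := 1 - p * (1 - (W.image κ).card / (n - 1 : ℝ)) with hb
    have hfac : ∀ e ∈ G.edgeFinset,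
        (p * ((if e ∈ W then {κ e} else if e ∈ X \ W then W.image κ else univ).card /
          (n - 1 : ℝ)) + if e ∉ W then 1 - p else 0) =
        if e ∈ W then p / (n - 1 : ℝ) else if e ∈ X \ W then b else 1 := by
      intro e _
      by_cases h1 : e ∈ W
      · simp [h1, div_eq_mul_inv]
      · by_cases h2 : e ∈ X \ W
        · simp only [h1, h2, if_true, if_false, not_false_eq_true, hb]
          ring
        · simp only [h1, h2, if_false, not_false_eq_true, if_true, card_univ, Fintype.card_fin,
            hcast, div_self hn1]
          ring
    trans ∏ e ∈ G.edgeFinset, (if e ∈ W then p / (n - 1 : ℝ) else if e ∈ X \ W then b else 1)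
    · exact (Finset.prod_congr rfl fun e he => by convert hfac e he).le
    rw [prod_ite_ite (hW.trans (crossEdges_subset G P))
      (sdiff_subset.trans (crossEdges_subset G P)) disjoint_sdiff]
    have hj : ((W.image κ).card : ℝ) ≤ t := by
      exact_mod_cast card_image_le.trans hWt
    have hb0 : 0 ≤ b := by
      have h0 : (0 : ℝ) ≤ (W.image κ).card / (n - 1 : ℝ) := div_nonneg (by positivity) (by linarith)
      rw [hb]; nlinarith
    set r : ℝ := p * (1 - t / (n - 1 : ℝ)) with hr
    have hr0 : 0 ≤ r := mul_nonneg hp0 (by linarith)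
    have hbr : b ≤ Real.exp (-r) := by
      have h1 : b ≤ 1 - r := by
        rw [hb, hr]
        have : ((W.image κ).card : ℝ) / (n - 1 : ℝ) ≤ t / (n - 1 : ℝ) :=
          div_le_div_of_nonneg_right hj (by linarith)
        nlinarith
      exact h1.trans (Real.one_sub_le_exp_neg r)
    refine mul_le_mul_of_nonneg_left ?_ (pow_nonneg (div_nonneg hp0 (by linarith)) _)
    have hc : ((X \ W).card : ℝ) = X.card - W.card := by
      rw [card_sdiff_of_subset hW, Nat.cast_sub (card_le_card hW)]
    have hWt' : (W.card : ℝ) ≤ t := by exact_mod_cast hWt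
    calc b ^ (X \ W).card ≤ Real.exp (-r) ^ (X \ W).card := pow_le_pow_left₀ hb0 hbr _
      _ = Real.exp (-(r * (X.card - W.card))) := by rw [← Real.exp_nat_mul, hc]; ring_nf
      _ ≤ _ := Real.exp_le_exp.2 (neg_le_neg (mul_le_mul_of_nonneg_left (by linarith) hr0))
  refine (Finset.sum_le_sum hterm).trans ?_
  rw [Finset.sum_sigma]
  have hinner : ∀ W ∈ 𝓦, ∑ _κ ∈ Fintype.piFinset fun e => if e ∈ W then univ else {c₀},
      (p / (n - 1 : ℝ)) ^ W.card * Real.exp (-(p * (1 - t / (n - 1 : ℝ)) * (X.card - t))) ≤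
      x⁻¹ ^ t * ((x * p) ^ W.card *
        Real.exp (-(p * (1 - t / (n - 1 : ℝ)) * (X.card - t)))) := by
    intro W hW
    have hWt := (mem_filter.1 hW).2
    rw [Finset.sum_const, Fintype.card_piFinset, nsmul_eq_mul]
    have hcard : ∏ e : Sym2 (Fin n), (if e ∈ W then (univ : Finset (Fin (n - 1))) else {c₀}).card =
        (n - 1) ^ W.card := by
      rw [← Finset.prod_subset (subset_univ W)]
      · rw [Finset.prod_congr rfl (g := fun _ => n - 1), prod_const]
        intro e he; simp [he]
      · intro e _ he; simp [he]
    rw [hcard, Nat.cast_pow, hcast, ← mul_assoc, ← mul_pow, mul_div_cancel₀ _ hn1, ← mul_assoc,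
      mul_pow, ← mul_assoc]
    refine mul_le_mul_of_nonneg_right ?_ (Real.exp_nonneg _)
    refine le_mul_of_one_le_left (pow_nonneg hp0 _) ?_
    rw [inv_pow, inv_mul_eq_div, one_le_div (pow_pos hx0 t)]
    exact pow_le_pow_of_le_one hx0.le hx1 hWt
  refine (Finset.sum_le_sum hinner).trans ?_
  rw [← Finset.mul_sum, ← Finset.sum_mul]
  gcongr
  calc ∑ W ∈ 𝓦, (x * p) ^ W.card ≤ ∑ W ∈ X.powerset, (x * p) ^ W.card :=
        Finset.sum_le_sum_of_subset_of_nonneg (filter_subset _ _) fun _ _ _ => by positivity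
    _ = (1 + x * p) ^ X.card := sum_powerset_pow_card _ _
    _ ≤ Real.exp (x * p) ^ X.card := by
        gcongr
        rw [add_comm]
        exact Real.add_one_le_exp _
    _ = _ := by rw [← Real.exp_nat_mul, mul_comm]

theorem sameFiber_card_add_degree {n : ℕ} {α : Type*} [DecidableEq α] (G : SimpleGraph (Fin n))
    (P : Fin n → α) (v : Fin n) :
    ((G.neighborFinset v).filter fun w => P w = P v).card + (crossGraph G P).degree v =
      G.degree v := by
  rw [← card_neighborFinset_eq_degree, ← card_neighborFinset_eq_degree,
    ← Finset.card_filter_add_card_filter_not (s := G.neighborFinset v) fun w => P w = P v]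
  congr 2
  ext w
  rw [mem_neighborFinset, mem_filter, mem_neighborFinset, eq_comm]
  rfl

/-- The values whose fibers have at least `d / 3` elements. -/
noncomputable def bigVals {n : ℕ} {α : Type*} (d : ℕ) (Q : Fin n → α) : Finset α :=
  (univ.image Q).filter fun y => d ≤ 3 * (univ.filter fun v => Q v = y).card

theorem mem_bigVals {n : ℕ} {α : Type*} [DecidableEq α] {d : ℕ} {Q : Fin n → α} {y : α} :
    y ∈ bigVals d Q ↔ (∃ v, Q v = y) ∧ d ≤ 3 * (univ.filter fun v => Q v = y).card := by
  rw [bigVals, mem_filter]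
  refine and_congr (by simp) ?_
  congr!

theorem card_bigVals_mul_le {n : ℕ} {α : Type*} (d : ℕ) (Q : Fin n → α) :
    (bigVals d Q).card * d ≤ 3 * n := by
  rw [← smul_eq_mul, ← Finset.sum_const]
  calc ∑ _y ∈ bigVals d Q, d ≤ ∑ y ∈ bigVals d Q, 3 * (univ.filter fun v => Q v = y).card :=
        Finset.sum_le_sum fun y hy => (mem_filter.1 hy).2
    _ ≤ ∑ y ∈ univ.image Q, 3 * (univ.filter fun v => Q v = y).card :=
        Finset.sum_le_sum_of_subset (filter_subset _ _)
    _ = 3 * n := by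
        rw [← Finset.mul_sum, ← Finset.card_eq_sum_card_image, card_univ, Fintype.card_fin]

theorem card_mul_le_of_le_degree {n : ℕ} {α : Type*} (G : SimpleGraph (Fin n)) (P : Fin n → α)
    {a : ℝ} (X : Finset (Fin n)) (hX : ∀ v ∈ X, a ≤ (crossGraph G P).degree v) :
    X.card * a ≤ 2 * (crossEdges G P).card := by
  have h := sum_degree_crossGraph G P
  calc (X.card : ℝ) * a = ∑ v ∈ X, a := by simp
    _ ≤ ∑ v ∈ X, ((crossGraph G P).degree v : ℝ) := Finset.sum_le_sum hX
    _ ≤ ∑ v, ((crossGraph G P).degree v : ℝ) :=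
        Finset.sum_le_sum_of_subset_of_nonneg (subset_univ _) fun _ _ _ => by positivity
    _ = 2 * (crossEdges G P).card := by exact_mod_cast h

theorem mem_bigVals_of_degree_lt {n : ℕ} {α : Type*} {G : SimpleGraph (Fin n)} {d : ℕ}
    (hG : G.IsRegularOfDegree d) (P : Fin n → α) {v : Fin n}
    (hv : 2 * (crossGraph G P).degree v < d) : P v ∈ bigVals d P := by
  refine mem_filter.2 ⟨mem_image_of_mem _ (mem_univ _), ?_⟩
  have h1 := sameFiber_card_add_degree G P v
  rw [hG v] at h1
  have h2 : ((G.neighborFinset v).filter fun w => P w = P v).card ≤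
      (univ.filter fun w => P w = P v).card := card_le_card (filter_subset_filter _ (subset_univ _))
  omega

theorem card_crossEdges_pair_le {n : ℕ} {α β : Type*} (G : SimpleGraph (Fin n)) (Q : Fin n → α)
    (P : Fin n → β) :
    (crossEdges G fun v => (Q v, P v)).card ≤
      (crossEdges G Q).card + (crossEdges G P).card := by
  refine (card_le_card fun e he => ?_).trans (card_union_le _ _)
  induction e with | _ u v =>
  rw [mem_union, mk_mem_crossEdges, mk_mem_crossEdges]
  obtain ⟨h, h'⟩ := mk_mem_crossEdges.1 he
  by_contra! hcon
  exact h' (Prod.ext (hcon.1 h) (hcon.2 h))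

theorem crossEdges_comp {n : ℕ} {α β : Type*} (G : SimpleGraph (Fin n)) (P : Fin n → α)
    {g : α → β} (hg : Function.Injective g) : crossEdges G (g ∘ P) = crossEdges G P := by
  ext e
  induction e with | _ u v =>
  rw [mk_mem_crossEdges, mk_mem_crossEdges, Function.comp, Function.comp, hg.ne_iff]

theorem card_bigVals_comp {n : ℕ} {α β : Type*} (d : ℕ) (P : Fin n → α)
    {g : α → β} (hg : Function.Injective g) : (bigVals d (g ∘ P)).card = (bigVals d P).card := by
  rw [← card_image_of_injective _ hg]
  congr 1
  ext y
  simp only [bigVals, mem_filter, mem_image, mem_univ, true_and, Function.comp]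
  constructor
  · rintro ⟨⟨v, rfl⟩, h⟩
    exact ⟨P v, ⟨⟨v, rfl⟩, by simpa [hg.eq_iff] using h⟩, rfl⟩
  · rintro ⟨_, ⟨⟨v, rfl⟩, h⟩, rfl⟩
    exact ⟨⟨v, rfl⟩, by simpa [hg.eq_iff] using h⟩

/-- There is a single partition of the vertices which almost refines every partition crossed by
few edges. -/
theorem exists_common_refinement {n : ℕ} {G : SimpleGraph (Fin n)} {d : ℕ}
    (hG : G.IsRegularOfDegree d) {c η γ : ℝ} (hc : 0 < c) (hη : 0 < η) (hη' : η ≤ 1 / 4)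
    (hγ : 0 < γ) (hγ' : 4 * (3 / c + 4) * γ ≤ η / 2 * c ^ 2) (hn : 0 < n)
    (hd : c * n ≤ d) :
    ∃ Q : Fin n → ℕ, ∀ P : Fin n → Fin n, ((crossEdges G P).card : ℝ) ≤ γ * n ^ 2 →
      ∃ Y : Finset (Fin n), (Y.card : ℝ) ≤ η / 2 * d ∧ (∀ v ∉ Y, Q v ∈ bigVals d Q) ∧
        ∀ u ∉ Y, ∀ v ∉ Y, Q u = Q v → P u = P v := by
  have hn0 : (0 : ℝ) < n := by exact_mod_cast hn
  have hd0 : (0 : ℝ) < d := lt_of_lt_of_le (by positivity) hd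
  have hd0' : 0 < d := by exact_mod_cast hd0
  have hbig : ∀ {α : Type} (Q : Fin n → α), ((bigVals d Q).card : ℝ) ≤ 3 / c := by
    intro α Q
    have h : ((bigVals d Q).card : ℝ) * d ≤ 3 * n := by exact_mod_cast card_bigVals_mul_le d Q
    rw [le_div_iff₀ hc]
    have h2 : ((bigVals d Q).card : ℝ) * (c * n) ≤ 3 * n :=
      (mul_le_mul_of_nonneg_left hd (by positivity)).trans h
    nlinarith
  set S : Set ℕ := {b | ∃ Q : Fin n → ℕ, (bigVals d Q).card = b ∧
    ((crossEdges G Q).card : ℝ) ≤ b * (γ * n ^ 2)} with hS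
  have hSne : S.Nonempty := by
    refine ⟨_, fun _ => 0, rfl, ?_⟩
    have : crossEdges G (fun _ : Fin n => 0) = ∅ := by
      ext e
      induction e with | _ u v => simp [mk_mem_crossEdges]
    rw [this]
    simp only [card_empty, Nat.cast_zero]
    positivity
  have hSbdd : BddAbove S := by
    refine ⟨⌈3 / c⌉₊, ?_⟩
    rintro _ ⟨Q, rfl, -⟩
    exact_mod_cast (hbig Q).trans (Nat.le_ceil _)
  obtain ⟨Q, hQb, hQ⟩ := Nat.sSup_mem hSne hSbdd
  refine ⟨Q, fun P hP => ?_⟩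
  set R : Fin n → ℕ × Fin n := fun v => (Q v, P v) with hR
  have hcR : ((crossEdges G R).card : ℝ) ≤ ((bigVals d Q).card + 1) * (γ * n ^ 2) := by
    have h : ((crossEdges G R).card : ℝ) ≤ (crossEdges G Q).card + (crossEdges G P).card := by
      exact_mod_cast card_crossEdges_pair_le G Q P
    rw [← hQb] at hQ
    linarith
  have hbR : (bigVals d R).card ≤ (bigVals d Q).card := by
    by_contra! hlt
    obtain ⟨g, hg⟩ := Countable.exists_injective_nat (ℕ × Fin n)
    have hmem : (bigVals d R).card ∈ S := by
      refine ⟨g ∘ R, card_bigVals_comp d R hg, ?_⟩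
      rw [crossEdges_comp G R hg]
      refine hcR.trans (mul_le_mul_of_nonneg_right ?_ (by positivity))
      exact_mod_cast hlt
    have := le_csSup hSbdd hmem
    omega
  set Y : Finset (Fin n) := univ.filter fun v => d ≤ 2 * (crossGraph G R).degree v with hY
  have hYc : (Y.card : ℝ) ≤ η / 2 * d := by
    have h1 := card_mul_le_of_le_degree G R (a := d / 2) Y (fun v hv => by
      have : (d : ℝ) ≤ 2 * (crossGraph G R).degree v := by
        exact_mod_cast (mem_filter.1 hv).2
      linarith)
    have h2 : ((bigVals d Q).card + 1) * (γ * n ^ 2) ≤ (3 / c + 4) * (γ * n ^ 2) :=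
      mul_le_mul_of_nonneg_right (by linarith [hbig Q]) (by positivity)
    have h3 : 4 * (3 / c + 4) * γ * n ^ 2 ≤ η / 2 * c ^ 2 * n ^ 2 :=
      mul_le_mul_of_nonneg_right hγ' (by positivity)
    have h4 : (c * n) * (c * n) ≤ (d : ℝ) * d := mul_le_mul hd hd (by positivity) hd0.le
    have h5 : (Y.card : ℝ) * d ≤ η / 2 * d * d := by nlinarith
    exact le_of_mul_le_mul_right h5 hd0
  have hYR : ∀ v ∉ Y, R v ∈ bigVals d R := fun v hv => mem_bigVals_of_degree_lt hG R (by
    by_contra! hcon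
    exact hv (mem_filter.2 ⟨mem_univ _, hcon⟩))
  have hmaps : ∀ y ∈ bigVals d R, y.1 ∈ bigVals d Q := by
    intro y hy
    obtain ⟨⟨v, rfl⟩, h2⟩ := mem_bigVals.1 hy
    refine mem_bigVals.2 ⟨⟨v, rfl⟩, h2.trans ?_⟩
    refine Nat.mul_le_mul_left _ (card_le_card fun w hw => ?_)
    rw [mem_filter] at hw ⊢
    exact ⟨hw.1, congrArg Prod.fst hw.2⟩
  have hinj : Set.InjOn Prod.fst (bigVals d R : Set (ℕ × Fin n)) := by
    refine Finset.injOn_of_surjOn_of_card_le (t := bigVals d Q) Prod.fst hmaps ?_ hbR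
    intro y hy
    have h3 : d ≤ 3 * (univ.filter fun v => Q v = y).card :=
      (mem_bigVals.1 hy).2
    have h3' : (d : ℝ) ≤ 3 * (univ.filter fun v => Q v = y).card := by exact_mod_cast h3
    have hlt : Y.card < (univ.filter fun v => Q v = y).card := by
      have : (Y.card : ℝ) < (univ.filter fun v => Q v = y).card := by nlinarith
      exact_mod_cast this
    obtain ⟨v, hv, hvY⟩ := Finset.exists_mem_notMem_of_card_lt_card hlt
    exact ⟨R v, hYR v hvY, (mem_filter.1 hv).2⟩
  exact ⟨Y, hYc, fun v hv => hmaps _ (hYR v hv), fun u hu v hv huv =>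
    congrArg Prod.snd (hinj (hYR u hu) (hYR v hv) huv)⟩

/-- The label carried by more than `d / 2` neighbors of `v`, if there is one. -/
noncomputable def majority {n : ℕ} (G : SimpleGraph (Fin n)) (d : ℕ) (g : Fin n → ℕ)
    (v : Fin n) : ℕ :=
  if h : ∃ l, d < 2 * ((G.neighborFinset v).filter fun w => g w = l).card then h.choose else 0

theorem majority_eq {n : ℕ} {G : SimpleGraph (Fin n)} {d : ℕ} (hG : G.IsRegularOfDegree d)
    {g : Fin n → ℕ} {v : Fin n} {l : ℕ}
    (hl : d < 2 * ((G.neighborFinset v).filter fun w => g w = l).card) : majority G d g v = l := by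
  have h : ∃ l, d < 2 * ((G.neighborFinset v).filter fun w => g w = l).card := ⟨l, hl⟩
  rw [majority, dif_pos h]
  have hm := h.choose_spec
  by_contra hne
  have hdisj : Disjoint ((G.neighborFinset v).filter fun w => g w = h.choose)
      ((G.neighborFinset v).filter fun w => g w = l) := by
    rw [Finset.disjoint_left]
    intro w hw hw'
    exact hne ((mem_filter.1 hw).2.symm.trans (mem_filter.1 hw').2)
  have hle := card_le_card (union_subset
    (filter_subset (fun w => g w = h.choose) (G.neighborFinset v))
    (filter_subset (fun w => g w = l) (G.neighborFinset v)))
  rw [card_union_of_disjoint hdisj, card_neighborFinset_eq_degree, hG v] at hle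
  omega

/-- A lower bound for the number of crossing edges at a vertex with label `f` when its
neighborhood suggests the label `s`. -/
noncomputable def deviationCost {V : Type*} (η d : ℝ) (s f : ℕ ⊕ V) : ℝ :=
  if f = s then 0 else Sum.elim (fun _ => (1 / 2 - η) * d) (fun _ => (1 - η) * d) f

theorem sum_degree_sub_card_le {n : ℕ} {α : Type*} (G : SimpleGraph (Fin n)) (P : Fin n → α)
    (X : Finset (Fin n)) :
    ∑ v ∈ X, (((crossGraph G P).degree v : ℝ) - X.card) ≤ (crossEdges G P).card := by
  have h1 : ∀ v ∈ X, ((crossGraph G P).degree v : ℝ) - X.card ≤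
      ((((crossGraph G P).neighborFinset v) \ X).card : ℝ) := by
    intro v _
    have : (crossGraph G P).degree v ≤ (((crossGraph G P).neighborFinset v) \ X).card + X.card := by
      rw [← card_neighborFinset_eq_degree]
      exact card_le_card_sdiff_add_card
    have : ((crossGraph G P).degree v : ℝ) ≤
      (((crossGraph G P).neighborFinset v) \ X).card + X.card := by exact_mod_cast this
    linarith
  refine (Finset.sum_le_sum h1).trans ?_
  rw [← Nat.cast_sum, ← Finset.card_sigma]
  norm_cast
  refine Finset.card_le_card_of_injOn (fun x => s(x.1, x.2)) ?_ ?_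
  · rintro ⟨v, w⟩ h
    rw [mem_coe, mem_sigma, Finset.mem_sdiff, mem_neighborFinset] at h
    exact mk_mem_crossEdges.2 h.2.1
  · rintro ⟨v, w⟩ h ⟨v', w'⟩ h' heq
    rw [mem_coe, mem_sigma, Finset.mem_sdiff] at h h'
    rcases Sym2.eq_iff.1 heq with ⟨h1, h2⟩ | ⟨h1, h2⟩
    · dsimp only at h1 h2
      rw [h1, h2]
    · dsimp only at h1 h2 h h'
      rw [h1] at h
      exact absurd h.1 h'.2.2

theorem exists_encoding {c η : ℝ} (hc : 0 < c) (hη : 0 < η) (hη' : η ≤ 1 / 4) :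
    ∃ γ > 0, ∃ M : ℕ, ∀ (n d : ℕ) (G : SimpleGraph (Fin n)), 0 < n → G.IsRegularOfDegree d →
      c * n ≤ d → ∃ B : Finset ℕ, B.card ≤ M ∧ ∃ 𝒮 : Finset (Fin n → ℕ ⊕ Fin n), 𝒮.card ≤ M ∧
        ∀ P : Fin n → Fin n, ((crossEdges G P).card : ℝ) ≤ γ * n ^ 2 →
          ∃ s ∈ 𝒮, ∃ f : Fin n → ℕ ⊕ Fin n, (∀ u v, f u = f v ↔ P u = P v) ∧
            (∀ v, f v ∈ B.disjSum univ) ∧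
            ∑ v, deviationCost η d (s v) (f v) ≤ (crossEdges G P).card := by
  set γ := η * c ^ 2 / (8 * (3 / c + 4)) with hγdef
  have hc3 : 0 < 3 / c := by positivity
  have hγ : 0 < γ := by positivity
  have hγ' : 4 * (3 / c + 4) * γ ≤ η / 2 * c ^ 2 := by
    rw [hγdef]
    have : 3 / c + 4 ≠ 0 := by positivity
    generalize 3 / c + 4 = a at *
    apply le_of_eq
    field_simp
    norm_num
  set b := ⌊3 / c⌋₊ with hb
  refine ⟨γ, hγ, b + (b + 1) ^ b, fun n d G hn hG hd => ?_⟩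
  have hn0 : (0 : ℝ) < n := by exact_mod_cast hn
  have hd0 : (0 : ℝ) < d := lt_of_lt_of_le (by positivity) hd
  obtain ⟨Q, hQ⟩ := exists_common_refinement hG hc hη hη' hγ hγ' hn hd
  have hBb : (bigVals d Q).card ≤ b := by
    have h : ((bigVals d Q).card : ℝ) * d ≤ 3 * n := by exact_mod_cast card_bigVals_mul_le d Q
    rw [hb, Nat.le_floor_iff hc3.le, le_div_iff₀ hc]
    have h2 : ((bigVals d Q).card : ℝ) * (c * n) ≤ 3 * n :=
      (mul_le_mul_of_nonneg_left hd (by positivity)).trans h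
    nlinarith
  set B := bigVals d Q with hB
  refine ⟨B, hBb.trans (Nat.le_add_right _ _),
    (Fintype.piFinset fun _ : B => insert 0 B).image fun ρ v =>
      Sum.inl (majority G d (fun w => if h : Q w ∈ B then ρ ⟨Q w, h⟩ else 0) v), ?_, ?_⟩
  · refine card_image_le.trans ?_
    rw [Fintype.card_piFinset, Finset.prod_const, card_univ, Fintype.card_coe]
    calc (insert 0 B).card ^ B.card ≤ (b + 1) ^ B.card :=
          Nat.pow_le_pow_left ((card_insert_le _ _).trans (Nat.succ_le_succ hBb)) _
      _ ≤ (b + 1) ^ b := Nat.pow_le_pow_right (Nat.succ_pos _) hBb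
      _ ≤ _ := Nat.le_add_left _ _
  intro P hP
  obtain ⟨Y, hY, hYB, hYP⟩ := hQ P hP
  -- the label of a part that is not contained in `Y`
  let main : Fin n → Prop := fun y => ∃ u ∉ Y, P u = y
  let lab : Fin n → ℕ := fun y => if h : main y then Q h.choose else 0
  have hlab : ∀ u ∉ Y, ∃ u' ∉ Y, P u' = P u ∧ lab (P u) = Q u' := by
    intro u hu
    have h : main (P u) := ⟨u, hu, rfl⟩
    exact ⟨h.choose, h.choose_spec.1, h.choose_spec.2, dif_pos h⟩
  let f : Fin n → ℕ ⊕ Fin n := fun v => if main (P v) then .inl (lab (P v)) else .inr (P v)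
  let ρ : B → ℕ := fun q => if h : ∃ u ∉ Y, Q u = q then lab (P h.choose) else 0
  have hρ : ∀ w ∉ Y, (if h : Q w ∈ B then ρ ⟨Q w, h⟩ else 0) = lab (P w) := by
    intro w hw
    have h : ∃ u ∉ Y, Q u = Q w := ⟨w, hw, rfl⟩
    rw [dif_pos (hYB w hw)]
    simp only [ρ]
    rw [dif_pos h, hYP _ h.choose_spec.1 w hw h.choose_spec.2]
  set g : Fin n → ℕ := fun w => if h : Q w ∈ B then ρ ⟨Q w, h⟩ else 0 with hg
  have hsame : ∀ v, (((G.neighborFinset v).filter fun w => P w = P v).card : ℝ) +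
      (crossGraph G P).degree v = d := by
    intro v
    have := sameFiber_card_add_degree G P v
    rw [hG v] at this
    exact_mod_cast this
  have hinr : ∀ v, ¬ main (P v) → (1 - η / 2) * d ≤ (crossGraph G P).degree v := by
    intro v hv
    have h1 : ((G.neighborFinset v).filter fun w => P w = P v).card ≤ Y.card := by
      refine card_le_card fun w hw => ?_
      by_contra hwY
      exact hv ⟨w, hwY, (mem_filter.1 hw).2⟩
    have h2 : (((G.neighborFinset v).filter fun w => P w = P v).card : ℝ) ≤ Y.card := by
      exact_mod_cast h1
    have := hsame v
    linarith
  have hdev : ∀ v, f v ≠ .inl (majority G d g v) →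
      (1 / 2 - η / 2) * d ≤ (crossGraph G P).degree v := by
    intro v hv
    by_cases hm : main (P v)
    · by_contra! hlt
      apply hv
      simp only [f]
      rw [if_pos hm, majority_eq hG (l := lab (P v))]
      have h1 : ((G.neighborFinset v).filter fun w => P w = P v).card ≤
          ((G.neighborFinset v).filter fun w => g w = lab (P v)).card + Y.card := by
        rw [← card_sdiff_add_card_inter _ Y]
        refine add_le_add (card_le_card fun w hw => ?_) (card_le_card inter_subset_right)
        rw [Finset.mem_sdiff, mem_filter] at hw
        exact mem_filter.2 ⟨hw.1.1, (hρ w hw.2).trans (by rw [hw.1.2])⟩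
      have h2 : (((G.neighborFinset v).filter fun w => P w = P v).card : ℝ) ≤
          ((G.neighborFinset v).filter fun w => g w = lab (P v)).card + Y.card := by
        exact_mod_cast h1
      have := hsame v
      have h3 : (d : ℝ) < 2 * ((G.neighborFinset v).filter fun w => g w = lab (P v)).card := by
        linarith
      exact_mod_cast h3
    · have := hinr v hm
      nlinarith
  refine ⟨fun v => .inl (majority G d g v), ?_, f, ?_, ?_, ?_⟩
  · refine mem_image.2 ⟨ρ, Fintype.mem_piFinset.2 fun q => ?_, rfl⟩
    simp only [ρ]
    split_ifs with h
    · obtain ⟨u', hu', -, hu⟩ := hlab _ h.choose_spec.1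
      rw [hu]
      exact mem_insert_of_mem (hYB u' hu')
    · exact mem_insert_self _ _
  · intro u v
    refine ⟨fun h => ?_, fun h => by simp only [f, h]⟩
    simp only [f] at h
    split_ifs at h with h1 h2
    · obtain ⟨a, ha, hau⟩ := h1
      obtain ⟨b, hb, hbv⟩ := h2
      obtain ⟨a', ha', ha1, ha2⟩ := hlab a ha
      obtain ⟨b', hb', hb1, hb2⟩ := hlab b hb
      rw [← hau, ← hbv, Sum.inl.injEq, ha2, hb2] at h
      rw [← hau, ← hbv, ← ha1, ← hb1, hYP a' ha' b' hb' h]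
    · exact Sum.inr.inj h
  · intro v
    simp only [f]
    split_ifs with h
    · obtain ⟨a, ha, hau⟩ := h
      obtain ⟨a', ha', -, ha2⟩ := hlab a ha
      rw [← hau, ha2]
      exact Finset.inl_mem_disjSum.2 (hYB a' ha')
    · exact Finset.inr_mem_disjSum.2 (mem_univ _)
  · set X := univ.filter fun v => (1 / 2 - η / 2) * d ≤ ((crossGraph G P).degree v : ℝ) with hX
    have hXc : (X.card : ℝ) ≤ η / 2 * d := by
      have h1 := card_mul_le_of_le_degree G P X fun v hv => (mem_filter.1 hv).2
      have h2 : 16 * γ ≤ 4 * (3 / c + 4) * γ := by nlinarith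
      have h3 : 16 * γ * n ^ 2 ≤ η / 2 * c ^ 2 * n ^ 2 :=
        mul_le_mul_of_nonneg_right (h2.trans hγ') (by positivity)
      have h4 : (c * n) * (c * n) ≤ (d : ℝ) * d := mul_le_mul hd hd (by positivity) hd0.le
      have h6 : (X.card : ℝ) * (3 / 8 * d) ≤ X.card * ((1 / 2 - η / 2) * d) := by
        gcongr
        linarith
      have h5 : (X.card : ℝ) * d ≤ η / 2 * d * d := by nlinarith [sq_nonneg (n : ℝ)]
      exact le_of_mul_le_mul_right h5 hd0
    refine le_trans ?_ (sum_degree_sub_card_le G P X)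
    rw [← Finset.sum_subset (subset_univ X)]
    · refine Finset.sum_le_sum fun v hv => ?_
      have hv' := (mem_filter.1 hv).2
      rw [deviationCost]
      split_ifs with h
      · nlinarith
      · simp only [f]
        split_ifs with hm
        · simp only [Sum.elim_inl]
          linarith
        · simp only [Sum.elim_inr]
          linarith [hinr v hm]
    · intro v _ hv
      rw [deviationCost, if_pos]
      by_contra hne
      exact hv (mem_filter.2 ⟨mem_univ _, hdev v hne⟩)

theorem prColored_few_colors_le_exp {n : ℕ} {α : Type*} {G : SimpleGraph (Fin n)}
    {P : Fin n → α} {p c κ : ℝ} (hn : 2 ≤ n) (hp0 : 0 ≤ p) (hp1 : p ≤ 1)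
    (hκ : 0 < κ) (hκ1 : κ ≤ 1) {t : ℕ} (htN : t * (c * n) ≤ 2 * (crossEdges G P).card)
    (htn : t ≤ κ * (n - 1)) (hpn : 2 * (Real.log κ⁻¹ + 1) ≤ c * κ * (p * n)) :
    prColored n G p (fun H φ => ((H ∩ crossEdges G P).image φ).card ≤ t) ≤
      Real.exp (-((1 - 3 * κ) * p * (crossEdges G P).card)) := by
  have hn2 : (2 : ℝ) ≤ n := by exact_mod_cast hn
  have htn' : t ≤ n - 1 := by
    have : (t : ℝ) ≤ ((n - 1 : ℕ) : ℝ) := by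
      rw [Nat.cast_sub (by omega), Nat.cast_one]
      nlinarith
    exact_mod_cast this
  refine (prColored_few_colors_le G P hn hp0 hp1 htn' hκ hκ1).trans ?_
  set N := ((crossEdges G P).card : ℝ) with hN
  set r : ℝ := t / (n - 1 : ℝ) with hr
  have hr0 : 0 ≤ r := div_nonneg (by positivity) (by linarith)
  have hrκ : r ≤ κ := (div_le_iff₀ (by linarith)).2 htn
  have ht0 : (0 : ℝ) ≤ t := by positivity
  have hN0 : 0 ≤ N := by positivity
  have hpow : κ⁻¹ ^ t = Real.exp (t * Real.log κ⁻¹) := by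
    rw [Real.exp_nat_mul, Real.exp_log (by positivity)]
  have hlog : 0 ≤ Real.log κ⁻¹ := Real.log_nonneg ((one_le_inv₀ hκ).2 hκ1)
  rw [hpow, ← Real.exp_add, ← Real.exp_add]
  apply Real.exp_le_exp.2
  have hkey : t * (Real.log κ⁻¹ + 1) ≤ κ * p * N := by
    have e1 : t * (2 * (Real.log κ⁻¹ + 1)) ≤ t * (c * κ * (p * n)) :=
      mul_le_mul_of_nonneg_left hpn ht0
    have e2 : (κ * p) * (t * (c * n)) ≤ (κ * p) * (2 * N) :=
      mul_le_mul_of_nonneg_left htN (by positivity)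
    nlinarith
  have e3 : p * (N * r) ≤ p * (N * κ) := by gcongr
  have e4 : p * t ≤ t := mul_le_of_le_one_left ht0 hp1
  have e5 : 0 ≤ p * (r * t) := by positivity
  nlinarith

theorem sum_exp_deviationCost_le {V : Type*} [Fintype V] (B : Finset ℕ) (η d z : ℝ) (s : ℕ ⊕ V) :
    ∑ y ∈ B.disjSum univ, Real.exp (-(z * deviationCost η d s y)) ≤
      1 + B.card * Real.exp (-(z * ((1 / 2 - η) * d))) +
        Fintype.card V * Real.exp (-(z * ((1 - η) * d))) := by
  have hpt : ∀ y ∈ B.disjSum (univ : Finset V), Real.exp (-(z * deviationCost η d s y)) ≤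
      (if y = s then 1 else 0) + Sum.elim (fun _ => Real.exp (-(z * ((1 / 2 - η) * d))))
        (fun _ => Real.exp (-(z * ((1 - η) * d)))) y := by
    intro y _
    rw [deviationCost]
    split_ifs with h
    · rcases y with y | y <;> simp [Real.exp_nonneg]
    · rcases y with y | y <;> simp
  refine (Finset.sum_le_sum hpt).trans ?_
  rw [Finset.sum_add_distrib, Finset.sum_ite_eq', Finset.sum_disjSum]
  simp only [Sum.elim_inl, Sum.elim_inr, Finset.sum_const, nsmul_eq_mul, card_univ]
  rw [add_assoc]
  gcongr
  split_ifs <;> norm_num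

theorem prColored_few_crossing_le {n d l M : ℕ} {G : SimpleGraph (Fin n)} {p c κ γ : ℝ}
    (hn : 2 ≤ n) (hp0 : 0 ≤ p) (hp1 : p ≤ 1) (hc : 0 < c) (hκ : 0 < κ) (hκ1 : κ ≤ 1 / 6)
    (hl : ∀ A : Finset (Fin n), A.Nonempty → A ≠ univ → l ≤ (edgeCut G A).card)
    (hcl : c * n ≤ l) (hγ : 4 * γ ≤ κ * c)
    (hpn : 2 * (Real.log κ⁻¹ + 1) ≤ c * κ * (p * n))
    (hz1 : Real.log n ≤ (1 - 3 * κ) * p * (1 - κ) * ((1 / 2 - κ) * d))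
    (hz2 : 2 * Real.log n ≤ (1 - 3 * κ) * p * (1 - κ) * ((1 - κ) * d))
    {B : Finset ℕ} (hB : B.card ≤ M) {𝒮 : Finset (Fin n → ℕ ⊕ Fin n)} (h𝒮 : 𝒮.card ≤ M)
    (henc : ∀ P : Fin n → Fin n, ((crossEdges G P).card : ℝ) ≤ γ * n ^ 2 →
          ∃ s ∈ 𝒮, ∃ f : Fin n → ℕ ⊕ Fin n, (∀ u v, f u = f v ↔ P u = P v) ∧
            (∀ v, f v ∈ B.disjSum univ) ∧
            ∑ v, deviationCost κ d (s v) (f v) ≤ (crossEdges G P).card) :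
    prColored n G p (fun H φ => ∃ P : Fin n → Fin n, 2 ≤ (univ.image P).card ∧
      ((crossEdges G P).card : ℝ) ≤ γ * n ^ 2 ∧
      ((H ∩ crossEdges G P).image φ).card ≤ (univ.image P).card) ≤
      M * Real.exp (M + 1) * Real.exp (-((1 - 3 * κ) * p * (κ * (c * n)))) := by
  have hn2 : (2 : ℝ) ≤ n := by exact_mod_cast hn
  have hn0 : (0 : ℝ) < n := by linarith
  set z := (1 - 3 * κ) * p * (1 - κ) with hz
  set D : (Fin n → ℕ ⊕ Fin n) × (Fin n → ℕ ⊕ Fin n) → ℝ :=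
    fun i => ∑ v, deviationCost κ d (i.1 v) (i.2 v) with hD
  set full := 𝒮 ×ˢ Fintype.piFinset fun _ : Fin n => B.disjSum (univ : Finset (Fin n)) with hfull
  set I := full.filter fun i => c * n ≤ (crossEdges G i.2).card ∧ D i ≤ (crossEdges G i.2).card ∧
    (univ.image i.2).card * (c * n) ≤ 2 * (crossEdges G i.2).card ∧
    (univ.image i.2).card ≤ κ * (n - 1) with hI
  have hunion := prColored_le_sum (G := G) hn hp0 hp1 I
    (P := fun H φ => ∃ P : Fin n → Fin n, 2 ≤ (univ.image P).card ∧
      ((crossEdges G P).card : ℝ) ≤ γ * n ^ 2 ∧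
      ((H ∩ crossEdges G P).image φ).card ≤ (univ.image P).card)
    (Q := fun i H φ => ((H ∩ crossEdges G i.2).image φ).card ≤ (univ.image i.2).card)
    (by
      rintro H - φ ⟨P, hP2, hPγ, hPφ⟩
      obtain ⟨s, hs, f, hfP, hfB, hdev⟩ := henc P hPγ
      have hcross : crossEdges G f = crossEdges G P := by
        ext e
        induction e with | _ u v =>
        rw [mk_mem_crossEdges, mk_mem_crossEdges, Ne, Ne, hfP]
      have himg : (univ.image f).card = (univ.image P).card := by
        refine Finset.card_bij (fun y _ => if h : ∃ v, f v = y then P h.choose else P ⟨0, by omega⟩)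
          ?_ ?_ ?_
        · intro y _
          split_ifs <;> exact mem_image_of_mem _ (mem_univ _)
        · intro y hy y' hy' heq
          obtain ⟨u, -, hu⟩ := mem_image.1 hy
          obtain ⟨v, -, hv⟩ := mem_image.1 hy'
          have h1 : ∃ v, f v = y := ⟨u, hu⟩
          have h2 : ∃ v, f v = y' := ⟨v, hv⟩
          rw [dif_pos h1, dif_pos h2, ← hfP, h1.choose_spec, h2.choose_spec] at heq
          exact heq
        · intro y hy
          obtain ⟨u, -, rfl⟩ := mem_image.1 hy
          have h1 : ∃ v, f v = f u := ⟨u, rfl⟩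
          exact ⟨f u, mem_image_of_mem _ (mem_univ _), by
            rw [dif_pos h1, ← hfP]; exact h1.choose_spec⟩
      have htl : ((univ.image P).card : ℝ) * (c * n) ≤ 2 * (crossEdges G P).card := by
        have h : ((univ.image P).card : ℝ) * l ≤ 2 * (crossEdges G P).card := by
          exact_mod_cast card_image_mul_le G P hl hP2
        exact (mul_le_mul_of_nonneg_left hcl (by positivity)).trans h
      have hP2' : (2 : ℝ) ≤ (univ.image P).card := by exact_mod_cast hP2
      have hcn : 0 < c * n := by positivity
      refine ⟨(s, f), ?_, by simpa only [hcross, himg] using hPφ⟩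
      rw [hI, mem_filter, hfull, mem_product, Fintype.mem_piFinset]
      refine ⟨⟨hs, hfB⟩, ?_⟩
      simp only [hD, hcross, himg]
      refine ⟨by nlinarith, hdev, htl, ?_⟩
      have e1 : ((univ.image P).card : ℝ) * (c * n) ≤ (κ * (n - 1)) * (c * n) := by
        have e2 : 4 * γ * n ^ 2 ≤ κ * c * n ^ 2 := mul_le_mul_of_nonneg_right hγ (by positivity)
        have e3 : 0 ≤ κ * c * n * (n - 2) := mul_nonneg (by positivity) (by linarith)
        nlinarith
      exact le_of_mul_le_mul_right e1 hcn)
  refine hunion.trans ?_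
  have hw : 0 ≤ (1 - 3 * κ) * p := mul_nonneg (by linarith) hp0
  have hterm : ∀ i ∈ I, prColored n G p
      (fun H φ => ((H ∩ crossEdges G i.2).image φ).card ≤ (univ.image i.2).card) ≤
      Real.exp (-((1 - 3 * κ) * p * (κ * (c * n)))) *
        ∏ v, Real.exp (-(z * deviationCost κ d (i.1 v) (i.2 v))) := by
    intro i hi
    obtain ⟨-, h1, h2, h3, h4⟩ := mem_filter.1 hi
    refine (prColored_few_colors_le_exp hn hp0 hp1 hκ (by linarith) h3 h4 hpn).trans ?_
    rw [← Real.exp_sum, ← Real.exp_add, Finset.sum_neg_distrib, ← Finset.mul_sum]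
    apply Real.exp_le_exp.2
    have e : κ * (c * n) + (1 - κ) * D i ≤ (crossEdges G i.2).card := by nlinarith
    have := mul_le_mul_of_nonneg_left e hw
    rw [hz]
    simp only [hD] at this
    linarith
  refine (Finset.sum_le_sum hterm).trans ?_
  rw [← Finset.mul_sum, mul_comm]
  refine mul_le_mul_of_nonneg_right ?_ (Real.exp_nonneg _)
  calc ∑ i ∈ I, ∏ v, Real.exp (-(z * deviationCost κ d (i.1 v) (i.2 v)))
      ≤ ∑ i ∈ full, ∏ v, Real.exp (-(z * deviationCost κ d (i.1 v) (i.2 v))) :=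
        Finset.sum_le_sum_of_subset_of_nonneg (filter_subset _ _) fun _ _ _ =>
          Finset.prod_nonneg fun _ _ => Real.exp_nonneg _
    _ = ∑ s ∈ 𝒮, ∏ v, ∑ y ∈ B.disjSum univ, Real.exp (-(z * deviationCost κ d (s v) y)) := by
        rw [hfull, Finset.sum_product]
        refine Finset.sum_congr rfl fun s _ => ?_
        rw [Finset.prod_univ_sum]
    _ ≤ ∑ _s ∈ 𝒮, Real.exp (M + 1) := by
        refine Finset.sum_le_sum fun s _ => ?_
        have hv : ∀ v ∈ (univ : Finset (Fin n)),
            ∑ y ∈ B.disjSum univ, Real.exp (-(z * deviationCost κ d (s v) y)) ≤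
            Real.exp ((M + 1) / n) := by
          intro v _
          refine (sum_exp_deviationCost_le B κ d z (s v)).trans ?_
          have a1 : Real.exp (-(z * ((1 / 2 - κ) * d))) ≤ (n : ℝ)⁻¹ := by
            rw [← Real.exp_log (inv_pos.2 hn0), Real.log_inv]
            exact Real.exp_le_exp.2 (neg_le_neg hz1)
          have a2 : Real.exp (-(z * ((1 - κ) * d))) ≤ ((n : ℝ)⁻¹) ^ 2 := by
            rw [← Real.exp_log (pow_pos (inv_pos.2 hn0) 2), Real.log_pow, Real.log_inv]
            apply Real.exp_le_exp.2
            push_cast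
            linarith
          have a3 : (B.card : ℝ) ≤ M := by exact_mod_cast hB
          rw [Fintype.card_fin]
          calc 1 + (B.card : ℝ) * Real.exp (-(z * ((1 / 2 - κ) * d))) +
                n * Real.exp (-(z * ((1 - κ) * d))) ≤ 1 + M * (n : ℝ)⁻¹ + n * ((n : ℝ)⁻¹) ^ 2 := by
                gcongr
            _ = (M + 1) / n + 1 := by
                field_simp
                ring
            _ ≤ _ := Real.add_one_le_exp _
        refine (Finset.prod_le_prod (fun _ _ => Finset.sum_nonneg fun _ _ => Real.exp_nonneg _)
          hv).trans ?_
        rw [Finset.prod_const, card_univ, Fintype.card_fin, ← Real.exp_nat_mul,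
          mul_div_cancel₀ _ hn0.ne']
    _ = 𝒮.card * Real.exp (M + 1) := by rw [Finset.sum_const, nsmul_eq_mul]
    _ ≤ _ := by
        gcongr

/-- The kept edges of color in a `k`-set `S` are spanned by a forest `F` with fewer than `k`
edges, all with color in `S`, such that at least `N` edges of `G` join different components
of `F`. -/
def HasSmallForest {n : ℕ} (G : SimpleGraph (Fin n)) (k : ℕ) (N : ℝ) (H : Finset (Sym2 (Fin n)))
    (φ : Sym2 (Fin n) → Fin (n - 1)) : Prop :=
  ∃ S : Finset (Fin (n - 1)), S.card = k ∧
    ∃ F ⊆ G.edgeFinset, F.card < k ∧ N ≤ (crossEdges G (spanRep F)).card ∧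
      (∀ e ∈ F, e ∈ H ∧ φ e ∈ S) ∧ ∀ e ∈ crossEdges G (spanRep F), e ∈ H → φ e ∉ S

/-- At most `γ n²` edges of `G` join different fibers of some `P`, and those kept have at most as
many colors as `P` has nonempty fibers. -/
def HasSparsePartition {n : ℕ} (G : SimpleGraph (Fin n)) (γ : ℝ) (H : Finset (Sym2 (Fin n)))
    (φ : Sym2 (Fin n) → Fin (n - 1)) : Prop :=
  ∃ P : Fin n → Fin n, 2 ≤ (univ.image P).card ∧ ((crossEdges G P).card : ℝ) ≤ γ * n ^ 2 ∧
    ((H ∩ crossEdges G P).image φ).card ≤ (univ.image P).card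

theorem two_mul_card_edgeFinset {n d : ℕ} {G : SimpleGraph (Fin n)}
    (hG : G.IsRegularOfDegree d) : 2 * G.edgeFinset.card = n * d := by
  rw [← G.sum_degrees_eq_twice_card_edges, Finset.sum_congr rfl fun v _ => hG v]
  simp

theorem hasSmallForest_or_hasSparsePartition {n d : ℕ} {G : SimpleGraph (Fin n)}
    (hG : G.IsRegularOfDegree d) {γ : ℝ} (δ : ℝ) {H : Finset (Sym2 (Fin n))}
    (hn : 2 ≤ n)
    (hH : H ⊆ G.edgeFinset) {φ : Sym2 (Fin n) → Fin (n - 1)}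
    (h : ¬ HasRainbowSpanningTree H φ) :
    (∃ k, 1 ≤ k ∧ k ≤ n - 1 ∧
      HasSmallForest G k (if k ≤ δ * n then n * d / 2 - 4 * (k : ℝ) ^ 2 else γ * n ^ 2) H φ) ∨
    HasSparsePartition G γ H φ := by
  obtain ⟨S, F, hFH, hFS, hF, hspan⟩ := exists_deficient_colors (by omega) G hH h
  have hSn : S.card ≤ n - 1 := by simpa using card_le_univ S
  have hcross : ∀ e ∈ crossEdges G (spanRep F), e ∈ H → φ e ∉ S := by
    intro e he heH heS
    have := hspan e heH heS
    induction e with | _ u v =>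
    exact (mk_mem_crossEdges.1 he).2 (spanRep_eq_iff.2 this)
  have hsmall : ∀ N : ℝ, N ≤ (crossEdges G (spanRep F)).card → HasSmallForest G S.card N H φ :=
    fun N hN => ⟨S, rfl, F, hFH.trans hH, hFS, hN, fun e he => ⟨hFH he, hF e he⟩, hcross⟩
  by_cases hk : S.card ≤ δ * n
  · refine Or.inl ⟨S.card, by omega, hSn, hsmall _ ?_⟩
    rw [if_pos hk]
    have h1 := card_edgeFinset_le_crossEdges_add G F
    have h2 := two_mul_card_edgeFinset hG
    have h1' : (G.edgeFinset.card : ℝ) ≤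
      (crossEdges G (spanRep F)).card + 4 * (F.card : ℝ) ^ 2 := by exact_mod_cast h1
    have h2' : 2 * (G.edgeFinset.card : ℝ) = n * d := by exact_mod_cast h2
    have h3 : (F.card : ℝ) ^ 2 ≤ (S.card : ℝ) ^ 2 := by gcongr
    linarith
  by_cases hN : ((crossEdges G (spanRep F)).card : ℝ) ≤ γ * n ^ 2
  · right
    have h1 := le_card_image_spanRep_add F
    refine ⟨spanRep F, by omega, hN, ?_⟩
    have h2 : (H ∩ crossEdges G (spanRep F)).image φ ⊆ Sᶜ := by
      intro y hy
      obtain ⟨e, he, rfl⟩ := mem_image.1 hy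
      rw [Finset.mem_inter] at he
      exact mem_compl.2 (hcross e he.2 he.1)
    have h3 := card_le_card h2
    rw [card_compl, Fintype.card_fin] at h3
    omega
  · refine Or.inl ⟨S.card, by omega, hSn, hsmall _ ?_⟩
    rw [if_neg hk]
    exact (not_le.1 hN).le

theorem prColored_hasSmallForest_le {n d k : ℕ} {G : SimpleGraph (Fin n)}
    (hG : G.IsRegularOfDegree d) {ε p : ℝ} (hε : 0 < ε) (hn : 2 ≤ n) (hd : 0 < d)
    (hp : p = (2 + ε) * Real.log n / d) (hp1 : p ≤ 1) (hL : 1 ≤ Real.log n) (hk : k ≤ n - 1)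
    (N : ℝ) :
    prColored n G p (HasSmallForest G k N) ≤ (n - 1).choose k *
      ((Real.log n * Real.exp (2 + ε)) ^ k * Real.exp (-(p * (k / (n - 1 : ℝ)) * N))) := by
  have hn2 : (2 : ℝ) ≤ n := by exact_mod_cast hn
  have hd0 : (0 : ℝ) < d := by exact_mod_cast hd
  have hp0 : 0 ≤ p := by rw [hp]; positivity
  set L := Real.log n with hLdef
  have hL0 : 0 < L := by linarith
  refine (prColored_exists_forest_le G hn hp0 hp1 hk (inv_pos.2 hL0) (inv_le_one_of_one_le₀ hL)
    N).trans ?_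
  have h2 : 2 * (G.edgeFinset.card : ℝ) = n * d := by exact_mod_cast two_mul_card_edgeFinset hG
  have h3 : (G.edgeFinset.card : ℝ) = n * d / 2 := by linarith
  have h4 : L⁻¹ * ((2 + ε) * L / d * (k / (n - 1 : ℝ))) * (n * d / 2) =
      k * (2 + ε) * (n / (2 * (n - 1 : ℝ))) := by
    have : (n - 1 : ℝ) ≠ 0 := by linarith
    field_simp
  have h5 : L⁻¹ * (p * (k / (n - 1 : ℝ))) * G.edgeFinset.card ≤ k * (2 + ε) := by
    rw [h3, hp, h4]
    exact mul_le_of_le_one_right (by positivity) ((div_le_one (by linarith)).2 (by linarith))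
  rw [inv_inv, ← mul_assoc (L ^ k), mul_pow, ← Real.exp_nat_mul]
  have h6 := Real.exp_le_exp.2 h5
  gcongr

theorem prColored_hasSmallForest_le_pow {n d k : ℕ} {G : SimpleGraph (Fin n)}
    (hG : G.IsRegularOfDegree d) {ε p c δ : ℝ} (hε : 0 < ε) (hn : 2 ≤ n) (hd : 0 < d)
    (hp : p = (2 + ε) * Real.log n / d) (hp1 : p ≤ 1) (hL : 1 ≤ Real.log n) (hk : k ≤ n - 1)
    (hc : 0 < c) (hcd : c * n ≤ d) (hδ : (1 + ε / 4) ≤ (1 + ε / 2) * (1 - 8 * δ ^ 2 / c))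
    (hkδ : k ≤ δ * n) :
    prColored n G p (HasSmallForest G k (n * d / 2 - 4 * (k : ℝ) ^ 2)) ≤
      (Real.log n * Real.exp (2 + ε) * Real.exp (-(ε / 4 * Real.log n))) ^ k := by
  have hn2 : (2 : ℝ) ≤ n := by exact_mod_cast hn
  have hn0 : (0 : ℝ) < n := by linarith
  have hd0 : (0 : ℝ) < d := by exact_mod_cast hd
  refine (prColored_hasSmallForest_le hG hε hn hd hp hp1 hL hk _).trans ?_
  set L := Real.log n with hLdef
  have hL0 : 0 < L := by linarith
  have hchoose : (((n - 1).choose k : ℕ) : ℝ) ≤ Real.exp (k * L) := by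
    rw [Real.exp_nat_mul, hLdef, Real.exp_log hn0]
    have : (n - 1).choose k ≤ n ^ k :=
      (Nat.choose_le_pow _ _).trans (Nat.pow_le_pow_left (Nat.sub_le _ _) _)
    exact_mod_cast this
  have hN : n * d / 2 * (1 - 8 * δ ^ 2 / c) ≤ n * d / 2 - 4 * (k : ℝ) ^ 2 := by
    have h1 : (k : ℝ) ^ 2 ≤ (δ * n) ^ 2 := by gcongr
    have h2 : (n : ℝ) ≤ d / c := (le_div_iff₀ hc).2 (by linarith)
    have h3 : δ ^ 2 * n * n ≤ δ ^ 2 * n * (d / c) := by gcongr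
    have h4 : n * d / 2 * (8 * δ ^ 2 / c) = 4 * (δ ^ 2 * n * (d / c)) := by ring
    nlinarith
  have hN0 : (1 + ε / 4) * (L * k) ≤ p * (k / (n - 1 : ℝ)) * (n * d / 2 - 4 * (k : ℝ) ^ 2) := by
    have hp0 : 0 ≤ p := by rw [hp]; positivity
    have hq : p * (k / n) ≤ p * (k / (n - 1 : ℝ)) := by
      have : (0 : ℝ) < n - 1 := by linarith
      gcongr
      linarith
    have h8 : 0 ≤ 1 - 8 * δ ^ 2 / c := by
      by_contra! hlt
      nlinarith
    calc (1 + ε / 4) * (L * k) ≤ (1 + ε / 2) * (1 - 8 * δ ^ 2 / c) * (L * k) := by gcongr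
      _ = p * (k / n) * (n * d / 2 * (1 - 8 * δ ^ 2 / c)) := by
          rw [hp]
          field_simp
      _ ≤ p * (k / (n - 1 : ℝ)) * (n * d / 2 * (1 - 8 * δ ^ 2 / c)) := by gcongr
      _ ≤ p * (k / (n - 1 : ℝ)) * (n * d / 2 - 4 * (k : ℝ) ^ 2) := by
          have : (0 : ℝ) < n - 1 := by linarith
          gcongr
  calc ((n - 1).choose k : ℝ) * ((L * Real.exp (2 + ε)) ^ k *
        Real.exp (-(p * (k / (n - 1 : ℝ)) * (n * d / 2 - 4 * (k : ℝ) ^ 2))))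
      ≤ Real.exp (k * L) * ((L * Real.exp (2 + ε)) ^ k *
        Real.exp (-((1 + ε / 4) * (L * k)))) := by gcongr
    _ = _ := by
        rw [mul_pow (L * Real.exp (2 + ε)), ← Real.exp_nat_mul, mul_left_comm, ← Real.exp_add]
        ring_nf

theorem prColored_hasSmallForest_le_pow_card {n d k : ℕ} {G : SimpleGraph (Fin n)}
    (hG : G.IsRegularOfDegree d) {ε p γ δ : ℝ} (hε : 0 < ε) (hn : 2 ≤ n) (hd : 0 < d)
    (hdn : d ≤ n)
    (hp : p = (2 + ε) * Real.log n / d) (hp1 : p ≤ 1) (hL : 1 ≤ Real.log n) (hk : k ≤ n - 1)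
    (hγ : 0 < γ) (hδ : 0 < δ) (hkδ : δ * n ≤ k) :
    prColored n G p (HasSmallForest G k (γ * n ^ 2)) ≤
      (2 * (Real.log n * Real.exp (2 + ε) * Real.exp (-(2 * δ * γ * Real.log n)))) ^ n := by
  have hn2 : (2 : ℝ) ≤ n := by exact_mod_cast hn
  have hn0 : (0 : ℝ) < n := by linarith
  have hd0 : (0 : ℝ) < d := by exact_mod_cast hd
  have hdn' : (d : ℝ) ≤ n := by exact_mod_cast hdn
  refine (prColored_hasSmallForest_le hG hε hn hd hp hp1 hL hk _).trans ?_
  set L := Real.log n with hLdef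
  have hL0 : 0 < L := by linarith
  have hchoose : (((n - 1).choose k : ℕ) : ℝ) ≤ 2 ^ n := by
    have : (n - 1).choose k ≤ 2 ^ n :=
      (Nat.choose_le_two_pow _ _).trans (Nat.pow_le_pow_right (by norm_num) (Nat.sub_le _ _))
    exact_mod_cast this
  have hpow : (L * Real.exp (2 + ε)) ^ k ≤ (L * Real.exp (2 + ε)) ^ n := by
    refine pow_le_pow_right₀ ?_ (by omega)
    exact one_le_mul_of_one_le_of_one_le hL (Real.one_le_exp (by linarith))
  have hN0 : n * (2 * δ * γ * L) ≤ p * (k / (n - 1 : ℝ)) * (γ * n ^ 2) := by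
    have hn1 : (0 : ℝ) < n - 1 := by linarith
    have h1 : δ ≤ k / (n - 1 : ℝ) := by
      rw [le_div_iff₀ hn1]
      nlinarith
    have h2 : 2 * L / n ≤ p := by
      rw [hp]
      gcongr
      linarith
    have hp0 : 0 ≤ p := le_trans (by positivity) h2
    calc n * (2 * δ * γ * L) = 2 * L / n * δ * (γ * n ^ 2) := by
          field_simp
      _ ≤ _ := by gcongr
  calc ((n - 1).choose k : ℝ) * ((L * Real.exp (2 + ε)) ^ k *
        Real.exp (-(p * (k / (n - 1 : ℝ)) * (γ * n ^ 2))))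
      ≤ 2 ^ n * ((L * Real.exp (2 + ε)) ^ n * Real.exp (-(n * (2 * δ * γ * L)))) := by gcongr
    _ = _ := by
        rw [mul_pow 2, mul_pow (L * Real.exp (2 + ε)), ← Real.exp_nat_mul]
        ring_nf

theorem prColored_not_hasRainbowSpanningTree_le {n d : ℕ} {G : SimpleGraph (Fin n)}
    (hG : G.IsRegularOfDegree d) {p γ δ z y : ℝ} (hn : 2 ≤ n) (hp0 : 0 ≤ p) (hp1 : p ≤ 1)
    (hz0 : 0 ≤ z) (hz : z ≤ 1 / 2) (hy0 : 0 ≤ y) (hy : y ≤ 1 / 2)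
    (hsmall : ∀ k : ℕ, k ≤ n - 1 → k ≤ δ * n →
      prColored n G p (HasSmallForest G k (n * d / 2 - 4 * (k : ℝ) ^ 2)) ≤ z ^ k)
    (hlarge : ∀ k : ℕ, k ≤ n - 1 → δ * n ≤ k →
      prColored n G p (HasSmallForest G k (γ * n ^ 2)) ≤ y ^ n) :
    prColored n G p (fun H φ => ¬ HasRainbowSpanningTree H φ) ≤
      prColored n G p (HasSparsePartition G γ) + (2 * z + n * (1 / 2) ^ n) := by
  refine (prColored_le_sum hn hp0 hp1 (insertNone (range (n - 1)))
    (Q := fun i => i.elim (HasSparsePartition G γ) fun k => HasSmallForest G (k + 1)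
      (if ((k + 1 : ℕ) : ℝ) ≤ δ * n then n * d / 2 - 4 * ((k + 1 : ℕ) : ℝ) ^ 2 else γ * n ^ 2))
    ?_).trans ?_
  · intro H hH φ h
    rcases hasSmallForest_or_hasSparsePartition hG δ hn hH h with ⟨k, hk1, hkn, hk⟩ | h
    · refine ⟨some (k - 1), by simp; omega, ?_⟩
      simp only [Option.elim_some]
      rwa [Nat.sub_add_cancel hk1]
    · exact ⟨none, by simp, h⟩
  rw [sum_insertNone]
  simp only [Option.elim_none, Option.elim_some]
  gcongr
  have hk : ∀ k ∈ range (n - 1), prColored n G p (HasSmallForest G (k + 1)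
      (if ((k + 1 : ℕ) : ℝ) ≤ δ * n then n * d / 2 - 4 * ((k + 1 : ℕ) : ℝ) ^ 2 else γ * n ^ 2)) ≤
      z * (1 / 2) ^ k + (1 / 2) ^ n := by
    intro k hk
    have hkn : k + 1 ≤ n - 1 := by
      have := mem_range.1 hk
      omega
    have h1 : z ^ (k + 1) ≤ z * (1 / 2) ^ k := by
      rw [pow_succ']
      gcongr
    have h2 : y ^ n ≤ (1 / 2) ^ n := by gcongr
    have h3 : (0 : ℝ) ≤ z * (1 / 2) ^ k := by positivity
    have h4 : (0 : ℝ) ≤ (1 / 2) ^ n := by positivity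
    split_ifs with hδ
    · linarith [hsmall (k + 1) hkn hδ]
    · linarith [hlarge (k + 1) hkn (not_le.1 hδ).le]
  refine (Finset.sum_le_sum hk).trans ?_
  rw [Finset.sum_add_distrib, ← Finset.mul_sum, Finset.sum_const, card_range, nsmul_eq_mul,
    mul_comm 2 z]
  gcongr
  · exact sum_geometric_two_le _
  · exact_mod_cast Nat.sub_le n 1

theorem tendsto_mul_exp_neg_mul {a : ℝ} (ha : 0 < a) (C : ℝ) :
    Tendsto (fun x : ℝ => x * C * Real.exp (-(a * x))) atTop (nhds 0) := by
  have h := ((Real.tendsto_pow_mul_exp_neg_atTop_nhds_zero 1).comp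
    (tendsto_id.const_mul_atTop ha)).const_mul (C / a)
  rw [mul_zero] at h
  refine h.congr fun x => ?_
  simp only [Function.comp, id, pow_one]
  field_simp

theorem one_le_sparse_exponent {ε κ : ℝ} (hε : 0 < ε) (hκ : κ = ε / (6 * (2 + ε))) :
    1 ≤ (1 - 3 * κ) * (1 - κ) * ((1 / 2 - κ) * (2 + ε)) ∧
      2 ≤ (1 - 3 * κ) * (1 - κ) * ((1 - κ) * (2 + ε)) ∧ 1 ≤ (1 - 3 * κ) * (2 + ε) := by
  have hκ0 : 0 < κ := by rw [hκ]; positivity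
  have h6 : (1 - 6 * κ) * (2 + ε) = 2 := by
    rw [hκ]
    field_simp
    ring
  have hκ1 : κ ≤ 1 / 6 := by
    by_contra! h
    nlinarith
  have h1 : 1 - 6 * κ ≤ (1 - 3 * κ) * (1 - κ) * (1 - 2 * κ) := by
    nlinarith [sq_nonneg κ, mul_nonneg (sq_nonneg κ) (by linarith : (0 : ℝ) ≤ 11 - 6 * κ)]
  have h2 := mul_le_mul_of_nonneg_right h1 (by linarith : (0 : ℝ) ≤ 2 + ε)
  have h3 : 0 ≤ (1 - 3 * κ) * (1 - κ) * (2 + ε) := by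
    refine mul_nonneg (mul_nonneg ?_ ?_) ?_ <;> linarith
  refine ⟨by linarith, ?_, by nlinarith⟩
  nlinarith [mul_nonneg h3 hκ0.le]

/-- If `G = G(n)` is a `d`-regular, `λ`-edge-connected graph on `n` vertices with
`d ≥ λ ≥ c·n`, and `p = (2 + ε)·(log n)/d`, then a.a.s. the random subgraph `G_p`,
with edges colored uniformly at random from `{1, …, n − 1}`, contains a rainbow
spanning tree. -/
theorem rainbow_spanning_tree_aas (ε c : ℝ) (hε : 0 < ε) (hc : 0 < c)
    (d lam : ℕ → ℕ) (G : ∀ n : ℕ, SimpleGraph (Fin n))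
    (hG : ∀ᶠ n : ℕ in atTop,
      (G n).IsRegularOfDegree (d n) ∧
      (∀ A : Finset (Fin n), A.Nonempty → A ≠ Finset.univ →
        lam n ≤ (edgeCut (G n) A).card) ∧
      lam n ≤ d n ∧ c * n ≤ (lam n : ℝ)) :
    Tendsto (fun n : ℕ =>
        prColored n (G n) ((2 + ε) * Real.log n / d n)
          (fun H φ => HasRainbowSpanningTree H φ))
      atTop (nhds 1) := by
  obtain ⟨κ, hκ⟩ : ∃ κ : ℝ, κ = ε / (6 * (2 + ε)) := ⟨_, rfl⟩
  have hκ0 : 0 < κ := by rw [hκ]; positivity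
  have hκ1 : κ ≤ 1 / 6 := by
    rw [hκ, div_le_div_iff₀ (by positivity) (by norm_num)]
    linarith
  obtain ⟨hexp1, hexp2, hexp3⟩ := one_le_sparse_exponent hε hκ
  obtain ⟨γ₀, hγ₀, M, henc⟩ := exists_encoding hc hκ0 (by linarith : κ ≤ 1 / 4)
  obtain ⟨γ, hγ, hγ₁, hγ₂⟩ : ∃ γ : ℝ, 0 < γ ∧ γ ≤ γ₀ ∧ 4 * γ ≤ κ * c :=
    ⟨min γ₀ (κ * c / 4), lt_min hγ₀ (by positivity), min_le_left _ _, by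
      linarith [min_le_right γ₀ (κ * c / 4)]⟩
  obtain ⟨δ, hδ, hδε⟩ : ∃ δ : ℝ, 0 < δ ∧ 1 + ε / 4 ≤ (1 + ε / 2) * (1 - 8 * δ ^ 2 / c) := by
    refine ⟨√(c * ((ε / 4) / (1 + ε / 2)) / 8), Real.sqrt_pos.2 (by positivity), ?_⟩
    rw [Real.sq_sqrt (by positivity)]
    apply le_of_eq
    field_simp
    ring
  set z : ℝ → ℝ := fun L => L * Real.exp (2 + ε) * Real.exp (-(ε / 4 * L)) with hz
  set y : ℝ → ℝ := fun L => 2 * (L * Real.exp (2 + ε) * Real.exp (-(2 * δ * γ * L))) with hy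
  set w : ℝ → ℝ := fun L => M * Real.exp (M + 1) * Real.exp (-(κ * c * L)) with hw
  have hlog : Tendsto (fun n : ℕ => Real.log n) atTop atTop :=
    Real.tendsto_log_atTop.comp tendsto_natCast_atTop_atTop
  have hzt : Tendsto (fun n : ℕ => z (Real.log n)) atTop (nhds 0) :=
    (tendsto_mul_exp_neg_mul (by positivity) _).comp hlog
  have hyt : Tendsto (fun n : ℕ => y (Real.log n)) atTop (nhds 0) := by
    have := ((tendsto_mul_exp_neg_mul (by positivity : 0 < 2 * δ * γ)
      (Real.exp (2 + ε))).comp hlog).const_mul 2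
    rwa [mul_zero] at this
  have hwt : Tendsto (fun n : ℕ => w (Real.log n)) atTop (nhds 0) := by
    have := ((Real.tendsto_exp_neg_atTop_nhds_zero.comp (tendsto_id.const_mul_atTop
      (by positivity : 0 < κ * c))).comp hlog).const_mul (M * Real.exp (M + 1))
    rwa [mul_zero] at this
  have hpt : Tendsto (fun n : ℕ => (2 + ε) / c * (Real.log n / n)) atTop (nhds 0) := by
    have := ((Real.tendsto_pow_log_div_mul_add_atTop 1 0 1 one_ne_zero).comp
      tendsto_natCast_atTop_atTop).const_mul ((2 + ε) / c)
    rw [mul_zero] at this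
    refine this.congr fun n => ?_
    simp
  have hbound : Tendsto (fun n : ℕ => 1 - (w (Real.log n) +
      (2 * z (Real.log n) + n * (1 / 2 : ℝ) ^ n))) atTop (nhds 1) := by
    have h := (hwt.add ((hzt.const_mul 2).add (tendsto_self_mul_const_pow_of_lt_one
      (by norm_num : (0 : ℝ) ≤ 1 / 2) (by norm_num)))).const_sub 1
    simpa using h
  have hev : ∀ᶠ n : ℕ in atTop, 1 - (w (Real.log n) +
      (2 * z (Real.log n) + n * (1 / 2 : ℝ) ^ n)) ≤ prColored n (G n)
        ((2 + ε) * Real.log n / d n) (fun H φ => HasRainbowSpanningTree H φ) ∧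
      prColored n (G n) ((2 + ε) * Real.log n / d n)
        (fun H φ => HasRainbowSpanningTree H φ) ≤ 1 := by
    filter_upwards [hG, eventually_ge_atTop 2, hlog.eventually_ge_atTop 1,
      hlog.eventually_ge_atTop (2 * (Real.log κ⁻¹ + 1) / (c * κ)),
      hzt.eventually_le_const (by norm_num : (0 : ℝ) < 1 / 2),
      hyt.eventually_le_const (by norm_num : (0 : ℝ) < 1 / 2),
      hpt.eventually_le_const (by norm_num : (0 : ℝ) < 1)] with
      n ⟨hreg, hcut, hld, hcl⟩ hn hL hLκ hzn hyn hpn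
    have hn0 : (0 : ℝ) < n := by positivity
    have hcd : c * n ≤ d n := hcl.trans (by exact_mod_cast hld)
    have hd0 : (0 : ℝ) < d n := lt_of_lt_of_le (by positivity) hcd
    have hd : 0 < d n := by exact_mod_cast hd0
    have hdn : d n ≤ n := by
      have := (G n).degree_lt_card_verts ⟨0, by omega⟩
      rw [hreg, Fintype.card_fin] at this
      exact this.le
    have hdn' : (d n : ℝ) ≤ n := by exact_mod_cast hdn
    obtain ⟨p, hp⟩ : ∃ p, p = (2 + ε) * Real.log n / d n := ⟨_, rfl⟩
    set L := Real.log n with hLdef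
    have hL0 : 0 < L := by linarith
    have hp0 : 0 ≤ p := by rw [hp]; positivity
    have hp1 : p ≤ 1 := by
      refine le_trans ?_ hpn
      calc p = (2 + ε) * L / d n := hp
        _ ≤ (2 + ε) * L / (c * n) := by gcongr
        _ = _ := by field_simp
    have hpd : p * d n = (2 + ε) * L := by
      rw [hp]
      field_simp
    have hpn' : (2 + ε) * L ≤ p * n := by
      rw [← hpd]
      gcongr
    rw [← hp]
    have hsparse : prColored n (G n) p (HasSparsePartition (G n) γ) ≤ w L := by
      obtain ⟨B, hB, 𝒮, h𝒮, hS⟩ := henc n (d n) (G n) (by omega) hreg hcd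
      refine (prColored_few_crossing_le hn hp0 hp1 hc hκ0 hκ1 hcut hcl hγ₂ ?_ ?_ ?_ hB h𝒮
        fun P hP => hS P (hP.trans (by gcongr))).trans ?_
      · rw [div_le_iff₀ (by positivity)] at hLκ
        have : L * (c * κ) ≤ p * n * (c * κ) := by
          gcongr
          nlinarith
        linarith
      · calc L ≤ (1 - 3 * κ) * (1 - κ) * ((1 / 2 - κ) * (2 + ε)) * L :=
              le_mul_of_one_le_left hL0.le hexp1
          _ = (1 - 3 * κ) * (1 - κ) * (1 / 2 - κ) * (p * d n) := by rw [hpd]; ring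
          _ = _ := by ring
      · calc 2 * L ≤ (1 - 3 * κ) * (1 - κ) * ((1 - κ) * (2 + ε)) * L := by gcongr
          _ = (1 - 3 * κ) * (1 - κ) * (1 - κ) * (p * d n) := by rw [hpd]; ring
          _ = _ := by ring
      · rw [hw]
        have : L ≤ (1 - 3 * κ) * (p * n) := by
          calc L ≤ (1 - 3 * κ) * (2 + ε) * L := le_mul_of_one_le_left hL0.le hexp3
            _ = (1 - 3 * κ) * ((2 + ε) * L) := by ring
            _ ≤ _ := mul_le_mul_of_nonneg_left hpn' (by linarith)
        have := mul_le_mul_of_nonneg_left this (by positivity : 0 ≤ κ * c)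
        refine mul_le_mul_of_nonneg_left (Real.exp_le_exp.2 ?_) (by positivity)
        linarith
    have hmain := prColored_not_hasRainbowSpanningTree_le hreg (γ := γ) (δ := δ) hn hp0 hp1
      (by positivity : 0 ≤ z L) hzn (by positivity : 0 ≤ y L) hyn
      (fun k hk hkδ => prColored_hasSmallForest_le_pow hreg hε hn hd hp hp1 hL hk hc hcd hδε hkδ)
      (fun k hk hkδ => prColored_hasSmallForest_le_pow_card hreg hε hn hd hdn hp hp1 hL hk hγ hδ
        hkδ)
    have h0 := prColored_nonneg (G n) hn hp0 hp1 (fun H φ => ¬ HasRainbowSpanningTree H φ)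
    have h1 := prColored_not (G n) p hn (fun H φ => HasRainbowSpanningTree H φ)
    constructor <;> linarith
  exact tendsto_of_tendsto_of_tendsto_of_le_of_le' hbound tendsto_const_nhds
    (hev.mono fun _ h => h.1) (hev.mono fun _ h => h.2)
end

section
/- For every constant c > 0 the following holds. For each n, let G = G(n) be a λ-edge-connected graph on n vertices with λ ≥ c·n, and let p = p(n) < (log n)²/n. Then a.a.s. the random subgraph G_p contains at most |S|/2 edges in each edge-cut S of G; that is, the probability that for every nonempty proper subset A ⊆ V(G) the number of edges of G_p with exactly one endpoint in A is at most half the number of edges of G with exactly one endpoint in A tends to 1 as n → ∞. -/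
open Finset SimpleGraph Filter
open scoped Classical

/-- The probability that the random subgraph of `G`, obtained by keeping each edge
independently with probability `p`, satisfies the property `P` (as a function of the
set of kept edges). -/
noncomputable def prSub (n : ℕ) (G : SimpleGraph (Fin n)) (p : ℝ)
    (P : Finset (Sym2 (Fin n)) → Prop) : ℝ :=
  ∑ H ∈ G.edgeFinset.powerset,
    p ^ H.card * (1 - p) ^ (G.edgeFinset.card - H.card) * (if P H then 1 else 0)

theorem sum_weight_mul_pow_inter {α : Type*} [DecidableEq α] (E S : Finset α) (hS : S ⊆ E)
    (p w : ℝ) :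
    ∑ H ∈ E.powerset, p ^ H.card * (1 - p) ^ (E.card - H.card) * w ^ (H ∩ S).card
      = (p * w + (1 - p)) ^ S.card := by
  have key := Finset.prod_add (fun e => p * (if e ∈ S then w else 1)) (fun _ => 1 - p) E
  have hleft : ∏ e ∈ E, (p * (if e ∈ S then w else 1) + (1 - p))
      = (p * w + (1 - p)) ^ S.card := by
    rw [← Finset.prod_subset hS fun e _ he => by simp [he],
      Finset.prod_congr rfl fun e he => by rw [if_pos he], Finset.prod_const]
  rw [← hleft, key]
  refine Finset.sum_congr rfl fun H hH => ?_
  rw [Finset.mem_powerset] at hH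
  rw [Finset.prod_const, Finset.card_sdiff_of_subset hH, Finset.prod_mul_distrib,
    Finset.prod_const, ← Finset.prod_filter, Finset.filter_mem_eq_inter, Finset.prod_const]
  ring

theorem prSub_le_one {n : ℕ} (G : SimpleGraph (Fin n)) {p : ℝ} (hp0 : 0 ≤ p) (hp1 : p ≤ 1)
    (P : Finset (Sym2 (Fin n)) → Prop) : prSub n G p P ≤ 1 := by
  have htotal := Finset.sum_pow_mul_eq_add_pow p (1 - p) G.edgeFinset
  rw [add_sub_cancel, one_pow] at htotal
  rw [← htotal]
  refine Finset.sum_le_sum fun H _ => mul_le_of_le_one_right ?_ (by split_ifs <;> norm_num)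
  have := sub_nonneg.2 hp1
  positivity

/-- Exponential Markov inequality and union bound over all cuts. -/
theorem one_sub_sum_le_prSub {n : ℕ} (G : SimpleGraph (Fin n)) {p z : ℝ} (hp0 : 0 ≤ p)
    (hp1 : p ≤ 1) (hz : 1 ≤ z) :
    1 - ∑ A : Finset (Fin n) with A.Nonempty ∧ A ≠ Finset.univ,
        ((p * z ^ 2 + (1 - p)) / z) ^ (edgeCut G A).card
      ≤ prSub n G p (fun H => ∀ A : Finset (Fin n), A.Nonempty → A ≠ Finset.univ →
          2 * (H ∩ edgeCut G A).card ≤ (edgeCut G A).card) := by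
  have hq := sub_nonneg.2 hp1
  have hz0 : 0 < z := by linarith
  have htotal := Finset.sum_pow_mul_eq_add_pow p (1 - p) G.edgeFinset
  rw [add_sub_cancel, one_pow] at htotal
  have hmoment (A : Finset (Fin n)) :
      ((p * z ^ 2 + (1 - p)) / z) ^ (edgeCut G A).card
        = ∑ H ∈ G.edgeFinset.powerset, p ^ H.card * (1 - p) ^ (G.edgeFinset.card - H.card) *
            ((z ^ 2) ^ (H ∩ edgeCut G A).card / z ^ (edgeCut G A).card) := by
    rw [div_pow, ← sum_weight_mul_pow_inter G.edgeFinset (edgeCut G A) (Finset.filter_subset _ _),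
      Finset.sum_div]
    exact Finset.sum_congr rfl fun H _ => mul_div_assoc _ _ _
  rw [Finset.sum_congr rfl fun A _ => hmoment A, Finset.sum_comm, prSub]
  refine (sub_le_sub_right htotal.ge _).trans ?_
  rw [← Finset.sum_sub_distrib]
  refine Finset.sum_le_sum fun H _ => ?_
  rw [← Finset.mul_sum, ← mul_one_sub]
  refine mul_le_mul_of_nonneg_left ?_ (by positivity)
  split_ifs with hP
  · exact sub_le_self _ (Finset.sum_nonneg fun A _ => by positivity)
  · push Not at hP
    obtain ⟨A, hA, hA', hlt⟩ := hP
    refine sub_nonpos.2 (le_trans ?_ (Finset.single_le_sum (fun A _ => by positivity)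
      (Finset.mem_filter.2 ⟨Finset.mem_univ A, hA, hA'⟩)))
    rw [one_le_div (by positivity), ← pow_mul]
    exact pow_le_pow_right₀ hz hlt.le

/-- If `G = G(n)` is `λ`-edge-connected on `n` vertices with `λ ≥ c·n`, and
`0 < p < (log n)²/n`, then a.a.s. the random subgraph `G_p` contains at most `|S|/2`
edges in each edge-cut `S` of `G`. -/
theorem half_of_every_cut_aas (c : ℝ) (hc : 0 < c)
    (lam : ℕ → ℕ) (G : ∀ n : ℕ, SimpleGraph (Fin n)) (p : ℕ → ℝ)
    (h : ∀ᶠ n : ℕ in atTop,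
      (∀ A : Finset (Fin n), A.Nonempty → A ≠ Finset.univ →
        lam n ≤ (edgeCut (G n) A).card) ∧
      c * n ≤ (lam n : ℝ) ∧
      0 < p n ∧ p n < 1 ∧ p n < (Real.log n) ^ 2 / n) :
    Tendsto (fun n : ℕ =>
        prSub n (G n) (p n)
          (fun H => ∀ A : Finset (Fin n), A.Nonempty → A ≠ Finset.univ →
            2 * (H ∩ edgeCut (G n) A).card ≤ (edgeCut (G n) A).card))
      atTop (nhds 1) := by
  obtain ⟨z, hz2, hzc⟩ : ∃ z : ℝ, 2 ≤ z ∧ (2 / z) ^ c = 1 / 4 := by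
    refine ⟨2 * 4 ^ (1 / c), ?_, ?_⟩
    · have : (1 : ℝ) ≤ 4 ^ (1 / c) := Real.one_le_rpow (by norm_num) (by positivity)
      linarith
    · rw [div_mul_cancel_left₀ two_ne_zero, Real.inv_rpow (by positivity),
        ← Real.rpow_mul (by norm_num), one_div_mul_cancel hc.ne', Real.rpow_one, one_div]
  have hz0 : 0 < z := by linarith
  have hlog : ∀ᶠ n : ℕ in atTop, (Real.log n) ^ 2 / n < 1 / z ^ 2 :=
    ((Real.isLittleO_pow_log_id_atTop (n := 2)).tendsto_div_nhds_zero.comp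
      tendsto_natCast_atTop_atTop).eventually_lt_const (by positivity)
  have hlim : Tendsto (fun n : ℕ => 1 - (1 / 2 : ℝ) ^ n) atTop (nhds 1) := by
    simpa using (tendsto_pow_atTop_nhds_zero_of_lt_one (r := (1 / 2 : ℝ))
      (by norm_num) (by norm_num)).const_sub 1
  refine tendsto_of_tendsto_of_tendsto_of_le_of_le' hlim tendsto_const_nhds ?_ ?_
  · filter_upwards [h, hlog] with n ⟨hcut, hlam, hp0, hp1, hp⟩ hn
    refine le_trans (sub_le_sub_left ?_ 1)
      (one_sub_sum_le_prSub (G n) hp0.le hp1.le (by linarith : 1 ≤ z))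
    have hpz : p n * z ^ 2 ≤ 1 := by
      have := (lt_div_iff₀ (by positivity)).1 (hp.trans hn)
      exact this.le
    have hterm : ∀ A ∈ Finset.univ.filter fun A : Finset (Fin n) => A.Nonempty ∧ A ≠ Finset.univ,
        ((p n * z ^ 2 + (1 - p n)) / z) ^ (edgeCut (G n) A).card ≤ (1 / 4 : ℝ) ^ n := by
      intro A hA
      obtain ⟨hA, hA'⟩ := (Finset.mem_filter.1 hA).2
      have hcard : c * n ≤ ((edgeCut (G n) A).card : ℝ) :=
        hlam.trans (Nat.cast_le.2 (hcut A hA hA'))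
      have hq := sub_pos.2 hp1
      calc ((p n * z ^ 2 + (1 - p n)) / z) ^ (edgeCut (G n) A).card
          ≤ (2 / z) ^ (edgeCut (G n) A).card := by
            gcongr
            linarith
        _ = (2 / z) ^ ((edgeCut (G n) A).card : ℝ) := (Real.rpow_natCast _ _).symm
        _ ≤ (2 / z) ^ (c * n) :=
            Real.rpow_le_rpow_of_exponent_ge (by positivity) ((div_le_one hz0).2 hz2) hcard
        _ = (1 / 4 : ℝ) ^ n := by rw [Real.rpow_mul (by positivity), hzc, Real.rpow_natCast]
    calc _ ≤ ∑ A : Finset (Fin n) with A.Nonempty ∧ A ≠ Finset.univ, (1 / 4 : ℝ) ^ n :=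
          Finset.sum_le_sum hterm
      _ ≤ ∑ _A : Finset (Fin n), (1 / 4 : ℝ) ^ n :=
          Finset.sum_le_sum_of_subset_of_nonneg (Finset.filter_subset _ _)
            fun _ _ _ => by positivity
      _ = (1 / 2 : ℝ) ^ n := by
          rw [Finset.sum_const, Finset.card_univ, Fintype.card_finset, Fintype.card_fin,
            nsmul_eq_mul, Nat.cast_pow, ← mul_pow]
          norm_num
  · filter_upwards [h] with n ⟨_, _, hp0, hp1, _⟩
    exact prSub_le_one (G n) hp0.le hp1.le _
end

section
/- For every constant ε > 0 and every constant c > 0 the following holds. For each n, let G = G(n) be a d-regular graph on n vertices with d ≥ c·n, and let p = (2 + ε)·(log n)/d. Form the random subgraph G_p by keeping each edge of G independently with probability p, and color each edge of G_p independently and uniformly at random from {1, …, n−1}. Then a.a.s. the edge-colored graph G_p contains a rainbow forest with at least n − (log n)³ edges. -/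
open Finset SimpleGraph Filter
open scoped Classical

/-- The edge-colored graph given by the kept edges `H` and the coloring `φ` contains a
rainbow forest with at least `m` edges (`m` a real number). -/
def HasRainbowForest {n : ℕ} (H : Finset (Sym2 (Fin n)))
    (φ : Sym2 (Fin n) → Fin (n - 1)) (m : ℝ) : Prop :=
  ∃ T ⊆ H, (SimpleGraph.fromEdgeSet (T : Set (Sym2 (Fin n)))).IsAcyclic ∧
    Set.InjOn φ ↑T ∧ m ≤ (T.card : ℝ)

/-- The dimension of the span of the vectors indexed by a finite set. -/
noncomputable def vecRank {α K W : Type*} [Field K] [AddCommGroup W] [Module K W]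
    (v : α → W) (A : Finset α) : ℕ :=
  Module.finrank K (Submodule.span K (v '' (A : Set α)))

lemma vecRank_submodular {α K W : Type*} [Field K] [AddCommGroup W] [Module K W]
    [FiniteDimensional K W] (v : α → W) {X Y Z₁ Z₂ : Finset α}
    (h₁ : Z₁ ⊆ X ∪ Y) (h₂ : Z₂ ⊆ X) (h₃ : Z₂ ⊆ Y) :
    vecRank (K := K) v Z₁ + vecRank (K := K) v Z₂ ≤
      vecRank (K := K) v X + vecRank (K := K) v Y := by
  unfold vecRank
  rw [← Submodule.finrank_sup_add_finrank_inf_eq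
    (Submodule.span K (v '' (X : Set α))) (Submodule.span K (v '' (Y : Set α)))]
  refine add_le_add (Submodule.finrank_mono ?_) (Submodule.finrank_mono (le_inf ?_ ?_))
  · rw [← Submodule.span_union, ← Set.image_union]
    exact Submodule.span_mono (Set.image_mono (by exact_mod_cast h₁))
  · exact Submodule.span_mono (Set.image_mono (by exact_mod_cast h₂))
  · exact Submodule.span_mono (Set.image_mono (by exact_mod_cast h₃))

lemma exists_linearIndepOn_card_eq_vecRank {α K W : Type*} [Field K] [AddCommGroup W]
    [Module K W] (v : α → W) (A : Finset α) :
    ∃ T ⊆ A, LinearIndepOn K v (T : Set α) ∧ T.card = vecRank (K := K) v A ∧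
      v '' (A : Set α) ⊆ Submodule.span K (v '' (T : Set α)) := by
  obtain ⟨b, hbA, -, hspan, hb⟩ :=
    exists_linearIndepOn_extension (linearIndepOn_empty K v) (Set.empty_subset (A : Set α))
  have hfin : b.Finite := A.finite_toSet.subset hbA
  lift b to Finset α using hfin
  refine ⟨b, by exact_mod_cast hbA, hb, ?_, hspan⟩
  have h1 : Submodule.span K (v '' (A : Set α)) = Submodule.span K (v '' (b : Set α)) :=
    le_antisymm (Submodule.span_le.2 hspan) (Submodule.span_mono (Set.image_mono hbA))
  unfold vecRank
  rw [h1, Set.image_eq_range]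
  have := finrank_span_eq_card (R := K) (b := fun x : (b : Set α) => v x) hb
  rw [this]
  simp

/-- Rado's theorem on independent transversals, with deficiency `D`, for vectors. -/
lemma exists_rainbow_linearIndepOn {α K W C : Type*} [Field K] [AddCommGroup W]
    [Module K W] [FiniteDimensional K W] [Fintype C] (v : α → W) (φ : α → C) (D : ℕ)
    (A : Finset α)
    (hA : ∀ S : Finset C, S.card ≤ vecRank (K := K) v (A.filter (φ · ∈ S)) + D) :
    ∃ T ⊆ A, Set.InjOn φ (T : Set α) ∧ LinearIndepOn K v (T : Set α) ∧
      Fintype.card C ≤ T.card + D := by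
  induction A using Finset.strongInduction with
  | H A ih =>
  by_cases hinj : Set.InjOn φ (A : Set α)
  · obtain ⟨T, hTA, hT, hcard, -⟩ := exists_linearIndepOn_card_eq_vecRank (K := K) v A
    refine ⟨T, hTA, hinj.mono (by exact_mod_cast hTA), hT, ?_⟩
    simpa [hcard] using hA univ
  · by_cases hsub : ∃ x ∈ A, ∀ S : Finset C,
        S.card ≤ vecRank (K := K) v ((A.erase x).filter (φ · ∈ S)) + D
    · obtain ⟨x, hx, hS⟩ := hsub
      obtain ⟨T, hT, h⟩ := ih _ (Finset.erase_ssubset hx) hS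
      exact ⟨T, hT.trans (Finset.erase_subset _ _), h⟩
    · exfalso
      push Not at hsub
      simp only [Set.InjOn, not_forall] at hinj
      obtain ⟨x, hx, y, hy, hxy, hne⟩ := hinj
      have key : ∀ z ∈ A, ∀ S : Finset C,
          vecRank (K := K) v ((A.erase z).filter (φ · ∈ S)) + D < S.card → φ z ∈ S := by
        intro z _ S hS
        by_contra hz
        have : (A.erase z).filter (φ · ∈ S) = A.filter (φ · ∈ S) := by
          ext w
          simp only [Finset.mem_filter, Finset.mem_erase]
          constructor
          · rintro ⟨⟨-, h⟩, h'⟩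
            exact ⟨h, h'⟩
          · rintro ⟨h, h'⟩
            exact ⟨⟨by rintro rfl; exact hz h', h⟩, h'⟩
        rw [this] at hS
        exact absurd (hA S) (by omega)
      obtain ⟨S₁, h₁⟩ := hsub x hx
      obtain ⟨S₂, h₂⟩ := hsub y hy
      have hx₁ := key x hx S₁ h₁
      have hy₂ := key y hy S₂ h₂
      have hsm := vecRank_submodular (K := K) v
        (X := (A.erase x).filter (φ · ∈ S₁)) (Y := (A.erase y).filter (φ · ∈ S₂))
        (Z₁ := A.filter (φ · ∈ S₁ ∪ S₂)) (Z₂ := A.filter (φ · ∈ (S₁ ∩ S₂).erase (φ x)))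
        (by
          intro z
          simp only [Finset.mem_filter, Finset.mem_union, Finset.mem_erase]
          rintro ⟨hz, hzS⟩
          by_cases hzx : z = x
          · subst hzx
            exact Or.inr ⟨⟨hne, hz⟩, hxy ▸ hy₂⟩
          · by_cases hzy : z = y
            · subst hzy
              exact Or.inl ⟨⟨hzx, hz⟩, hxy ▸ hx₁⟩
            · rcases hzS with h | h
              · exact Or.inl ⟨⟨hzx, hz⟩, h⟩
              · exact Or.inr ⟨⟨hzy, hz⟩, h⟩)
        (by
          intro z
          simp only [Finset.mem_filter, Finset.mem_inter, Finset.mem_erase]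
          rintro ⟨hz, hzx, hz1, hz2⟩
          exact ⟨⟨by rintro rfl; exact hzx rfl, hz⟩, hz1⟩)
        (by
          intro z
          simp only [Finset.mem_filter, Finset.mem_inter, Finset.mem_erase]
          rintro ⟨hz, hzx, hz1, hz2⟩
          exact ⟨⟨by rintro rfl; exact hzx hxy.symm, hz⟩, hz2⟩)
      have e1 := hA (S₁ ∪ S₂)
      have e2 := hA ((S₁ ∩ S₂).erase (φ x))
      have e3 := Finset.card_union_add_card_inter S₁ S₂
      have e4 := Finset.pred_card_le_card_erase (s := S₁ ∩ S₂) (a := φ x)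
      omega

/-- The incidence vector over `𝔽₂` of a potential edge. -/
def incVec {n : ℕ} (e : Sym2 (Fin n)) : Fin n → ZMod 2 :=
  Sym2.lift ⟨fun u v => Pi.single u 1 + Pi.single v 1, fun _ _ => add_comm _ _⟩ e

@[simp] lemma incVec_mk {n : ℕ} (u v : Fin n) :
    incVec s(u, v) = Pi.single u 1 + Pi.single v 1 := rfl

lemma incVec_apply_eq_zero {n : ℕ} {e : Sym2 (Fin n)} {v : Fin n} (h : v ∉ e) :
    incVec e v = 0 := by
  induction e with
  | h x y =>
    simp only [Sym2.mem_iff, not_or] at h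
    simp [h.1, h.2]

lemma incVec_apply_eq_one {n : ℕ} {e : Sym2 (Fin n)} {v : Fin n} (he : ¬ e.IsDiag)
    (h : v ∈ e) : incVec e v = 1 := by
  induction e with
  | h x y =>
    simp only [Sym2.mk_isDiag_iff] at he
    rcases Sym2.mem_iff.1 h with rfl | rfl
    · simp [he]
    · simp [Ne.symm he]

lemma add_self_zmod_two {n : ℕ} (x : Fin n → ZMod 2) : x + x = 0 := by
  ext i
  exact CharTwo.add_self_eq_zero (x i)

lemma incVec_mem_span_of_reachable {n : ℕ} {A : Set (Sym2 (Fin n))} {u v : Fin n}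
    (h : (SimpleGraph.fromEdgeSet A).Reachable u v) :
    incVec s(u, v) ∈ Submodule.span (ZMod 2) (incVec '' A) := by
  obtain ⟨w⟩ := h
  induction w with
  | nil => simp [add_self_zmod_two]
  | @cons a b c hab _ ih =>
    have h1 : incVec s(a, b) ∈ Submodule.span (ZMod 2) (incVec '' A) :=
      Submodule.subset_span ⟨_, ((SimpleGraph.fromEdgeSet_adj A).1 hab).1, rfl⟩
    have h2 := Submodule.add_mem _ h1 ih
    have h3 : incVec s(a, b) + incVec s(b, c) = incVec s(a, c) := by
      simp only [incVec_mk]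
      rw [add_assoc, ← add_assoc (Pi.single b 1), add_self_zmod_two, zero_add]
    rwa [h3] at h2

lemma isAcyclic_of_linearIndepOn {n : ℕ} {T : Set (Sym2 (Fin n))}
    (hT : LinearIndepOn (ZMod 2) incVec T) : (SimpleGraph.fromEdgeSet T).IsAcyclic := by
  rw [SimpleGraph.isAcyclic_iff_forall_adj_isBridge]
  intro u v huv
  have huT : s(u, v) ∈ T := ((SimpleGraph.fromEdgeSet_adj T).1 huv).1
  rw [SimpleGraph.isBridge_iff]
  intro hr
  have hr' : (SimpleGraph.fromEdgeSet (T \ {s(u, v)})).Reachable u v := by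
    refine hr.mono ?_
    rw [SimpleGraph.deleteEdges_fromEdgeSet]
  have h1 := incVec_mem_span_of_reachable hr'
  have h2 : LinearIndepOn (ZMod 2) incVec (insert s(u, v) (T \ {s(u, v)})) := by
    rwa [Set.insert_sdiff_singleton, Set.insert_eq_of_mem huT]
  rw [linearIndepOn_insert (by simp)] at h2
  exact h2.2 h1

lemma card_le_vecRank_add_card_connectedComponent {n : ℕ} (A : Finset (Sym2 (Fin n)))
    {g : SimpleGraph (Fin n)} [Fintype g.ConnectedComponent]
    (hg : g = SimpleGraph.fromEdgeSet (A : Set (Sym2 (Fin n)))) :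
    n ≤ vecRank (K := ZMod 2) incVec A + Fintype.card g.ConnectedComponent := by
  let R : Set (Fin n → ZMod 2) :=
    Set.range fun c : g.ConnectedComponent => Pi.single c.out 1
  have htop : Submodule.span (ZMod 2) (incVec '' (A : Set (Sym2 (Fin n)))) ⊔
      Submodule.span (ZMod 2) R = ⊤ := by
    rw [eq_top_iff, ← (Pi.basisFun (ZMod 2) (Fin n)).span_eq, Submodule.span_le]
    rintro _ ⟨v, rfl⟩
    have hr : g.Reachable v (g.connectedComponentMk v).out :=
      SimpleGraph.ConnectedComponent.exact (Quot.out_eq _).symm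
    have h1 : incVec s(v, (g.connectedComponentMk v).out) ∈
        Submodule.span (ZMod 2) (incVec '' (A : Set (Sym2 (Fin n)))) :=
      incVec_mem_span_of_reachable (by rw [← hg]; exact hr)
    have h2 : (Pi.single (g.connectedComponentMk v).out 1 : Fin n → ZMod 2) ∈
        Submodule.span (ZMod 2) R := Submodule.subset_span ⟨_, rfl⟩
    have h3 := Submodule.add_mem_sup h1 h2
    rw [incVec_mk, add_assoc, add_self_zmod_two, add_zero] at h3
    simpa using h3
  have h1 := Submodule.finrank_add_le_finrank_add_finrank
    (Submodule.span (ZMod 2) (incVec '' (A : Set (Sym2 (Fin n))))) (Submodule.span (ZMod 2) R)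
  rw [htop, finrank_top, Module.finrank_fin_fun] at h1
  have h2 : Module.finrank (ZMod 2) (Submodule.span (ZMod 2) R) ≤
      Fintype.card g.ConnectedComponent := finrank_range_le_card _
  exact h1.trans (add_le_add le_rfl h2)

/-- Every edge of `F` is kept with a color in `S`, and no edge of `B` is. -/
def KeptWithin {n : ℕ} (F B : Finset (Sym2 (Fin n))) (S : Finset (Fin (n - 1)))
    (H : Finset (Sym2 (Fin n))) (φ : Sym2 (Fin n) → Fin (n - 1)) : Prop :=
  (∀ e ∈ F, e ∈ H ∧ φ e ∈ S) ∧ ∀ e ∈ B, e ∈ H → φ e ∉ S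

lemma prColored_mono {n : ℕ} (hn : 2 ≤ n) (G : SimpleGraph (Fin n)) {p : ℝ} (hp0 : 0 ≤ p)
    (hp1 : p ≤ 1) {P Q : Finset (Sym2 (Fin n)) → (Sym2 (Fin n) → Fin (n - 1)) → Prop}
    (h : ∀ H ⊆ G.edgeFinset, ∀ φ, P H φ → Q H φ) :
    prColored n G p P ≤ prColored n G p Q := by
  unfold prColored
  have h1 : (0 : ℝ) ≤ n - 1 := by
    have : (2 : ℝ) ≤ n := by exact_mod_cast hn
    linarith
  have h2 : (0 : ℝ) ≤ 1 - p := by linarith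
  refine Finset.sum_le_sum fun H hH => Finset.sum_le_sum fun φ _ => ?_
  refine mul_le_mul_of_nonneg_left ?_ (by positivity)
  have := h H (Finset.mem_powerset.1 hH) φ
  split_ifs <;> simp_all

lemma prColored_exists_le {n : ℕ} (hn : 2 ≤ n) (G : SimpleGraph (Fin n)) {p : ℝ}
    (hp0 : 0 ≤ p) (hp1 : p ≤ 1) {ι : Type*} (I : Finset ι)
    (Q : ι → Finset (Sym2 (Fin n)) → (Sym2 (Fin n) → Fin (n - 1)) → Prop) :
    prColored n G p (fun H φ => ∃ i ∈ I, Q i H φ) ≤ ∑ i ∈ I, prColored n G p (Q i) := by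
  unfold prColored
  have h1 : (0 : ℝ) ≤ n - 1 := by
    have : (2 : ℝ) ≤ n := by exact_mod_cast hn
    linarith
  have h2 : (0 : ℝ) ≤ 1 - p := by linarith
  rw [Finset.sum_comm (s := I)]
  refine Finset.sum_le_sum fun H _ => ?_
  rw [Finset.sum_comm (s := I)]
  refine Finset.sum_le_sum fun φ _ => ?_
  rw [← Finset.mul_sum]
  refine mul_le_mul_of_nonneg_left ?_ (by positivity)
  have h0 : ∀ i ∈ I, (0 : ℝ) ≤ if Q i H φ then 1 else 0 := fun i _ => by split_ifs <;> simp
  split_ifs with h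
  · obtain ⟨i, hi, hQ⟩ := h
    calc (1 : ℝ) = if Q i H φ then 1 else 0 := by rw [if_pos hQ]
      _ ≤ _ := Finset.single_le_sum (f := fun i => if Q i H φ then (1 : ℝ) else 0) h0 hi
  · exact Finset.sum_nonneg h0

lemma prColored_or_le {n : ℕ} (hn : 2 ≤ n) (G : SimpleGraph (Fin n)) {p : ℝ}
    (hp0 : 0 ≤ p) (hp1 : p ≤ 1)
    (P Q : Finset (Sym2 (Fin n)) → (Sym2 (Fin n) → Fin (n - 1)) → Prop) :
    prColored n G p (fun H φ => P H φ ∨ Q H φ) ≤ prColored n G p P + prColored n G p Q := by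
  have h := prColored_exists_le hn G hp0 hp1 (univ : Finset Bool)
    (fun b => if b then P else Q)
  simpa [or_comm] using h

lemma prColored_keptWithin {n : ℕ} (hn : 2 ≤ n) (G : SimpleGraph (Fin n)) (p : ℝ)
    {F B : Finset (Sym2 (Fin n))} (hF : F ⊆ G.edgeFinset) (hB : B ⊆ G.edgeFinset)
    (hFB : Disjoint F B) (S : Finset (Fin (n - 1))) :
    prColored n G p (KeptWithin F B S) =
      (p * S.card / (n - 1)) ^ F.card * (1 - p * S.card / (n - 1)) ^ B.card := by
  have hn1 : ((n - 1 : ℕ) : ℝ) = (n : ℝ) - 1 := by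
    rw [Nat.cast_sub (by omega)]; simp
  have hn0 : (n : ℝ) - 1 ≠ 0 := by
    have : (2 : ℝ) ≤ n := by exact_mod_cast hn
    intro h; linarith
  set σ : ℝ := S.card / (n - 1) with hσ
  have hSc : ((Sᶜ.card : ℕ) : ℝ) = (n - 1) - S.card := by
    rw [Finset.card_compl, Fintype.card_fin, Nat.cast_sub, hn1]
    simpa using Finset.card_le_univ S
  let a : Sym2 (Fin n) → ℝ := fun e => if e ∈ F then σ else if e ∈ B then 1 - σ else 1
  let b : Sym2 (Fin n) → ℝ := fun e => if e ∈ F then 0 else 1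
  have hinner : ∀ H ∈ G.edgeFinset.powerset,
      ∑ φ : Sym2 (Fin n) → Fin (n - 1), p ^ H.card * (1 - p) ^ (G.edgeFinset.card - H.card) *
        (1 / (n - 1 : ℝ)) ^ Fintype.card (Sym2 (Fin n)) *
        (if KeptWithin F B S H φ then (1 : ℝ) else 0) =
      (∏ e ∈ H, p * a e) * ∏ e ∈ G.edgeFinset \ H, (1 - p) * b e := by
    intro H hH
    rw [Finset.mem_powerset] at hH
    let g : Sym2 (Fin n) → Fin (n - 1) → ℝ := fun e c =>
      (1 / (n - 1 : ℝ)) *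
        if (e ∈ F → e ∈ H ∧ c ∈ S) ∧ (e ∈ B → e ∈ H → c ∉ S) then 1 else 0
    have h1 : ∀ φ : Sym2 (Fin n) → Fin (n - 1),
        (1 / (n - 1 : ℝ)) ^ Fintype.card (Sym2 (Fin n)) *
          (if KeptWithin F B S H φ then (1 : ℝ) else 0) = ∏ e, g e (φ e) := by
      intro φ
      simp only [g]
      rw [Finset.prod_mul_distrib, Finset.prod_const, Finset.card_univ, Finset.prod_ite_zero]
      simp [KeptWithin, forall_and]
    have h2 : ∀ e, ∑ c, g e c =
        if e ∈ H then a e else if e ∈ G.edgeFinset \ H then b e else 1 := by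
      intro e
      simp only [g, a, b]
      rw [← Finset.mul_sum, Finset.sum_boole]
      have hdis : e ∈ F → e ∉ B := fun h h' => Finset.disjoint_left.1 hFB h h'
      have hFe : e ∈ F → e ∈ G.edgeFinset := fun h => hF h
      have cS : (univ.filter (fun c => c ∈ S)) = S := by ext; simp
      have cS' : (univ.filter (fun c => c ∉ S)) = Sᶜ := by ext; simp
      by_cases eF : e ∈ F
      · have := hFe eF
        by_cases eH : e ∈ H
        · simp [eF, eH, hdis eF, cS, hσ]; ring
        · simp only [eF, eH, hdis eF, Finset.mem_sdiff, this]; simp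
      · by_cases eB : e ∈ B
        · by_cases eH : e ∈ H
          · simp [eF, eH, eB, cS', hSc, hσ]; field_simp
          · have := hB eB
            simp only [eF, eH, eB, Finset.mem_sdiff, this]; simp [hn1, hn0]
        · simp [eF, eB, hn1, hn0]
    simp_rw [mul_assoc]
    rw [← Finset.mul_sum, ← Finset.mul_sum]
    simp_rw [h1]
    rw [← Fintype.prod_sum]
    simp_rw [h2]
    rw [Finset.prod_mul_distrib, Finset.prod_mul_distrib, Finset.prod_const, Finset.prod_const,
      Finset.card_sdiff_of_subset hH]
    have h3 : ∏ e, (if e ∈ H then a e else if e ∈ G.edgeFinset \ H then b e else 1) =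
        (∏ e ∈ H, a e) * ∏ e ∈ G.edgeFinset \ H, b e := by
      rw [← Finset.prod_ite_mem_eq H a, ← Finset.prod_ite_mem_eq (G.edgeFinset \ H) b,
        ← Finset.prod_mul_distrib]
      refine Finset.prod_congr rfl fun e _ => ?_
      by_cases eH : e ∈ H <;> simp [eH]
    rw [h3]
    ring
  unfold prColored
  rw [Finset.sum_congr rfl hinner, ← Finset.prod_add]
  have h4 : ∀ e ∈ G.edgeFinset, p * a e + (1 - p) * b e =
      (if e ∈ F then p * S.card / (n - 1) else 1) *
        (if e ∈ B then 1 - p * S.card / (n - 1) else 1) := by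
    intro e _
    simp only [a, b, hσ]
    by_cases eF : e ∈ F
    · simp [eF, Finset.disjoint_left.1 hFB eF]; ring
    · by_cases eB : e ∈ B
      · simp [eF, eB]; ring
      · simp [eF, eB]
  rw [Finset.prod_congr rfl h4, Finset.prod_mul_distrib, Finset.prod_ite_mem,
    Finset.prod_ite_mem, Finset.inter_eq_right.2 hF, Finset.inter_eq_right.2 hB,
    Finset.prod_const, Finset.prod_const]

lemma prColored_add_not {n : ℕ} (hn : 2 ≤ n) (G : SimpleGraph (Fin n)) (p : ℝ)
    (P : Finset (Sym2 (Fin n)) → (Sym2 (Fin n) → Fin (n - 1)) → Prop) :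
    prColored n G p P + prColored n G p (fun H φ => ¬ P H φ) = 1 := by
  have h := prColored_keptWithin hn G p (Finset.empty_subset _) (Finset.empty_subset _)
    (Finset.disjoint_empty_left ∅) ∅
  simp only [Finset.card_empty, pow_zero, mul_one] at h
  rw [← h]
  unfold prColored
  rw [← Finset.sum_add_distrib]
  refine Finset.sum_congr rfl fun H _ => ?_
  rw [← Finset.sum_add_distrib]
  refine Finset.sum_congr rfl fun φ _ => ?_
  by_cases hP : P H φ <;> simp [hP, KeptWithin]

/-- The edges of `G` having an endpoint that is not covered by `F`. -/
noncomputable def uncoveredEdges {n : ℕ} (G : SimpleGraph (Fin n))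
    (F : Finset (Sym2 (Fin n))) : Finset (Sym2 (Fin n)) :=
  G.edgeFinset.filter fun e => ∃ v ∈ e, ∀ f ∈ F, v ∉ f

/-- The edges of `G` between `U` and its complement. -/
noncomputable def crossingEdges {n : ℕ} (G : SimpleGraph (Fin n))
    (U : Finset (Fin n)) : Finset (Sym2 (Fin n)) :=
  G.edgeFinset.filter fun e => ∃ u ∈ U, ∃ v ∉ U, e = s(u, v)

lemma disjoint_uncoveredEdges {n : ℕ} (G : SimpleGraph (Fin n)) (F : Finset (Sym2 (Fin n))) :
    Disjoint F (uncoveredEdges G F) := by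
  rw [Finset.disjoint_left]
  intro e he h
  obtain ⟨v, hv, h'⟩ := (Finset.mem_filter.1 h).2
  exact h' e he hv

lemma card_edgeFinset_le_card_uncoveredEdges {n : ℕ} (G : SimpleGraph (Fin n))
    (F : Finset (Sym2 (Fin n))) :
    G.edgeFinset.card ≤ (uncoveredEdges G F).card + F.card * (2 * F.card + 1) := by
  let V : Finset (Fin n) := F.biUnion fun f => f.toFinset
  have hV : V.card ≤ 2 * F.card := by
    rw [mul_comm]
    refine Finset.card_biUnion_le_card_mul _ _ _ fun f _ => ?_
    rw [Sym2.card_toFinset]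
    split_ifs <;> omega
  have hsub : G.edgeFinset ⊆ uncoveredEdges G F ∪ V.sym2 := by
    intro e he
    by_cases h : e ∈ V.sym2
    · exact Finset.mem_union_right _ h
    · refine Finset.mem_union_left _ (Finset.mem_filter.2 ⟨he, ?_⟩)
      rw [Finset.mem_sym2_iff] at h
      push Not at h
      obtain ⟨v, hv, hvV⟩ := h
      refine ⟨v, hv, fun f hf hvf => hvV ?_⟩
      exact Finset.mem_biUnion.2 ⟨f, hf, Sym2.mem_toFinset.2 hvf⟩
  refine (Finset.card_le_card hsub).trans ((Finset.card_union_le _ _).trans ?_)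
  refine Nat.add_le_add_left ?_ _
  rw [Finset.card_sym2, Nat.choose_two_right]
  apply Nat.div_le_of_le_mul
  simp only [Nat.add_sub_cancel]
  nlinarith

lemma exists_keptWithin_uncoveredEdges {n : ℕ} (G : SimpleGraph (Fin n))
    {H : Finset (Sym2 (Fin n))} (hH : H ⊆ G.edgeFinset) (φ : Sym2 (Fin n) → Fin (n - 1))
    (S : Finset (Fin (n - 1))) :
    ∃ F ⊆ G.edgeFinset, F.card = vecRank (K := ZMod 2) incVec (H.filter (φ · ∈ S)) ∧
      KeptWithin F (uncoveredEdges G F) S H φ := by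
  obtain ⟨F, hF, -, hcard, hspan⟩ :=
    exists_linearIndepOn_card_eq_vecRank (K := ZMod 2) incVec (H.filter (φ · ∈ S))
  refine ⟨F, (hF.trans (Finset.filter_subset _ _)).trans hH, hcard,
    fun e he => Finset.mem_filter.1 (hF he), ?_⟩
  intro e he heH heS
  obtain ⟨heG, v, hv, hvF⟩ := Finset.mem_filter.1 he
  have h1 : incVec e ∈ Submodule.span (ZMod 2) (incVec '' (F : Set (Sym2 (Fin n)))) :=
    hspan ⟨e, by simpa using ⟨heH, heS⟩, rfl⟩
  have h2 : Submodule.span (ZMod 2) (incVec '' (F : Set (Sym2 (Fin n)))) ≤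
      LinearMap.ker (LinearMap.proj (R := ZMod 2) (φ := fun _ : Fin n => ZMod 2) v) := by
    rw [Submodule.span_le]
    rintro _ ⟨f, hf, rfl⟩
    exact incVec_apply_eq_zero (hvF f hf)
  have h3 : incVec e v = 0 := h2 h1
  rw [incVec_apply_eq_one (G.not_isDiag_of_mem_edgeSet (by simpa using heG)) hv] at h3
  exact one_ne_zero h3

lemma card_mul_le_card_crossingEdges {n d : ℕ} {G : SimpleGraph (Fin n)}
    (hG : G.IsRegularOfDegree d) (U : Finset (Fin n)) :
    U.card * (d - U.card) ≤ (crossingEdges G U).card := by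
  let P : Finset (Σ _ : Fin n, Fin n) := U.sigma fun u => G.neighborFinset u \ U
  have h1 : U.card * (d - U.card) ≤ P.card := by
    rw [Finset.card_sigma, ← smul_eq_mul]
    refine Finset.card_nsmul_le_sum _ _ _ fun u _ => ?_
    have h := Finset.le_card_sdiff U (G.neighborFinset u)
    rwa [SimpleGraph.card_neighborFinset_eq_degree, hG.degree_eq u] at h
  refine h1.trans (Finset.card_le_card_of_injOn (fun x => s(x.1, x.2)) ?_ ?_)
  · rintro ⟨u, v⟩ h
    simp only [P, Finset.coe_sigma, Set.mem_sigma_iff, Finset.mem_coe, Finset.mem_sdiff,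
      SimpleGraph.mem_neighborFinset] at h
    simp only [crossingEdges, Finset.mem_coe, Finset.mem_filter, SimpleGraph.mem_edgeFinset,
      SimpleGraph.mem_edgeSet]
    exact ⟨h.2.1, u, h.1, v, h.2.2, rfl⟩
  · rintro ⟨u, v⟩ h ⟨u', v'⟩ h' heq
    simp only [P, Finset.coe_sigma, Set.mem_sigma_iff, Finset.mem_coe, Finset.mem_sdiff,
      SimpleGraph.mem_neighborFinset] at h h'
    simp only [Sym2.eq_iff] at heq
    rcases heq with ⟨rfl, rfl⟩ | ⟨rfl, rfl⟩
    · rfl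
    · exact absurd h.1 h'.2.2

/-- If an edge set has small rank, then some set of vertices of controlled size is a union of
connected components. -/
lemma exists_isolated_set {n K s : ℕ} {b : ℝ} (hb : 0 < b) (hK : n / b ≤ K)
    (A : Finset (Sym2 (Fin n))) (hs : vecRank (K := ZMod 2) incVec A + K < s) :
    ∃ U : Finset (Fin n), (U.card : ℝ) ≤ 2 * b ∧ (b < U.card ∨ n ≤ U.card + s) ∧
      ∀ u ∈ U, ∀ v ∉ U, s(u, v) ∉ A := by
  set g := SimpleGraph.fromEdgeSet (A : Set (Sym2 (Fin n))) with hg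
  let sz : g.ConnectedComponent → ℕ := fun C =>
    (univ.filter fun v => g.connectedComponentMk v = C).card
  let U : Finset g.ConnectedComponent → Finset (Fin n) := fun X =>
    univ.filter fun v => g.connectedComponentMk v ∈ X
  have hU : ∀ X, (U X).card = ∑ C ∈ X, sz C := by
    intro X
    rw [Finset.card_eq_sum_card_fiberwise (f := g.connectedComponentMk) (t := X)]
    · refine Finset.sum_congr rfl fun C hC => ?_
      congr 1
      ext v
      simp only [U, Finset.mem_filter, Finset.mem_univ, true_and, and_iff_right_iff_imp]
      rintro rfl
      exact hC
    · intro v hv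
      simpa [U] using hv
  have hsz : ∀ C, 1 ≤ sz C := by
    intro C
    rw [Nat.one_le_iff_ne_zero, ← Nat.pos_iff_ne_zero, Finset.card_pos]
    obtain ⟨v, hv⟩ := C.exists_rep
    exact ⟨v, Finset.mem_filter.2 ⟨Finset.mem_univ _, hv⟩⟩
  let small : Finset g.ConnectedComponent := univ.filter fun C => (sz C : ℝ) ≤ b
  let big : Finset g.ConnectedComponent := univ.filter fun C => ¬ (sz C : ℝ) ≤ b
  have hbig : big.card ≤ K := by
    have h1 : (big.card : ℝ) * b ≤ n := by
      calc (big.card : ℝ) * b = ∑ C ∈ big, b := by simp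
        _ ≤ ∑ C ∈ big, (sz C : ℝ) :=
            Finset.sum_le_sum fun C hC => (not_le.1 (Finset.mem_filter.1 hC).2).le
        _ = ((U big).card : ℝ) := by rw [hU]; simp
        _ ≤ n := by exact_mod_cast (Finset.card_le_univ _).trans (by simp)
    have h2 : (big.card : ℝ) ≤ K := ((le_div_iff₀ hb).2 h1).trans hK
    exact_mod_cast h2
  have hcount : small.card + big.card = Fintype.card g.ConnectedComponent :=
    Finset.card_filter_add_card_filter_not _
  have hcomp := card_le_vecRank_add_card_connectedComponent A hg
  have hsmall : n ≤ small.card + s := by omega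
  have hiso : ∀ X, ∀ u ∈ U X, ∀ v ∉ U X, s(u, v) ∉ A := by
    intro X u hu v hv huv
    simp only [U, Finset.mem_filter, Finset.mem_univ, true_and] at hu hv
    have hadj : g.Adj u v := by
      rw [hg, SimpleGraph.fromEdgeSet_adj]
      exact ⟨by exact_mod_cast huv, by rintro rfl; exact hv hu⟩
    rw [SimpleGraph.ConnectedComponent.sound hadj.reachable] at hu
    exact hv hu
  obtain ⟨X, hX, hmax⟩ := Finset.exists_max_image
    (small.powerset.filter fun X => ((U X).card : ℝ) ≤ 2 * b) (fun X => X.card)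
    ⟨∅, by simp [U, hb.le]⟩
  simp only [Finset.mem_filter, Finset.mem_powerset] at hX hmax
  refine ⟨U X, hX.2, ?_, hiso X⟩
  by_contra! hcon
  have hXU : X.card ≤ (U X).card := by
    rw [hU, Finset.card_eq_sum_ones]
    exact Finset.sum_le_sum fun C _ => hsz C
  obtain ⟨C, hC, hCX⟩ : ∃ C ∈ small, C ∉ X := by
    by_contra! h
    have := Finset.card_le_card h
    omega
  have h1 := hmax (insert C X) ⟨Finset.insert_subset hC hX.1, by
    rw [hU, Finset.sum_insert hCX, ← hU]
    have := (Finset.mem_filter.1 hC).2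
    push_cast
    linarith [hcon.1]⟩
  rw [Finset.card_insert_of_notMem hCX] at h1
  omega

/-- The bad event for a color set `S`, in terms of an edge set `F` of small size. -/
def FewEdgesEvent {n : ℕ} (G : SimpleGraph (Fin n))
    (x : Finset (Fin (n - 1)) × Finset (Sym2 (Fin n)))
    (H : Finset (Sym2 (Fin n))) (φ : Sym2 (Fin n) → Fin (n - 1)) : Prop :=
  KeptWithin x.2 (uncoveredEdges G x.2) x.1 H φ

/-- The bad event for a color set `S`, in terms of an isolated vertex set `U`. -/
def IsolatedEvent {n : ℕ} (G : SimpleGraph (Fin n))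
    (x : Finset (Fin (n - 1)) × Finset (Fin n))
    (H : Finset (Sym2 (Fin n))) (φ : Sym2 (Fin n) → Fin (n - 1)) : Prop :=
  KeptWithin ∅ (crossingEdges G x.2) x.1 H φ

/-- The pairs of a color set and a small edge set over which the union bound is taken. -/
noncomputable def fewEdgesIndex {n : ℕ} (G : SimpleGraph (Fin n)) (δ : ℝ) :
    Finset (Finset (Fin (n - 1)) × Finset (Sym2 (Fin n))) :=
  (univ ×ˢ G.edgeFinset.powerset).filter fun x =>
    (x.1.card : ℝ) ≤ δ * n ∧ x.2.card < x.1.card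

/-- The pairs of a color set and a vertex set over which the union bound is taken. -/
noncomputable def isolatedIndex (n : ℕ) (δ b : ℝ) :
    Finset (Finset (Fin (n - 1)) × Finset (Fin n)) :=
  univ.filter fun x => δ * n < x.1.card ∧ (x.2.card : ℝ) ≤ 2 * b ∧
    (b < x.2.card ∨ n ≤ x.2.card + x.1.card)

lemma exists_event_of_not_hasRainbowForest {n K : ℕ} (G : SimpleGraph (Fin n))
    {b δ L : ℝ} (hb : 0 < b) (hK : n / b ≤ K) (hL : K + 1 ≤ L)
    {H : Finset (Sym2 (Fin n))} (hH : H ⊆ G.edgeFinset) (φ : Sym2 (Fin n) → Fin (n - 1))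
    (hnot : ¬ HasRainbowForest H φ (n - L)) :
    (∃ x ∈ fewEdgesIndex G δ, FewEdgesEvent G x H φ) ∨
      ∃ x ∈ isolatedIndex n δ b, IsolatedEvent G x H φ := by
  obtain ⟨S, hS⟩ : ∃ S : Finset (Fin (n - 1)),
      vecRank (K := ZMod 2) incVec (H.filter (φ · ∈ S)) + K < S.card := by
    by_contra! h
    obtain ⟨T, hTH, hφ, hT, hcard⟩ := exists_rainbow_linearIndepOn incVec φ K H
      (fun S => le_trans (h S) (le_of_eq (by congr!)))
    refine hnot ⟨T, hTH, isAcyclic_of_linearIndepOn hT, hφ, ?_⟩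
    rw [Fintype.card_fin] at hcard
    have h1 : n ≤ T.card + K + 1 := by omega
    have h2 : (n : ℝ) ≤ T.card + K + 1 := by exact_mod_cast h1
    linarith
  by_cases hSδ : (S.card : ℝ) ≤ δ * n
  · left
    obtain ⟨F, hF, hcard, hkept⟩ := exists_keptWithin_uncoveredEdges G hH φ S
    refine ⟨(S, F), ?_, hkept⟩
    simp only [fewEdgesIndex, Finset.mem_filter, Finset.mem_product, Finset.mem_univ, true_and,
      Finset.mem_powerset]
    exact ⟨hF, hSδ, by omega⟩
  · right
    obtain ⟨U, hU, hU', hiso⟩ := exists_isolated_set hb hK _ hS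
    refine ⟨(S, U), ?_, by simp, ?_⟩
    · simp only [isolatedIndex, Finset.mem_filter, Finset.mem_univ, true_and]
      exact ⟨not_le.1 hSδ, hU, hU'⟩
    · intro e he heH heS
      obtain ⟨-, u, hu, v, hv, rfl⟩ := Finset.mem_filter.1 he
      exact hiso u hu v hv (Finset.mem_filter.2 ⟨heH, heS⟩)

lemma two_mul_card_edgeFinset_eq {n d : ℕ} {G : SimpleGraph (Fin n)}
    (hG : G.IsRegularOfDegree d) : 2 * (G.edgeFinset.card : ℝ) = n * d := by
  have h := G.sum_degrees_eq_twice_card_edges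
  rw [Finset.sum_congr rfl fun v _ => hG.degree_eq v] at h
  simp only [Finset.sum_const, Finset.card_univ, Fintype.card_fin, smul_eq_mul] at h
  exact_mod_cast h.symm

lemma one_sub_pow_le_exp {x : ℝ} (hx : x ≤ 1) (m : ℕ) : (1 - x) ^ m ≤ Real.exp (-(x * m)) := by
  calc (1 - x) ^ m ≤ (Real.exp (-x)) ^ m :=
        pow_le_pow_left₀ (by linarith) (Real.one_sub_le_exp_neg x) m
    _ = Real.exp (-(x * m)) := by rw [← Real.exp_nat_mul]; ring_nf

lemma one_add_pow_le_exp {x : ℝ} (hx : 0 ≤ x) (m : ℕ) : (1 + x) ^ m ≤ Real.exp (m * x) := by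
  calc (1 + x) ^ m ≤ (Real.exp x) ^ m :=
        pow_le_pow_left₀ (by linarith) (by linarith [Real.add_one_le_exp x]) m
    _ = Real.exp (m * x) := by rw [← Real.exp_nat_mul]

/-- Bounds on the probability that an edge is kept with a color from a set of `s` colors. -/
lemma keptProb_bounds {n d s : ℕ} (hn : 2 ≤ n) {ε : ℝ} (hε : 0 < ε) (hd : 0 < (d : ℝ))
    (hp : (2 + ε) * Real.log n / d ≤ 1) (hs : s ≤ n - 1) :
    0 ≤ (2 + ε) * Real.log n / d * s / (n - 1) ∧
    (2 + ε) * Real.log n / d * s / (n - 1) ≤ 1 ∧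
    (2 + ε) * Real.log n * s / (d * n) ≤ (2 + ε) * Real.log n / d * s / (n - 1) ∧
    (2 + ε) * Real.log n / d * s / (n - 1) * (n * d) ≤ 2 * ((2 + ε) * Real.log n * s) := by
  have hn2 : (2 : ℝ) ≤ n := by exact_mod_cast hn
  have hn1 : (0 : ℝ) < n - 1 := by linarith
  have hlog : 0 ≤ Real.log n := Real.log_natCast_nonneg n
  have hs' : (s : ℝ) ≤ n - 1 := by
    have : ((n - 1 : ℕ) : ℝ) = (n : ℝ) - 1 := by rw [Nat.cast_sub (by omega)]; simp
    rw [← this]; exact_mod_cast hs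
  have hp0 : 0 ≤ (2 + ε) * Real.log n / d := by positivity
  refine ⟨by positivity, ?_, ?_, ?_⟩
  · rw [div_le_one hn1]
    calc (2 + ε) * Real.log n / d * s ≤ 1 * s := by gcongr
      _ ≤ n - 1 := by linarith
  · have : (2 + ε) * Real.log n / d * s / (n - 1) =
        (2 + ε) * Real.log n * s / (d * (n - 1)) := by field_simp
    rw [this]
    gcongr
    linarith
  · have : (2 + ε) * Real.log n / d * s / (n - 1) * (n * d) =
        ((2 + ε) * Real.log n * s) * (n / (n - 1)) := by field_simp
    rw [this, mul_comm 2]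
    gcongr
    rw [div_le_iff₀ hn1]
    linarith

lemma prColored_fewEdgesEvent_le {n d : ℕ} (hn : 2 ≤ n) {G : SimpleGraph (Fin n)}
    (hG : G.IsRegularOfDegree d) {ε c δ : ℝ} (hε : 0 < ε) (hd : 0 < (d : ℝ))
    (hcd : c * n ≤ d) (hp : (2 + ε) * Real.log n / d ≤ 1) (hlog : 1 ≤ Real.log n)
    (hδ1 : δ ≤ 1) (hδc : 4 * δ ≤ c * (ε / (4 + 2 * ε)))
    {x : Finset (Fin (n - 1)) × Finset (Sym2 (Fin n))} (hx : x ∈ fewEdgesIndex G δ) :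
    prColored n G ((2 + ε) * Real.log n / d) (FewEdgesEvent G x) ≤
      (Real.log n * Real.exp (-((1 + ε / 4) * Real.log n))) ^ x.1.card *
        ((2 + ε) * Real.log n / d * x.1.card / (n - 1) / Real.log n) ^ x.2.card := by
  obtain ⟨S, F⟩ := x
  simp only [fewEdgesIndex, Finset.mem_filter, Finset.mem_product, Finset.mem_univ, true_and,
    Finset.mem_powerset] at hx
  obtain ⟨hF, hSδ, hFS⟩ := hx
  have hScard : S.card ≤ n - 1 := by simpa using Finset.card_le_univ S
  obtain ⟨h0, h1, hlow, -⟩ := keptProb_bounds hn hε hd hp hScard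
  have heq : prColored n G ((2 + ε) * Real.log n / d) (FewEdgesEvent G (S, F)) = _ :=
    prColored_keptWithin hn G _ hF (Finset.filter_subset _ _) (disjoint_uncoveredEdges G F) S
  rw [heq]
  set ρ := (2 + ε) * Real.log n / d * S.card / (n - 1) with hρ
  have hn0 : (0 : ℝ) < n := by
    have : (2 : ℝ) ≤ n := by exact_mod_cast hn
    linarith
  have hB : (n * d / 2 : ℝ) * (1 - ε / (4 + 2 * ε)) ≤ (uncoveredEdges G F).card := by
    have e1 := card_edgeFinset_le_card_uncoveredEdges G F
    have e2 : F.card * (2 * F.card + 1) ≤ 2 * S.card ^ 2 := by nlinarith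
    have e3 : (G.edgeFinset.card : ℝ) ≤ (uncoveredEdges G F).card + 2 * (S.card : ℝ) ^ 2 := by
      exact_mod_cast e1.trans (Nat.add_le_add_left e2 _)
    have e4 := two_mul_card_edgeFinset_eq hG
    have hδ0 : 0 ≤ δ := by
      have : 0 ≤ δ * n := le_trans (by positivity) hSδ
      exact nonneg_of_mul_nonneg_left this hn0
    have e5 : 4 * (S.card : ℝ) ^ 2 ≤ ε / (4 + 2 * ε) * (n * d) := by
      calc 4 * (S.card : ℝ) ^ 2 ≤ 4 * (δ * n) ^ 2 := by gcongr
        _ = (4 * δ) * δ * n ^ 2 := by ring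
        _ ≤ (4 * δ) * 1 * n ^ 2 := by gcongr
        _ ≤ (c * (ε / (4 + 2 * ε))) * 1 * n ^ 2 := by gcongr
        _ = ε / (4 + 2 * ε) * (n * (c * n)) := by ring
        _ ≤ ε / (4 + 2 * ε) * (n * d) := by gcongr
    nlinarith
  have hexp : (1 + ε / 4) * Real.log n * S.card ≤ ρ * (uncoveredEdges G F).card := by
    have ha : 0 ≤ 1 - ε / (4 + 2 * ε) := by
      rw [sub_nonneg, div_le_one (by positivity)]
      linarith
    calc (1 + ε / 4) * Real.log n * S.card
        = (2 + ε) * Real.log n * S.card / (d * n) *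
          ((n * d / 2 : ℝ) * (1 - ε / (4 + 2 * ε))) := by field_simp; ring
      _ ≤ ρ * (uncoveredEdges G F).card := by gcongr
  have hlog0 : 0 < Real.log n := by linarith
  calc ρ ^ F.card * (1 - ρ) ^ (uncoveredEdges G F).card
      ≤ ρ ^ F.card * Real.exp (-(ρ * (uncoveredEdges G F).card)) := by
        gcongr
        exact one_sub_pow_le_exp h1 _
    _ ≤ ρ ^ F.card * Real.exp (-((1 + ε / 4) * Real.log n * S.card)) := by gcongr
    _ = Real.log n ^ F.card * (Real.exp (-((1 + ε / 4) * Real.log n)) ^ S.card *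
          (ρ / Real.log n) ^ F.card) := by
        have h2 : ρ ^ F.card = Real.log n ^ F.card * (ρ / Real.log n) ^ F.card := by
          rw [← mul_pow, mul_div_cancel₀ _ hlog0.ne']
        rw [← Real.exp_nat_mul, h2]
        ring_nf
    _ ≤ Real.log n ^ S.card * (Real.exp (-((1 + ε / 4) * Real.log n)) ^ S.card *
          (ρ / Real.log n) ^ F.card) := by
        gcongr
    _ = _ := by rw [mul_pow]; ring

lemma sum_prColored_fewEdgesEvent_le {n d : ℕ} (hn : 2 ≤ n) {G : SimpleGraph (Fin n)}
    (hG : G.IsRegularOfDegree d) {ε c δ : ℝ} (hε : 0 < ε) (hd : 0 < (d : ℝ))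
    (hcd : c * n ≤ d) (hp : (2 + ε) * Real.log n / d ≤ 1) (hlog : 1 ≤ Real.log n)
    (hδ1 : δ ≤ 1) (hδc : 4 * δ ≤ c * (ε / (4 + 2 * ε))) :
    ∑ x ∈ fewEdgesIndex G δ, prColored n G ((2 + ε) * Real.log n / d) (FewEdgesEvent G x) ≤
      Real.exp (n * (Real.log n * Real.exp (-((1 + ε / 4) * Real.log n)) *
        Real.exp (2 + ε))) - 1 := by
  have hlog0 : 0 < Real.log n := by linarith
  set E := Real.log n * Real.exp (-((1 + ε / 4) * Real.log n)) with hE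
  have hE0 : 0 ≤ E := by positivity
  set ρ : Finset (Fin (n - 1)) → ℝ := fun S => (2 + ε) * Real.log n / d * S.card / (n - 1)
  have hρ : ∀ S, 0 ≤ ρ S ∧ (G.edgeFinset.card : ℝ) * (ρ S / Real.log n) ≤ S.card * (2 + ε) := by
    intro S
    have hScard : S.card ≤ n - 1 := by simpa using Finset.card_le_univ S
    obtain ⟨h0, -, -, hup⟩ := keptProb_bounds hn hε hd hp hScard
    refine ⟨h0, ?_⟩
    rw [← two_mul_card_edgeFinset_eq hG] at hup
    rw [← mul_div_assoc, div_le_iff₀ hlog0]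
    simp only [ρ]
    linarith
  calc _ ≤ ∑ x ∈ fewEdgesIndex G δ, E ^ x.1.card * (ρ x.1 / Real.log n) ^ x.2.card :=
        Finset.sum_le_sum fun x hx =>
          prColored_fewEdgesEvent_le hn hG hε hd hcd hp hlog hδ1 hδc hx
    _ ≤ ∑ x ∈ (univ.erase ∅) ×ˢ G.edgeFinset.powerset,
          E ^ x.1.card * (ρ x.1 / Real.log n) ^ x.2.card := by
        refine Finset.sum_le_sum_of_subset_of_nonneg ?_ fun x _ _ => ?_
        · intro x hx
          simp only [fewEdgesIndex, Finset.mem_filter, Finset.mem_product, Finset.mem_univ,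
            true_and, Finset.mem_powerset] at hx
          simp only [Finset.mem_product, Finset.mem_erase, Finset.mem_univ, and_true,
            Finset.mem_powerset]
          exact ⟨Finset.card_pos.1 (by omega) |>.ne_empty, hx.1⟩
        · have := (hρ x.1).1
          positivity
    _ = ∑ S ∈ univ.erase ∅, E ^ S.card * (1 + ρ S / Real.log n) ^ G.edgeFinset.card := by
        rw [Finset.sum_product]
        refine Finset.sum_congr rfl fun S _ => ?_
        dsimp only
        rw [← Finset.mul_sum]
        have h := Finset.sum_pow_mul_eq_add_pow (ρ S / Real.log n) 1 G.edgeFinset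
        simp only [one_pow, mul_one] at h
        rw [h, add_comm]
    _ ≤ ∑ S ∈ (univ : Finset (Finset (Fin (n - 1)))).erase ∅,
          (E * Real.exp (2 + ε)) ^ S.card := by
        refine Finset.sum_le_sum fun S _ => ?_
        rw [mul_pow E, ← Real.exp_nat_mul (2 + ε)]
        have h1 : 0 ≤ ρ S / Real.log n := div_nonneg (hρ S).1 hlog0.le
        exact mul_le_mul_of_nonneg_left
          ((one_add_pow_le_exp h1 _).trans (Real.exp_le_exp.2 (hρ S).2)) (by positivity)
    _ = (1 + E * Real.exp (2 + ε)) ^ (n - 1) - 1 := by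
        have h := Fintype.sum_pow_mul_eq_add_pow (Fin (n - 1)) (E * Real.exp (2 + ε)) 1
        simp only [one_pow, mul_one, Fintype.card_fin] at h
        rw [Finset.sum_erase_eq_sub (Finset.mem_univ _), h, add_comm]
        simp
    _ ≤ _ := by
        have h1 : 0 ≤ E * Real.exp (2 + ε) := by positivity
        refine sub_le_sub_right ((one_add_pow_le_exp h1 _).trans (Real.exp_le_exp.2 ?_)) _
        gcongr
        omega

lemma prColored_isolatedEvent_le {n d : ℕ} (hn : 2 ≤ n) {G : SimpleGraph (Fin n)}
    (hG : G.IsRegularOfDegree d) {ε c δ γ : ℝ} (hε : 0 < ε) (hd : 0 < (d : ℝ))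
    (hcd : c * n ≤ d) (hp : (2 + ε) * Real.log n / d ≤ 1)
    (hδ : 0 < δ) (hγ0 : 0 < γ) (hγ : γ ≤ ε / (4 * (2 + ε)))
    {x : Finset (Fin (n - 1)) × Finset (Fin n)} (hx : x ∈ isolatedIndex n δ (γ / 2 * d)) :
    prColored n G ((2 + ε) * Real.log n / d) (IsolatedEvent G x) ≤
      Real.exp (-((1 + ε / 4) * Real.log n)) *
        (Real.exp (-((1 + ε / 4) * Real.log n)) ^ (n - 1 - x.1.card) *
          Real.exp (-((1 + ε / 4) * Real.log n)) ^ x.2.card) +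
      Real.exp (-((2 + ε) * (1 - γ) * δ * min (γ / 2 * c) γ * Real.log n)) ^ n := by
  obtain ⟨S, U⟩ := x
  simp only [isolatedIndex, Finset.mem_filter, Finset.mem_univ, true_and] at hx
  obtain ⟨hSδ, hUb, hU⟩ := hx
  have hScard : S.card ≤ n - 1 := by simpa using Finset.card_le_univ S
  obtain ⟨h0, h1, hlow, -⟩ := keptProb_bounds hn hε hd hp hScard
  have heq : prColored n G ((2 + ε) * Real.log n / d) (IsolatedEvent G (S, U)) = _ :=
    prColored_keptWithin hn G _ (Finset.empty_subset _) (Finset.filter_subset _ _)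
      (Finset.disjoint_empty_left (crossingEdges G U)) S
  rw [heq]
  set ρ := (2 + ε) * Real.log n / d * S.card / (n - 1) with hρ
  have hlog : 0 ≤ Real.log n := Real.log_natCast_nonneg n
  have hn0 : (0 : ℝ) < n := by
    have : (2 : ℝ) ≤ n := by exact_mod_cast hn
    linarith
  have hγ' : γ * (4 * (2 + ε)) ≤ ε := (le_div_iff₀ (by positivity)).1 hγ
  have hγ1 : γ ≤ 1 / 4 := by nlinarith
  have hUd : (U.card : ℝ) ≤ γ * d := by linarith
  have hB : (U.card : ℝ) * ((1 - γ) * d) ≤ (crossingEdges G U).card := by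
    have e1 := card_mul_le_card_crossingEdges hG U
    have e2 : U.card ≤ d := by
      have : (U.card : ℝ) ≤ d := by nlinarith
      exact_mod_cast this
    have e3 : (U.card : ℝ) * (d - U.card) ≤ (crossingEdges G U).card := by
      rw [← Nat.cast_sub e2]
      exact_mod_cast e1
    refine le_trans ?_ e3
    gcongr
    linarith
  have hγ2 : 0 ≤ 1 - γ := by linarith
  have hexp : (2 + ε) * (1 - γ) * (S.card / n) * U.card * Real.log n ≤
      ρ * (crossingEdges G U).card := by
    calc (2 + ε) * (1 - γ) * (S.card / n) * U.card * Real.log n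
        = (2 + ε) * Real.log n * S.card / (d * n) * (U.card * ((1 - γ) * d)) := by
          field_simp
      _ ≤ ρ * (crossingEdges G U).card := by gcongr
  have hmain : ρ ^ (∅ : Finset (Sym2 (Fin n))).card * (1 - ρ) ^ (crossingEdges G U).card ≤
      Real.exp (-((2 + ε) * (1 - γ) * (S.card / n) * U.card * Real.log n)) := by
    rw [Finset.card_empty, pow_zero, one_mul]
    exact (one_sub_pow_le_exp h1 _).trans (Real.exp_le_exp.2 (neg_le_neg hexp))
  refine hmain.trans ?_
  by_cases hcase : (1 - γ) * n ≤ S.card ∧ n ≤ U.card + S.card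
  · obtain ⟨hS, hUS⟩ := hcase
    refine le_trans ?_ (le_add_of_nonneg_right (by positivity))
    rw [← Real.exp_nat_mul, ← Real.exp_nat_mul, ← Real.exp_add, ← Real.exp_add,
      Real.exp_le_exp]
    have e1 : ((n - 1 - S.card : ℕ) : ℝ) + 1 ≤ U.card := by
      have : n - 1 - S.card + 1 ≤ U.card := by omega
      exact_mod_cast this
    have e2 : 1 - γ ≤ S.card / n := by rwa [le_div_iff₀ hn0]
    have e3 : 2 + ε / 2 ≤ (2 + ε) * (1 - γ) * (S.card / n) := by
      calc 2 + ε / 2 ≤ (2 + ε) * (1 - γ) * (1 - γ) := by nlinarith [sq_nonneg γ]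
        _ ≤ _ := by gcongr
    have e4 : (2 + ε / 2) * (U.card * Real.log n) ≤
        (2 + ε) * (1 - γ) * (S.card / n) * (U.card * Real.log n) := by gcongr
    have e5 : (1 + ε / 4) * Real.log n * (((n - 1 - S.card : ℕ) : ℝ) + 1) ≤
        (1 + ε / 4) * Real.log n * U.card := by gcongr
    linarith
  · have hUlow : min (γ / 2 * c) γ * n ≤ U.card := by
      rcases hU with h | h
      · calc min (γ / 2 * c) γ * n ≤ γ / 2 * c * n := by gcongr; exact min_le_left _ _
          _ = γ / 2 * (c * n) := by ring
          _ ≤ γ / 2 * d := by gcongr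
          _ ≤ U.card := h.le
      · have hS : (S.card : ℝ) < (1 - γ) * n := by
          by_contra! hS
          exact hcase ⟨hS, h⟩
        have h' : (n : ℝ) ≤ U.card + S.card := by exact_mod_cast h
        calc min (γ / 2 * c) γ * n ≤ γ * n := by gcongr; exact min_le_right _ _
          _ ≤ U.card := by linarith
    refine le_trans ?_ (le_add_of_nonneg_left (by positivity))
    rw [← Real.exp_nat_mul, Real.exp_le_exp]
    have e1 : δ ≤ S.card / n := by
      rw [le_div_iff₀ hn0]
      exact hSδ.le
    have e2 : (2 + ε) * (1 - γ) * δ * (min (γ / 2 * c) γ * n) * Real.log n ≤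
        (2 + ε) * (1 - γ) * (S.card / n) * U.card * Real.log n := by
      have : (2 + ε) * (1 - γ) * δ * (min (γ / 2 * c) γ * n) ≤
          (2 + ε) * (1 - γ) * δ * U.card := by gcongr
      have h' : (2 + ε) * (1 - γ) * δ * U.card ≤
          (2 + ε) * (1 - γ) * (S.card / n) * U.card := by gcongr
      exact mul_le_mul_of_nonneg_right (this.trans h') hlog
    linarith

lemma sum_prColored_isolatedEvent_le {n d : ℕ} (hn : 2 ≤ n) {G : SimpleGraph (Fin n)}
    (hG : G.IsRegularOfDegree d) {ε c δ γ : ℝ} (hε : 0 < ε) (hd : 0 < (d : ℝ))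
    (hcd : c * n ≤ d) (hp : (2 + ε) * Real.log n / d ≤ 1)
    (hδ : 0 < δ) (hγ0 : 0 < γ) (hγ : γ ≤ ε / (4 * (2 + ε))) :
    ∑ x ∈ isolatedIndex n δ (γ / 2 * d),
        prColored n G ((2 + ε) * Real.log n / d) (IsolatedEvent G x) ≤
      Real.exp (-((1 + ε / 4) * Real.log n)) *
        Real.exp (2 * (n * Real.exp (-((1 + ε / 4) * Real.log n)))) +
      (4 * Real.exp (-((2 + ε) * (1 - γ) * δ * min (γ / 2 * c) γ * Real.log n))) ^ n := by
  set z := Real.exp (-((1 + ε / 4) * Real.log n)) with hz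
  set q := Real.exp (-((2 + ε) * (1 - γ) * δ * min (γ / 2 * c) γ * Real.log n)) with hq
  have hz0 : 0 ≤ z := (Real.exp_pos _).le
  have hq0 : 0 ≤ q := (Real.exp_pos _).le
  calc _ ≤ ∑ x ∈ isolatedIndex n δ (γ / 2 * d),
          (z * (z ^ (n - 1 - x.1.card) * z ^ x.2.card) + q ^ n) :=
        Finset.sum_le_sum fun x hx =>
          prColored_isolatedEvent_le hn hG hε hd hcd hp hδ hγ0 hγ hx
    _ ≤ ∑ x : Finset (Fin (n - 1)) × Finset (Fin n),
          (z * (z ^ (n - 1 - x.1.card) * z ^ x.2.card) + q ^ n) :=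
        Finset.sum_le_sum_of_subset_of_nonneg (Finset.subset_univ _) fun x _ _ => by positivity
    _ = z * ((1 + z) ^ (n - 1) * (1 + z) ^ n) + 2 ^ (n - 1) * 2 ^ n * q ^ n := by
        rw [Finset.sum_add_distrib, ← Finset.mul_sum, Fintype.sum_prod_type]
        congr 1
        · congr 1
          have h1 := Fintype.sum_pow_mul_eq_add_pow (Fin (n - 1)) 1 z
          have h2 := Fintype.sum_pow_mul_eq_add_pow (Fin n) z 1
          simp only [one_pow, mul_one, one_mul, Fintype.card_fin] at h1 h2
          rw [← h1, add_comm 1 z, ← h2, Finset.sum_mul_sum]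
        · simp
    _ ≤ z * (Real.exp (n * z) * Real.exp (n * z)) + 2 ^ n * 2 ^ n * q ^ n := by
        have h1 : (1 + z) ^ (n - 1) ≤ Real.exp (n * z) :=
          (pow_le_pow_right₀ (by linarith) (by omega)).trans (one_add_pow_le_exp hz0 n)
        have h2 := one_add_pow_le_exp hz0 n
        gcongr
        · norm_num
        · omega
    _ = _ := by
        rw [← Real.exp_add, ← two_mul, mul_pow, ← mul_pow 2 2]
        norm_num

lemma tendsto_log_mul_exp_neg {a : ℝ} (ha : 0 < a) :
    Tendsto (fun n : ℕ => Real.log n * Real.exp (-(a * Real.log n))) atTop (nhds 0) := by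
  have h1 : Tendsto (fun n : ℕ => Real.log n) atTop atTop :=
    Real.tendsto_log_atTop.comp tendsto_natCast_atTop_atTop
  have h2 : Tendsto (fun x : ℝ => x * Real.exp (-(a * x))) atTop (nhds 0) := by
    have h3 := Real.tendsto_pow_mul_exp_neg_atTop_nhds_zero 1
    have h4 := (h3.comp (tendsto_id.const_mul_atTop ha)).const_mul a⁻¹
    rw [mul_zero] at h4
    refine h4.congr fun x => ?_
    simp only [Function.comp_apply, id, pow_one]
    field_simp
  exact h2.comp h1

lemma tendsto_exp_neg_log {a : ℝ} (ha : 0 < a) :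
    Tendsto (fun n : ℕ => Real.exp (-(a * Real.log n))) atTop (nhds 0) := by
  have h1 : Tendsto (fun n : ℕ => Real.log n) atTop atTop :=
    Real.tendsto_log_atTop.comp tendsto_natCast_atTop_atTop
  exact Real.tendsto_exp_neg_atTop_nhds_zero.comp (h1.const_mul_atTop ha)

lemma natCast_mul_exp_neg_log {a : ℝ} {n : ℕ} (hn : 0 < n) :
    n * Real.exp (-((1 + a) * Real.log n)) = Real.exp (-(a * Real.log n)) := by
  have hn0 : (0 : ℝ) < n := by exact_mod_cast hn
  nth_rewrite 1 [← Real.exp_log hn0]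
  rw [← Real.exp_add]
  ring_nf

lemma tendsto_fewEdges_bound {ε : ℝ} (hε : 0 < ε) :
    Tendsto (fun n : ℕ => Real.exp (n * (Real.log n * Real.exp (-((1 + ε / 4) * Real.log n)) *
        Real.exp (2 + ε))) - 1) atTop (nhds 0) := by
  have h1 := (tendsto_log_mul_exp_neg (a := ε / 4) (by positivity)).mul_const (Real.exp (2 + ε))
  rw [zero_mul] at h1
  have h2 := (Real.continuous_exp.tendsto 0).comp h1
  rw [Real.exp_zero] at h2
  have h3 := h2.sub_const 1
  rw [sub_self] at h3
  refine h3.congr' ?_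
  filter_upwards [eventually_gt_atTop 0] with n hn
  simp only [Function.comp_apply]
  rw [← natCast_mul_exp_neg_log hn]
  ring_nf

lemma tendsto_isolated_bound {ε q : ℝ} (hε : 0 < ε) (hq : 0 < q) :
    Tendsto (fun n : ℕ => Real.exp (-((1 + ε / 4) * Real.log n)) *
        Real.exp (2 * (n * Real.exp (-((1 + ε / 4) * Real.log n)))) +
      (4 * Real.exp (-(q * Real.log n))) ^ n) atTop (nhds 0) := by
  have h1 := tendsto_exp_neg_log (a := 1 + ε / 4) (by positivity)
  have h2 := (tendsto_exp_neg_log (a := ε / 4) (by positivity)).const_mul 2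
  rw [mul_zero] at h2
  have h3 := (Real.continuous_exp.tendsto 0).comp h2
  have h4 := h1.mul h3
  rw [zero_mul] at h4
  have h5 := (tendsto_exp_neg_log hq).const_mul 4
  rw [mul_zero] at h5
  have h6 : Tendsto (fun n : ℕ => (4 * Real.exp (-(q * Real.log n))) ^ n) atTop (nhds 0) := by
    refine squeeze_zero' (Eventually.of_forall fun n => by positivity) ?_ h5
    filter_upwards [h5.eventually_le_const one_pos, eventually_gt_atTop 0] with n hn hn0
    exact pow_le_of_le_one (by positivity) hn hn0.ne'
  rw [← add_zero (0 : ℝ)]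
  refine (h4.congr' ?_).add h6
  filter_upwards [eventually_gt_atTop 0] with n hn
  simp only [Function.comp_apply]
  rw [natCast_mul_exp_neg_log hn]

/-- If `G = G(n)` is a `d`-regular graph on `n` vertices with `d ≥ c·n`, and
`p = (2 + ε)·(log n)/d`, then a.a.s. the random subgraph `G_p`, with edges colored
uniformly at random from `{1, …, n − 1}`, contains a rainbow forest with at least
`n − (log n)³` edges. -/
theorem rainbow_forest_aas (ε c : ℝ) (hε : 0 < ε) (hc : 0 < c)
    (d : ℕ → ℕ) (G : ∀ n : ℕ, SimpleGraph (Fin n))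
    (hG : ∀ᶠ n : ℕ in atTop,
      (G n).IsRegularOfDegree (d n) ∧ c * n ≤ (d n : ℝ)) :
    Tendsto (fun n : ℕ =>
        prColored n (G n) ((2 + ε) * Real.log n / d n)
          (fun H φ => HasRainbowForest H φ ((n : ℝ) - (Real.log n) ^ 3)))
      atTop (nhds 1) := by
  set γ : ℝ := ε / (4 * (2 + ε)) with hγ
  have hγ0 : 0 < γ := by positivity
  have hγ1 : γ < 1 := by
    rw [hγ, div_lt_one (by positivity)]
    linarith
  set δ : ℝ := min 1 (c * (ε / (4 + 2 * ε)) / 4) with hδ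
  have hδ0 : 0 < δ := lt_min one_pos (by positivity)
  have hδc : 4 * δ ≤ c * (ε / (4 + 2 * ε)) := by
    have := min_le_right 1 (c * (ε / (4 + 2 * ε)) / 4)
    linarith
  have hq : 0 < (2 + ε) * (1 - γ) * δ * min (γ / 2 * c) γ := by
    have h1 : 0 < 1 - γ := by linarith
    have h2 : 0 < min (γ / 2 * c) γ := lt_min (by positivity) hγ0
    positivity
  obtain ⟨K, hK⟩ := exists_nat_ge (1 / (γ / 2 * c))
  have hlogtop : Tendsto (fun n : ℕ => Real.log n) atTop atTop :=
    Real.tendsto_log_atTop.comp tendsto_natCast_atTop_atTop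
  have hbound := ((tendsto_fewEdges_bound hε).add (tendsto_isolated_bound hε hq)).const_sub 1
  rw [add_zero, sub_zero] at hbound
  have hpsmall : ∀ᶠ n : ℕ in atTop, (2 + ε) * Real.log n ≤ c * n := by
    have h := Real.isLittleO_log_id_atTop.bound (c := c / (2 + ε)) (by positivity)
    filter_upwards [tendsto_natCast_atTop_atTop.eventually h, eventually_ge_atTop 1]
      with n hn hn1
    have hlog : 0 ≤ Real.log n := Real.log_natCast_nonneg n
    simp only [id, Real.norm_eq_abs, abs_of_nonneg hlog, Nat.abs_cast] at hn
    rw [div_mul_eq_mul_div, le_div_iff₀ (by positivity)] at hn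
    linarith
  have hev : ∀ᶠ n : ℕ in atTop, 2 ≤ n ∧ (G n).IsRegularOfDegree (d n) ∧ c * n ≤ (d n : ℝ) ∧
      0 < (d n : ℝ) ∧ 0 ≤ (2 + ε) * Real.log n / d n ∧ (2 + ε) * Real.log n / d n ≤ 1 ∧
      1 ≤ Real.log n ∧ (K : ℝ) + 1 ≤ Real.log n := by
    filter_upwards [hG, hpsmall, eventually_ge_atTop 2,
      hlogtop.eventually_ge_atTop ((K : ℝ) + 1)] with n hn hp hn2 hKn
    have hn0 : (0 : ℝ) < n := by exact_mod_cast (by omega : 0 < n)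
    have hd : 0 < (d n : ℝ) := lt_of_lt_of_le (by positivity) hn.2
    have hK0 : (0 : ℝ) ≤ K := Nat.cast_nonneg K
    have hlog : 1 ≤ Real.log n := by linarith
    refine ⟨hn2, hn.1, hn.2, hd, by positivity, ?_, hlog, hKn⟩
    rw [div_le_one hd]
    exact hp.trans hn.2
  refine tendsto_of_tendsto_of_tendsto_of_le_of_le' hbound tendsto_const_nhds ?_ ?_
  · filter_upwards [hev] with n ⟨hn, hreg, hcd, hd, hp0, hp1, hlog, hKn⟩
    have hnot := prColored_add_not hn (G n) ((2 + ε) * Real.log n / d n)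
      (fun H φ => HasRainbowForest H φ ((n : ℝ) - (Real.log n) ^ 3))
    have hb : 0 < γ / 2 * (d n : ℝ) := by positivity
    have hKb : n / (γ / 2 * (d n : ℝ)) ≤ K := by
      refine le_trans ?_ hK
      rw [div_le_div_iff₀ hb (by positivity), one_mul]
      calc n * (γ / 2 * c) = γ / 2 * (c * n) := by ring
        _ ≤ γ / 2 * d n := by gcongr
    have hL : (K : ℝ) + 1 ≤ Real.log n ^ 3 :=
      hKn.trans (le_self_pow₀ hlog (by norm_num))
    have hmono := prColored_mono hn (G n) hp0 hp1 (fun H hH φ h =>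
      exists_event_of_not_hasRainbowForest (δ := δ) (G n) hb hKb hL hH φ h)
    have h1 := prColored_or_le hn (G n) hp0 hp1
      (fun H φ => ∃ x ∈ fewEdgesIndex (G n) δ, FewEdgesEvent (G n) x H φ)
      (fun H φ => ∃ x ∈ isolatedIndex n δ (γ / 2 * d n), IsolatedEvent (G n) x H φ)
    have h2 := prColored_exists_le hn (G n) hp0 hp1 (fewEdgesIndex (G n) δ)
      (FewEdgesEvent (G n))
    have h3 := prColored_exists_le hn (G n) hp0 hp1 (isolatedIndex n δ (γ / 2 * d n))
      (IsolatedEvent (G n))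
    have h4 := sum_prColored_fewEdgesEvent_le hn hreg hε hd hcd hp1 hlog
      (min_le_left _ _) hδc
    have h5 := sum_prColored_isolatedEvent_le hn hreg hε hd hcd hp1 hδ0 hγ0 le_rfl
    linarith
  · filter_upwards [hev] with n ⟨hn, _, _, _, hp0, hp1, _, _⟩
    have h1 := prColored_keptWithin hn (G n) ((2 + ε) * Real.log n / d n)
      (Finset.empty_subset _) (Finset.empty_subset _) (Finset.disjoint_empty_left ∅) ∅
    simp only [Finset.card_empty, pow_zero, mul_one] at h1
    rw [← h1]
    exact prColored_mono hn (G n) hp0 hp1 fun H _ φ _ => by simp [KeptWithin]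
end
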